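/- Whenever constants satisfy the hierarchy 0 < 1/n ≪ φ ≪ ε ≪ γ ≪ 1, the following holds: if H is a 3-graph on n vertices with δ₂(H) ≥ (1/2 − γ)n and H is not 3γ-extremal, then there exists a set W ⊆ V(H) with |W| ≤ εn such that for every U ⊆ V(H) ∖ W with |U| ≤ φn and |U| divisible by 4, both H[W] and H[U ∪ W] contain K₄⁻-factors. -/

import Mathlib

open Finset

/-- `H` is the edge set of a 3-uniform hypergraph (3-graph) on `Fin n`. -/
def Is3Graph (n : ℕ) (H : Finset (Finset (Fin n))) : Prop :=
  ∀ e ∈ H, e.card = 3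

/-- `degOn H x y U` : number of `z ∈ U` with `{x,y,z} ∈ H`, i.e. `deg_H(xy, U)`. -/
def degOn {n : ℕ} (H : Finset (Finset (Fin n))) (x y : Fin n) (U : Finset (Fin n)) : ℕ :=
  (U.filter fun z => ({x, y, z} : Finset (Fin n)) ∈ H).card

/-- The minimum codegree `δ₂(H)` is at least `t`. -/
def CodegLB {n : ℕ} (H : Finset (Finset (Fin n))) (t : ℝ) : Prop :=
  ∀ x y : Fin n, x ≠ y → t ≤ (degOn H x y Finset.univ : ℝ)

/-- `S` spans a copy of `K₄⁻` in `H`: it has 4 vertices and at least 3 of its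
four 3-subsets are edges. -/
def SpansK4m {n : ℕ} (H : Finset (Finset (Fin n))) (S : Finset (Fin n)) : Prop :=
  S.card = 4 ∧ 3 ≤ ((S.powersetCard 3).filter (· ∈ H)).card

/-- `S` spans a copy of `K₄³` (the complete 3-graph on 4 vertices) in `H`. -/
def SpansK43 {n : ℕ} (H : Finset (Finset (Fin n))) (S : Finset (Fin n)) : Prop :=
  S.card = 4 ∧ ((S.powersetCard 3).filter (· ∈ H)).card = 4

/-- The induced subgraph `H[X]` contains a `K₄⁻`-factor. -/
def HasK4mFactorOn {n : ℕ} (H : Finset (Finset (Fin n))) (X : Finset (Fin n)) : Prop :=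
  ∃ P : Finset (Finset (Fin n)),
    (∀ S ∈ P, SpansK4m H S) ∧
    (∀ S ∈ P, ∀ T ∈ P, S ≠ T → Disjoint S T) ∧
    P.biUnion id = X

/-- `S` is an `(x,y)`-connector of length `c` in `H`. -/
def IsConnector {n : ℕ} (H : Finset (Finset (Fin n))) (c : ℕ) (x y : Fin n)
    (S : Finset (Fin n)) : Prop :=
  x ∉ S ∧ y ∉ S ∧ S.card = 4 * c - 1 ∧
    HasK4mFactorOn H (insert x S) ∧ HasK4mFactorOn H (insert y S)

/-- `x` and `y` are `(c,η)`-close in `H` (a 3-graph on `n` vertices). -/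
def Close {n : ℕ} (H : Finset (Finset (Fin n))) (c : ℕ) (η : ℝ) (x y : Fin n) : Prop :=
  η * (n : ℝ) ^ (4 * c - 1) ≤ ({S : Finset (Fin n) | IsConnector H c x y S}.ncard : ℝ)

/-- `U` is `(c,η)`-closed in `H`. -/
def ClosedOn {n : ℕ} (H : Finset (Finset (Fin n))) (c : ℕ) (η : ℝ)
    (U : Finset (Fin n)) : Prop :=
  ∀ x ∈ U, ∀ y ∈ U, x ≠ y → Close H c η x y

/-- The number of `(X,Y)`-bridges `(x,y,S)` of length `c` in `H`. -/
noncomputable def BridgeCount {n : ℕ} (H : Finset (Finset (Fin n))) (c : ℕ)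
    (X Y : Finset (Fin n)) : ℕ :=
  {t : Fin n × Fin n × Finset (Fin n) |
    t.1 ∈ X ∧ t.2.1 ∈ Y ∧ IsConnector H c t.1 t.2.1 t.2.2}.ncard

/-- The 3-graph `𝓑[A,B]`: all triples in `A ∪ B` containing an odd number of
vertices of `A`. -/
def BGraph {n : ℕ} (A B : Finset (Fin n)) : Finset (Finset (Fin n)) :=
  ((A ∪ B).powersetCard 3).filter fun e => (e ∩ A).card % 2 = 1

/-- `H` (a 3-graph on `n` vertices) is `γ`-extremal. -/
def IsExtremal {n : ℕ} (H : Finset (Finset (Fin n))) (γ : ℝ) : Prop :=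
  ∃ A B : Finset (Fin n), Disjoint A B ∧ A ∪ B = Finset.univ ∧
    A.card = n / 2 ∧ B.card = n - n / 2 ∧
    ((BGraph A B \ H).card : ℝ) ≤ γ * (n : ℝ) ^ 3

/-- The number of `V₁V₂V₃`-edges of `H`. -/
def eCount {n : ℕ} (H : Finset (Finset (Fin n))) (A B C : Finset (Fin n)) : ℕ :=
  (H.filter fun e => ∃ a ∈ A, ∃ b ∈ B, ∃ c ∈ C, e = {a, b, c}).card

/-- `Ñ_{c,η}(x)` : the set of vertices `(c,η)`-close to `x` in `H`. -/
def Ntilde {n : ℕ} (H : Finset (Finset (Fin n))) (c : ℕ) (η : ℝ) (x : Fin n) :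
    Set (Fin n) :=
  {y | y ≠ x ∧ Close H c η x y}

/-- The triple `{x,x',y}` is `(ρ,X,Y)`-typical. -/
def TypicalTriple {n : ℕ} (H : Finset (Finset (Fin n))) (ρ : ℝ) (X Y : Finset (Fin n))
    (x x' y : Fin n) : Prop :=
  (Y.card : ℝ) - ρ * n ≤ (degOn H x x' Y : ℝ) ∧
  (((X.filter fun z => ({x, y, z} : Finset (Fin n)) ∈ H ∧
      ({x', y, z} : Finset (Fin n)) ∈ H).card : ℝ) ≤ ρ * n) ∧
  (X.card : ℝ) - ρ * n ≤ (degOn H x y X : ℝ) + (degOn H x' y X : ℝ)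

/-- `Q` spans an `(X,Y)`-bridge of length 1, i.e. `Q = {a,b} ∪ S` for some
`(X,Y)`-bridge `(a,b,S)` of length 1. -/
def SpansBridge1 {n : ℕ} (H : Finset (Finset (Fin n))) (X Y Q : Finset (Fin n)) : Prop :=
  ∃ a ∈ X, ∃ b ∈ Y, ∃ S : Finset (Fin n), IsConnector H 1 a b S ∧
    Q = insert a (insert b S)

/-- real-valued indicator of a proposition -/
noncomputable def ind (P : Prop) : ℝ := open Classical in if P then 1 else 0

lemma ind_nonneg (P : Prop) : 0 ≤ ind P := by unfold ind; split_ifs <;> norm_num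
lemma ind_le_one (P : Prop) : ind P ≤ 1 := by unfold ind; split_ifs <;> norm_num
lemma ind_pos {P : Prop} (h : P) : ind P = 1 := by simp [ind, h]
lemma ind_neg {P : Prop} (h : ¬ P) : ind P = 0 := by simp [ind, h]
lemma ind_mono {P Q : Prop} (h : P → Q) : ind P ≤ ind Q := by
  by_cases hP : P
  · rw [ind_pos hP, ind_pos (h hP)]
  · rw [ind_neg hP]; exact ind_nonneg _
lemma ind_and (P Q : Prop) : ind (P ∧ Q) = ind P * ind Q := by
  by_cases hP : P <;> by_cases hQ : Q <;> simp [ind, hP, hQ]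
lemma ind_or_le (P Q : Prop) : ind (P ∨ Q) ≤ ind P + ind Q := by
  by_cases hP : P <;> by_cases hQ : Q <;> simp [ind, hP, hQ]
lemma ind_forall {I : Type*} [Fintype I] (P : I → Prop) : ind (∀ i, P i) = ∏ i, ind (P i) := by
  by_cases h : ∀ i, P i
  · rw [ind_pos h, prod_eq_one]; intro i _; exact ind_pos (h i)
  · rw [ind_neg h]; push Not at h; obtain ⟨i, hi⟩ := h
    rw [prod_eq_zero (mem_univ i) (ind_neg hi)]

/-- number of elements satisfying a predicate -/
noncomputable def cnt {Ω : Type*} [Fintype Ω] (P : Ω → Prop) : ℝ := ∑ ω, ind (P ω)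

lemma cnt_nonneg {Ω : Type*} [Fintype Ω] (P : Ω → Prop) : 0 ≤ cnt P :=
  sum_nonneg fun _ _ => ind_nonneg _
lemma cnt_mono {Ω : Type*} [Fintype Ω] {P Q : Ω → Prop} (h : ∀ ω, P ω → Q ω) : cnt P ≤ cnt Q :=
  sum_le_sum fun ω _ => ind_mono (h ω)
lemma cnt_eq_card {Ω : Type*} [Fintype Ω] (P : Ω → Prop) [DecidablePred P] :
    cnt P = ((univ.filter P).card : ℝ) := by
  unfold cnt ind
  rw [card_filter]; push_cast
  refine sum_congr rfl fun ω _ => ?_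
  split_ifs <;> rfl
lemma cnt_le_card {Ω : Type*} [Fintype Ω] (P : Ω → Prop) : cnt P ≤ Fintype.card Ω := by
  classical
  rw [cnt_eq_card]; exact_mod_cast card_le_univ _
lemma cnt_or_le {Ω : Type*} [Fintype Ω] (P Q : Ω → Prop) :
    cnt (fun ω => P ω ∨ Q ω) ≤ cnt P + cnt Q := by
  unfold cnt; rw [← sum_add_distrib]; exact sum_le_sum fun ω _ => ind_or_le _ _
lemma cnt_exists_le {Ω I : Type*} [Fintype Ω] (s : Finset I) (P : I → Ω → Prop) :
    cnt (fun ω => ∃ i ∈ s, P i ω) ≤ ∑ i ∈ s, cnt (P i) := by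
  unfold cnt; rw [sum_comm]
  refine sum_le_sum fun ω _ => ?_
  by_cases h : ∃ i ∈ s, P i ω
  · obtain ⟨i, hi, hP⟩ := h
    calc ind _ ≤ 1 := ind_le_one _
      _ = ind (P i ω) := (ind_pos hP).symm
      _ ≤ _ := single_le_sum (f := fun i => ind (P i ω)) (fun _ _ => ind_nonneg _) hi
  · rw [ind_neg h]; exact sum_nonneg fun _ _ => ind_nonneg _
lemma cnt_equiv {Ω Ω' : Type*} [Fintype Ω] [Fintype Ω'] (e : Ω ≃ Ω') (P : Ω' → Prop) :
    cnt (fun ω => P (e ω)) = cnt P := Fintype.sum_equiv e _ _ (fun _ => rfl)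
lemma cnt_exists {Ω : Type*} [Fintype Ω] {P : Ω → Prop} (h : 0 < cnt P) : ∃ ω, P ω := by
  by_contra hc; push Not at hc
  have : cnt P = 0 := sum_eq_zero fun ω _ => ind_neg (hc ω)
  linarith

lemma cnt_prod {A B : Type*} [Fintype A] [Fintype B] (Q : A → Prop) (R : A → B → Prop)
    (x y : ℝ) (hy : 0 ≤ y) (h1 : x ≤ cnt Q) (h2 : ∀ a, Q a → y ≤ cnt (R a)) :
    x * y ≤ cnt (fun p : A × B => Q p.1 ∧ R p.1 p.2) := by
  unfold cnt
  rw [Fintype.sum_prod_type]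
  simp only [ind_and, ← mul_sum]
  calc x * y ≤ (∑ a, ind (Q a)) * y := mul_le_mul_of_nonneg_right h1 hy
    _ = ∑ a, ind (Q a) * y := by rw [sum_mul]
    _ ≤ _ := by
      refine sum_le_sum fun a _ => ?_
      by_cases ha : Q a
      · exact mul_le_mul_of_nonneg_left (h2 a ha) (ind_nonneg _)
      · simp [ind_neg ha]

lemma cnt_pi {I A : Type*} [Fintype I] [DecidableEq I] [Fintype A] (R : I → A → Prop) :
    cnt (fun g : I → A => ∀ i, R i (g i)) = ∏ i, cnt (R i) := by
  unfold cnt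
  simp only [ind_forall]
  rw [Finset.prod_univ_sum]
  simp

lemma cnt_comb {J1 I J V : Type} [Fintype J1] [Fintype I] [Fintype J] [Fintype V]
    [DecidableEq J1] [DecidableEq I] [DecidableEq J]
    (Q1 : (J1 → V) → Prop) (R : (J1 → V) → I → (J → V) → Prop) (x y : ℝ) (hy : 0 ≤ y)
    (h1 : x ≤ cnt Q1) (h2 : ∀ a, Q1 a → ∀ i, y ≤ cnt (R a i)) :
    x * y ^ Fintype.card I ≤ cnt (fun ω : J1 ⊕ (I × J) → V =>
      Q1 (fun j => ω (.inl j)) ∧ ∀ i, R (fun j => ω (.inl j)) i (fun j => ω (.inr (i, j)))) := by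
  have key := cnt_prod (A := J1 → V) (B := I → J → V) Q1 (fun a g => ∀ i, R a i (g i)) x
    (y ^ Fintype.card I) (by positivity) h1 (by
      intro a ha
      rw [cnt_pi]
      calc y ^ Fintype.card I = ∏ _i : I, y := by simp
        _ ≤ _ := prod_le_prod (fun _ _ => hy) (fun i _ => h2 a ha i))
  refine key.trans (le_of_eq ?_)
  let e : (J1 ⊕ (I × J) → V) ≃ (J1 → V) × (I → J → V) :=
    (Equiv.sumArrowEquivProdArrow J1 (I × J) V).trans
      (Equiv.prodCongr (Equiv.refl _) (Equiv.curry I J V))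
  exact (cnt_equiv e _).symm

lemma cnt_eval_eq {J V : Type} [Fintype J] [DecidableEq J] [Fintype V] [DecidableEq V]
    (P : (J → V) → Prop) (j : J) (h : ∀ ω ω', P ω → P ω' → (∀ i, i ≠ j → ω i = ω' i) → ω = ω') :
    cnt P * Fintype.card V ≤ (Fintype.card V : ℝ) ^ Fintype.card J := by
  classical
  rw [cnt_eq_card]
  have : (univ.filter P ×ˢ (univ : Finset V)).card ≤ (univ : Finset (J → V)).card := by
    refine card_le_card_of_injOn (fun p => Function.update p.1 j p.2) (fun _ _ => by simp) ?_
    rintro ⟨a, u⟩ ha ⟨b, v⟩ hb hab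
    simp only [coe_product, coe_filter, mem_univ, true_and, Set.mem_prod, Set.mem_ofPred_eq] at ha hb
    simp only at hab
    have h1 : u = v := by simpa using congrFun hab j
    have h2 : a = b := h a b ha.1 hb.1 (fun i hi => by
      simpa [Function.update_of_ne hi] using congrFun hab i)
    rw [h1, h2]
  rw [card_product] at this
  have h3 : (univ : Finset (J → V)).card = Fintype.card V ^ Fintype.card J := by
    rw [card_univ]; simp
  rw [h3] at this
  exact_mod_cast this

/-- discarding the non-injective tuples and the tuples meeting a small forbidden set -/
lemma cnt_good {J : Type} {n : ℕ} [Fintype J] [DecidableEq J] (Q : (J → Fin n) → Prop)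
    (A : Finset (Fin n)) (β : ℝ) (hβ : 0 < β)
    (hcount : 2 * β * (n : ℝ) ^ Fintype.card J ≤ cnt Q)
    (hn : ((Fintype.card J : ℝ) ^ 2 + A.card * Fintype.card J) ≤ β * n) (hn0 : 0 < n) :
    β * (n : ℝ) ^ Fintype.card J ≤
      cnt (fun ω => Q ω ∧ Function.Injective ω ∧ ∀ j, ω j ∉ A) := by
  set N := Fintype.card J
  have hn' : (0 : ℝ) < n := by exact_mod_cast hn0
  have b1 : ∀ i j : J, i ≠ j → cnt (fun ω : J → Fin n => ω i = ω j) ≤ (n : ℝ) ^ N / n := by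
    intro i j hij
    rw [le_div_iff₀ hn']
    have := cnt_eval_eq (fun ω : J → Fin n => ω i = ω j) j (by
      intro ω ω' h1 h2 h
      ext1 k
      by_cases hk : k = j
      · subst hk; rw [← h1, ← h2]; exact h i hij
      · exact h k hk)
    simpa using this
  have b2 : ∀ (j : J) (a : Fin n), cnt (fun ω : J → Fin n => ω j = a) ≤ (n : ℝ) ^ N / n := by
    intro j a
    rw [le_div_iff₀ hn']
    have := cnt_eval_eq (fun ω : J → Fin n => ω j = a) j (by
      intro ω ω' h1 h2 h
      ext1 k
      by_cases hk : k = j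
      · subst hk; rw [h1, h2]
      · exact h k hk)
    simpa using this
  set s : Finset (J × J) := univ.filter fun p => p.1 ≠ p.2
  set t : Finset (J × Fin n) := univ ×ˢ A
  have c1 : cnt (fun ω : J → Fin n => ∃ p ∈ s, ω p.1 = ω p.2) ≤ N ^ 2 * ((n : ℝ) ^ N / n) := by
    refine (cnt_exists_le s (fun p (ω : J → Fin n) => ω p.1 = ω p.2)).trans ?_
    calc _ ≤ ∑ p ∈ s, (n : ℝ) ^ N / n := sum_le_sum fun p hp => b1 _ _ (by simpa [s] using hp)
      _ = s.card * ((n : ℝ) ^ N / n) := by rw [sum_const, nsmul_eq_mul]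
      _ ≤ _ := by
        refine mul_le_mul_of_nonneg_right ?_ (by positivity)
        have : s.card ≤ N ^ 2 := (card_le_univ s).trans (by simp [N, sq])
        exact_mod_cast this
  have c2 : cnt (fun ω : J → Fin n => ∃ p ∈ t, ω p.1 = p.2) ≤ A.card * N * ((n : ℝ) ^ N / n) := by
    refine (cnt_exists_le t (fun p (ω : J → Fin n) => ω p.1 = p.2)).trans ?_
    calc _ ≤ ∑ p ∈ t, (n : ℝ) ^ N / n := sum_le_sum fun p _ => b2 _ _
      _ = t.card * ((n : ℝ) ^ N / n) := by rw [sum_const, nsmul_eq_mul]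
      _ = _ := by
        rw [show t.card = Fintype.card J * A.card by simp [t, card_product]]
        push_cast; ring
  have c3 : cnt Q ≤ cnt (fun ω => Q ω ∧ Function.Injective ω ∧ ∀ j, ω j ∉ A) +
      (cnt (fun ω : J → Fin n => ∃ p ∈ s, ω p.1 = ω p.2) +
        cnt (fun ω : J → Fin n => ∃ p ∈ t, ω p.1 = p.2)) := by
    refine le_trans ?_ (add_le_add le_rfl (cnt_or_le _ _))
    refine le_trans ?_ (cnt_or_le _ _)
    refine cnt_mono fun ω hω => ?_
    by_cases h1 : Function.Injective ω
    · by_cases h2 : ∀ j, ω j ∉ A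
      · exact .inl ⟨hω, h1, h2⟩
      · push Not at h2; obtain ⟨j, hj⟩ := h2
        exact .inr (.inr ⟨(j, ω j), by simp [t, hj], rfl⟩)
    · simp only [Function.Injective] at h1; push Not at h1
      obtain ⟨i, j, h, hij⟩ := h1
      exact .inr (.inl ⟨(i, j), by simp [s, hij], h⟩)
  have c4 : ((N : ℝ) ^ 2 + A.card * N) * ((n : ℝ) ^ N / n) ≤ β * (n : ℝ) ^ N := by
    calc _ ≤ (β * n) * ((n : ℝ) ^ N / n) := mul_le_mul_of_nonneg_right hn (by positivity)
      _ = _ := by field_simp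
  nlinarith

lemma factor_single {n : ℕ} {H : Finset (Finset (Fin n))} {S : Finset (Fin n)}
    (h : SpansK4m H S) : HasK4mFactorOn H S :=
  ⟨{S}, by simpa using h, by simp +contextual, by simp⟩

lemma factor_empty {n : ℕ} (H : Finset (Finset (Fin n))) : HasK4mFactorOn H ∅ :=
  ⟨∅, by simp, by simp, by simp⟩

lemma factor_union {n : ℕ} {H : Finset (Finset (Fin n))} {A B : Finset (Fin n)}
    (hA : HasK4mFactorOn H A) (hB : HasK4mFactorOn H B) (hd : Disjoint A B) :
    HasK4mFactorOn H (A ∪ B) := by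
  obtain ⟨P, hP1, hP2, hP3⟩ := hA
  obtain ⟨Q, hQ1, hQ2, hQ3⟩ := hB
  have sP : ∀ S ∈ P, S ⊆ A := fun S hS => by rw [← hP3]; exact subset_biUnion_of_mem id hS
  have sQ : ∀ S ∈ Q, S ⊆ B := fun S hS => by rw [← hQ3]; exact subset_biUnion_of_mem id hS
  refine ⟨P ∪ Q, ?_, ?_, ?_⟩
  · intro S hS; rcases mem_union.1 hS with h | h
    · exact hP1 S h
    · exact hQ1 S h
  · intro S hS T hT hne
    rcases mem_union.1 hS with h | h <;> rcases mem_union.1 hT with h' | h'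
    · exact hP2 S h T h' hne
    · exact disjoint_of_subset_left (sP S h) (disjoint_of_subset_right (sQ T h') hd)
    · exact disjoint_of_subset_left (sQ S h) (disjoint_of_subset_right (sP T h') hd.symm)
    · exact hQ2 S h T h' hne
  · rw [union_biUnion, hP3, hQ3]

lemma factor_biUnion {n : ℕ} {H : Finset (Finset (Fin n))} {I : Type*} [DecidableEq I]
    (s : Finset I) (A : I → Finset (Fin n)) (hA : ∀ i ∈ s, HasK4mFactorOn H (A i))
    (hd : ∀ i ∈ s, ∀ j ∈ s, i ≠ j → Disjoint (A i) (A j)) : HasK4mFactorOn H (s.biUnion A) := by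
  induction s using Finset.induction_on with
  | empty => simpa using factor_empty H
  | insert a s ha ih =>
    rw [biUnion_insert]
    refine factor_union (hA a (mem_insert_self _ _)) (ih (fun i hi => hA i (mem_insert_of_mem hi))
      (fun i hi j hj => hd i (mem_insert_of_mem hi) j (mem_insert_of_mem hj))) ?_
    rw [disjoint_biUnion_right]
    intro i hi
    exact hd a (mem_insert_self _ _) i (mem_insert_of_mem hi) (by rintro rfl; exact ha hi)

/-- a tuple version of connectors -/
def ConnT {n : ℕ} (H : Finset (Finset (Fin n))) {J : Type} [Fintype J] (x y : Fin n)
    (f : J → Fin n) : Prop :=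
  Function.Injective f ∧ (∀ j, f j ≠ x) ∧ (∀ j, f j ≠ y) ∧
    HasK4mFactorOn H (insert x (univ.image f)) ∧ HasK4mFactorOn H (insert y (univ.image f))

def CloseT {n : ℕ} (H : Finset (Finset (Fin n))) (m : ℕ) (η : ℝ) (x y : Fin n) : Prop :=
  η * (n : ℝ) ^ m ≤ cnt (fun f : Fin m → Fin n => ConnT H x y f)

lemma ConnT_symm {n : ℕ} {H : Finset (Finset (Fin n))} {J : Type} [Fintype J] {x y : Fin n}
    {f : J → Fin n} (h : ConnT H x y f) : ConnT H y x f :=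
  ⟨h.1, h.2.2.1, h.2.1, h.2.2.2.2, h.2.2.2.1⟩

lemma CloseT_symm {n : ℕ} {H : Finset (Finset (Fin n))} {m : ℕ} {η : ℝ} {x y : Fin n}
    (h : CloseT H m η x y) : CloseT H m η y x :=
  le_trans h (cnt_mono fun _ => ConnT_symm)

lemma CloseT_gen {n : ℕ} {H : Finset (Finset (Fin n))} {J : Type} [Fintype J] [DecidableEq J]
    (x y : Fin n) (Q : (J → Fin n) → Prop) (β : ℝ) (hβ : 0 < β) (m : ℕ) (hm : Fintype.card J = m)
    (hcount : 2 * β * (n : ℝ) ^ m ≤ cnt Q)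
    (hn : ((m : ℝ) ^ 2 + 2 * m) ≤ β * n)
    (hQ : ∀ ω, Q ω → Function.Injective ω → (∀ j, ω j ≠ x) → (∀ j, ω j ≠ y) →
      HasK4mFactorOn H (insert x (univ.image ω)) ∧ HasK4mFactorOn H (insert y (univ.image ω))) :
    CloseT H m β x y := by
  subst hm
  have hn0 : 0 < n := x.pos
  have hA : (({x, y} : Finset (Fin n)).card : ℝ) ≤ 2 := by exact_mod_cast card_le_two
  have := cnt_good Q {x, y} β hβ hcount (le_trans (by gcongr) hn) hn0
  unfold CloseT
  refine this.trans ?_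
  let e : J ≃ Fin (Fintype.card J) := Fintype.equivFin J
  rw [← cnt_equiv (Equiv.arrowCongr e (Equiv.refl (Fin n)))]
  refine cnt_mono fun ω ⟨h1, h2, h3⟩ => ?_
  simp only [mem_insert, mem_singleton, not_or] at h3
  have him : univ.image ((Equiv.arrowCongr e (Equiv.refl (Fin n))) ω) = univ.image ω := by
    ext z; simp only [mem_image, mem_univ, true_and]
    constructor
    · rintro ⟨i, rfl⟩; exact ⟨e.symm i, rfl⟩
    · rintro ⟨i, rfl⟩; exact ⟨e i, by simp⟩
  have := hQ ω h1 h2 (fun j => (h3 j).1) (fun j => (h3 j).2)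
  refine ⟨?_, fun j => (h3 _).1, fun j => (h3 _).2, ?_, ?_⟩
  · exact h2.comp e.symm.injective
  · rw [him]; exact this.1
  · rw [him]; exact this.2

/-- link of `x` : the triples that form a `K₄⁻` with `x` -/
def FF {n : ℕ} (H : Finset (Finset (Fin n))) (x : Fin n) (s : Fin 3 → Fin n) : Prop :=
  SpansK4m H {x, s 0, s 1, s 2}

/-- 4-tuples spanning a `K₄⁻` -/
def KK {n : ℕ} (H : Finset (Finset (Fin n))) (s : Fin 4 → Fin n) : Prop :=
  SpansK4m H (univ.image s)

lemma image_fin3 {n : ℕ} (s : Fin 3 → Fin n) : univ.image s = {s 0, s 1, s 2} := by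
  ext z; simp [Fin.exists_fin_succ, eq_comm]

/-- P0 -/
lemma close_zero {n : ℕ} {H : Finset (Finset (Fin n))} (x y : Fin n) (β : ℝ) (hβ : 0 < β)
    (hn : 15 ≤ β * n)
    (h : 2 * β * (n : ℝ) ^ 3 ≤ cnt (fun s : Fin 3 → Fin n => FF H x s ∧ FF H y s)) :
    CloseT H 3 β x y := by
  refine CloseT_gen x y _ β hβ 3 (by simp) h (by norm_num; linarith) ?_
  rintro ω ⟨h1, h2⟩ - - -
  rw [image_fin3]
  exact ⟨factor_single h1, factor_single h2⟩

/-- Padding -/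
lemma close_pad {n : ℕ} {H : Finset (Finset (Fin n))} (x y : Fin n) (κ η β : ℝ) (hκ : 0 ≤ κ)
    (hβ : 0 < β) (m r M : ℕ) (hM : m + r * 4 = M) (hβ2 : 2 * β ≤ η * κ ^ r)
    (hn : ((M : ℝ) ^ 2 + 2 * M) ≤ β * n)
    (hK : κ * (n : ℝ) ^ 4 ≤ cnt (fun s : Fin 4 → Fin n => KK H s))
    (h : CloseT H m η x y) : CloseT H M β x y := by
  have key := cnt_comb (J1 := Fin m) (I := Fin r) (J := Fin 4) (V := Fin n)
    (fun f => ConnT H x y f) (fun _ _ s => KK H s) _ (κ * (n : ℝ) ^ 4) (by positivity) h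
    (fun _ _ _ => hK)
  refine CloseT_gen x y _ β hβ M (by simp [hM]) (le_trans ?_ key) hn ?_
  · rw [← hM, mul_pow, ← pow_mul, pow_add, Fintype.card_fin, mul_comm 4 r]
    have : (0 : ℝ) ≤ (n : ℝ) ^ m * (n : ℝ) ^ (r * 4) := by positivity
    nlinarith
  · rintro ω ⟨⟨-, -, -, hx, hy⟩, hs⟩ hinj hωx hωy
    have him : univ.image ω = univ.image (fun j => ω (.inl j)) ∪
        univ.biUnion (fun i => univ.image (fun j => ω (.inr (i, j)))) := by
      ext z; simp
    have hf : HasK4mFactorOn H (univ.biUnion (fun i => univ.image (fun j => ω (.inr (i, j))))) := by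
      refine factor_biUnion _ _ (fun i _ => factor_single (hs i)) ?_
      intro i _ j _ hij
      rw [disjoint_left]
      simp only [mem_image, mem_univ, true_and, not_exists]
      rintro z ⟨a, rfl⟩ b hb
      have := hinj hb
      simp at this
      exact hij this.1.symm
    have hd : ∀ z, (∀ j, ω j ≠ z) → Disjoint (insert z (univ.image (fun j => ω (.inl j))))
        (univ.biUnion (fun i => univ.image (fun j => ω (.inr (i, j))))) := by
      intro z hz
      rw [disjoint_left]
      simp only [mem_insert, mem_biUnion, mem_image, mem_univ, true_and, not_exists]
      rintro w (rfl | ⟨a, rfl⟩) i b hb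
      · exact hz _ hb
      · have := hinj hb
        simp at this
    rw [him, ← insert_union, ← insert_union]
    exact ⟨factor_union hx hf (hd x hωx), factor_union hy hf (hd y hωy)⟩

/-- P2 -/
lemma close_trans {n : ℕ} {H : Finset (Finset (Fin n))} (x y : Fin n) (α η β : ℝ) (hη : 0 ≤ η)
    (hβ : 0 < β) (m : ℕ) (hβ2 : 2 * β ≤ α * η ^ 2)
    (hn : (((2 * m + 1 : ℕ) : ℝ) ^ 2 + 2 * (2 * m + 1 : ℕ)) ≤ β * n)
    (h : α * n ≤ cnt (fun z => CloseT H m η x z ∧ CloseT H m η z y)) :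
    CloseT H (2 * m + 1) β x y := by
  have h1 : α * n ≤ cnt (fun z : Unit → Fin n => CloseT H m η x (z ()) ∧ CloseT H m η (z ()) y) := by
    refine h.trans (le_of_eq ?_)
    exact (cnt_equiv (Equiv.funUnique Unit (Fin n)) _).symm
  have key := cnt_comb (J1 := Unit) (I := Fin 2) (J := Fin m) (V := Fin n) _
    (fun z i f => if i = 0 then ConnT H x (z ()) f else ConnT H (z ()) y f) _
      (η * (n : ℝ) ^ m) (by positivity) h1
    (fun z hz i => by
      fin_cases i
      · simpa [CloseT] using hz.1
      · simpa [CloseT] using hz.2)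
  refine CloseT_gen x y _ β hβ (2 * m + 1) (by simp; omega) (le_trans ?_ key) hn ?_
  · rw [Fintype.card_fin, mul_pow, ← pow_mul, pow_succ, mul_comm 2 m]
    have : (0 : ℝ) ≤ (n : ℝ) ^ (m * 2) * n := by positivity
    nlinarith
  · rintro ω ⟨-, hs⟩ hinj hωx hωy
    have h0 := hs 0
    have h1 := hs 1
    simp only [if_true, Fin.isValue, one_ne_zero, if_false] at h0 h1
    obtain ⟨-, -, -, a1, a2⟩ := h0
    obtain ⟨-, -, -, b1, b2⟩ := h1
    constructor
    · have : insert x (univ.image ω) = insert x (univ.image (fun j => ω (.inr (0, j)))) ∪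
        insert (ω (.inl ())) (univ.image (fun j => ω (.inr (1, j)))) := by
        ext z; simp [Fin.exists_fin_two]; tauto
      rw [this]
      refine factor_union a1 b1 ?_
      rw [disjoint_left]
      simp only [mem_insert, mem_image, mem_univ, true_and]
      rintro w (rfl | ⟨a, rfl⟩) (h | ⟨b, h⟩)
      · exact hωx _ h.symm
      · exact hωx _ h
      · simpa using hinj h
      · simpa using hinj h
    · have : insert y (univ.image ω) = insert y (univ.image (fun j => ω (.inr (1, j)))) ∪
        insert (ω (.inl ())) (univ.image (fun j => ω (.inr (0, j)))) := by
        ext z; simp [Fin.exists_fin_two]; tauto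
      rw [this]
      refine factor_union b2 a2 ?_
      rw [disjoint_left]
      simp only [mem_insert, mem_image, mem_univ, true_and]
      rintro w (rfl | ⟨a, rfl⟩) (h | ⟨b, h⟩)
      · exact hωy _ h.symm
      · exact hωy _ h
      · simpa using hinj h
      · simpa using hinj h

/-- P3 -/
lemma close_bridge {n : ℕ} {H : Finset (Finset (Fin n))} (x y : Fin n) (α η β : ℝ) (hη : 0 ≤ η)
    (hβ : 0 < β) (m : ℕ) (hβ2 : 2 * β ≤ α * η ^ 3)
    (hn : (((3 * m + 6 : ℕ) : ℝ) ^ 2 + 2 * (3 * m + 6 : ℕ)) ≤ β * n)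
    (h : α * (n : ℝ) ^ 6 ≤ cnt (fun s : Fin 3 ⊕ Fin 3 → Fin n =>
      (FF H x (fun i => s (.inl i)) ∧ FF H y (fun i => s (.inr i))) ∧
        ∀ i, CloseT H m η (s (.inl i)) (s (.inr i)))) :
    CloseT H (3 * m + 6) β x y := by
  have key := cnt_comb (J1 := Fin 3 ⊕ Fin 3) (I := Fin 3) (J := Fin m) (V := Fin n) _
    (fun s i f => ConnT H (s (.inl i)) (s (.inr i)) f) _
      (η * (n : ℝ) ^ m) (by positivity) h
    (fun s hs i => hs.2 i)
  refine CloseT_gen x y _ β hβ (3 * m + 6) (by simp; omega) (le_trans ?_ key) hn ?_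
  · rw [Fintype.card_fin, mul_pow, ← pow_mul, pow_add, mul_comm 3 m]
    have : (0 : ℝ) ≤ (n : ℝ) ^ (m * 3) * (n : ℝ) ^ 6 := by positivity
    nlinarith
  · rintro ω ⟨⟨⟨hx, hy⟩, -⟩, hs⟩ hinj hωx hωy
    constructor
    · have : insert x (univ.image ω) = {x, ω (.inl (.inl 0)), ω (.inl (.inl 1)), ω (.inl (.inl 2))} ∪
        univ.biUnion (fun i => insert (ω (.inl (.inr i))) (univ.image (fun j => ω (.inr (i, j))))) := by
        ext z
        simp only [mem_insert, mem_image, mem_univ, true_and, mem_union, mem_singleton, mem_biUnion]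
        constructor
        · rintro (rfl | ⟨(i | i) | ⟨i, j⟩, rfl⟩)
          · exact .inl (.inl rfl)
          · left; fin_cases i <;> simp
          · exact .inr ⟨i, .inl rfl⟩
          · exact .inr ⟨i, .inr ⟨j, rfl⟩⟩
        · rintro ((rfl | rfl | rfl | rfl) | ⟨i, rfl | ⟨j, rfl⟩⟩)
          · exact .inl rfl
          all_goals exact .inr ⟨_, rfl⟩
      rw [this]
      refine factor_union (factor_single hx) (factor_biUnion _ _ (fun i _ => (hs i).2.2.2.2) ?_) ?_
      · intro i _ j _ hij
        rw [disjoint_left]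
        simp only [mem_insert, mem_image, mem_univ, true_and]
        rintro w (rfl | ⟨a, rfl⟩) (h | ⟨b, h⟩) <;> simpa [hij, hij.symm] using hinj h
      · rw [disjoint_left]
        simp only [mem_insert, mem_image, mem_univ, true_and, mem_biUnion, mem_singleton]
        rintro w (rfl | rfl | rfl | rfl) ⟨i, (h | ⟨b, h⟩)⟩
        · exact hωx _ h.symm
        · exact hωx _ h
        all_goals simpa using hinj h
    · have : insert y (univ.image ω) = {y, ω (.inl (.inr 0)), ω (.inl (.inr 1)), ω (.inl (.inr 2))} ∪
        univ.biUnion (fun i => insert (ω (.inl (.inl i))) (univ.image (fun j => ω (.inr (i, j))))) := by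
        ext z
        simp only [mem_insert, mem_image, mem_univ, true_and, mem_union, mem_singleton, mem_biUnion]
        constructor
        · rintro (rfl | ⟨(i | i) | ⟨i, j⟩, rfl⟩)
          · exact .inl (.inl rfl)
          · exact .inr ⟨i, .inl rfl⟩
          · left; fin_cases i <;> simp
          · exact .inr ⟨i, .inr ⟨j, rfl⟩⟩
        · rintro ((rfl | rfl | rfl | rfl) | ⟨i, rfl | ⟨j, rfl⟩⟩)
          · exact .inl rfl
          all_goals exact .inr ⟨_, rfl⟩
      rw [this]
      refine factor_union (factor_single hy) (factor_biUnion _ _ (fun i _ => (hs i).2.2.2.1) ?_) ?_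
      · intro i _ j _ hij
        rw [disjoint_left]
        simp only [mem_insert, mem_image, mem_univ, true_and]
        rintro w (rfl | ⟨a, rfl⟩) (h | ⟨b, h⟩) <;> simpa [hij, hij.symm] using hinj h
      · rw [disjoint_left]
        simp only [mem_insert, mem_image, mem_univ, true_and, mem_biUnion, mem_singleton]
        rintro w (rfl | rfl | rfl | rfl) ⟨i, (h | ⟨b, h⟩)⟩
        · exact hωy _ h.symm
        · exact hωy _ h
        all_goals simpa using hinj h

/-- absorbing tuples for a 4-tuple -/
def AbsT {n : ℕ} (H : Finset (Finset (Fin n))) {J : Type} [Fintype J] (x : Fin 4 → Fin n)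
    (f : J → Fin n) : Prop :=
  HasK4mFactorOn H (univ.image f) ∧ HasK4mFactorOn H (univ.image x ∪ univ.image f)

lemma abs_count {n : ℕ} {H : Finset (Finset (Fin n))} (κ η β : ℝ) (hη : 0 ≤ η)
    (hβ : 0 < β) (m : ℕ) (hβ2 : 2 * β ≤ κ * η ^ 4)
    (hn : (((4 * m + 4 : ℕ) : ℝ) ^ 2 + 4 * (4 * m + 4 : ℕ)) ≤ β * n)
    (hK : κ * (n : ℝ) ^ 4 ≤ cnt (fun s : Fin 4 → Fin n => KK H s))
    (hcl : ∀ x y, CloseT H m η x y) (x : Fin 4 → Fin n) (hx : Function.Injective x) :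
    β * (n : ℝ) ^ (4 * m + 4) ≤ cnt (fun f : Fin 4 ⊕ (Fin 4 × Fin m) → Fin n => AbsT H x f) := by
  have hn0 : 0 < n := (x 0).pos
  have key := cnt_comb (J1 := Fin 4) (I := Fin 4) (J := Fin m) (V := Fin n) (fun y => KK H y)
    (fun y i f => ConnT H (x i) (y i) f) _
      (η * (n : ℝ) ^ m) (by positivity) hK
    (fun s hs i => hcl _ _)
  have hJ : Fintype.card (Fin 4 ⊕ (Fin 4 × Fin m)) = 4 * m + 4 := by simp; omega
  have hA : ((univ.image x).card : ℝ) ≤ 4 := by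
    have : (univ.image x).card ≤ 4 := card_image_le.trans (by simp)
    exact_mod_cast this
  have := cnt_good _ (univ.image x) β hβ (le_trans (by
    rw [hJ, Fintype.card_fin, mul_pow, ← pow_mul, pow_add, mul_comm 4 m]
    have : (0 : ℝ) ≤ (n : ℝ) ^ (m * 4) * (n : ℝ) ^ 4 := by positivity
    nlinarith) key) (le_trans (by rw [hJ]; gcongr) hn) hn0
  rw [hJ] at this
  refine this.trans (cnt_mono ?_)
  rintro ω ⟨⟨hy, hs⟩, hinj, hωx⟩
  simp only [mem_image, mem_univ, true_and, not_exists] at hωx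
  constructor
  · have : univ.image ω = univ.biUnion
      (fun i => insert (ω (.inl i)) (univ.image (fun j => ω (.inr (i, j))))) := by
      ext z; simp [eq_comm]; constructor
      · rintro (⟨i, h⟩ | ⟨i, b, h⟩)
        · exact ⟨i, .inl h⟩
        · exact ⟨i, .inr ⟨b, h⟩⟩
      · rintro ⟨i, h | ⟨b, h⟩⟩
        · exact .inl ⟨i, h⟩
        · exact .inr ⟨i, b, h⟩
    rw [this]
    refine factor_biUnion _ _ (fun i _ => (hs i).2.2.2.2) ?_
    intro i _ j _ hij
    rw [disjoint_left]
    simp only [mem_insert, mem_image, mem_univ, true_and]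
    rintro w (rfl | ⟨a, rfl⟩) (h | ⟨b, h⟩) <;> simpa [hij, hij.symm] using hinj h
  · have : univ.image x ∪ univ.image ω = univ.image (fun i => ω (.inl i)) ∪ univ.biUnion
      (fun i => insert (x i) (univ.image (fun j => ω (.inr (i, j))))) := by
      ext z; simp [eq_comm]; constructor
      · rintro (⟨i, h⟩ | ⟨i, h⟩ | ⟨i, b, h⟩)
        · exact .inr ⟨i, .inl h⟩
        · exact .inl ⟨i, h⟩
        · exact .inr ⟨i, .inr ⟨b, h⟩⟩
      · rintro (⟨i, h⟩ | ⟨i, h | ⟨b, h⟩⟩)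
        · exact .inr (.inl ⟨i, h⟩)
        · exact .inl ⟨i, h⟩
        · exact .inr (.inr ⟨i, b, h⟩)
    rw [this]
    refine factor_union (factor_single hy) (factor_biUnion _ _ (fun i _ => (hs i).2.2.2.1) ?_) ?_
    · intro i _ j _ hij
      rw [disjoint_left]
      simp only [mem_insert, mem_image, mem_univ, true_and]
      rintro w (rfl | ⟨a, rfl⟩) (h | ⟨b, h⟩)
      · exact hij (hx h)
      · exact hωx _ _ h.symm
      · exact hωx _ _ h.symm
      · simpa [hij, hij.symm] using hinj h
    · rw [disjoint_left]
      simp only [mem_insert, mem_image, mem_univ, true_and, mem_biUnion]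
      rintro w ⟨a, rfl⟩ ⟨i, h | ⟨b, h⟩⟩
      · exact hωx _ _ h.symm
      · simpa using hinj h

lemma sel_conf {Ω : Type} [Fintype Ω] (C : Ω → Ω → Prop) (c : ℝ)
    (hC : ∀ b, cnt (fun a => C a b) ≤ c * Fintype.card Ω) (t : ℕ) (i j : Fin t) (hij : i ≠ j) :
    cnt (fun F : Fin t → Ω => C (F i) (F j)) ≤ c * (Fintype.card Ω : ℝ) ^ t := by
  have h := cnt_equiv (Equiv.funSplitAt i Ω).symm (fun F : Fin t → Ω => C (F i) (F j))
  rw [← h]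
  unfold cnt
  rw [Fintype.sum_prod_type, sum_comm]
  have h2 : ∀ y : {j // j ≠ i} → Ω, ∑ x, ind (C ((Equiv.funSplitAt i Ω).symm (x, y) i)
      ((Equiv.funSplitAt i Ω).symm (x, y) j)) ≤ c * Fintype.card Ω := by
    intro y
    have := hC (y ⟨j, hij.symm⟩)
    refine le_trans (le_of_eq ?_) this
    unfold cnt
    refine sum_congr rfl fun x _ => ?_
    simp [Equiv.funSplitAt, Equiv.piSplitAt, hij.symm]
  refine (sum_le_sum fun y _ => h2 y).trans ?_
  rw [sum_const, nsmul_eq_mul, card_univ]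
  simp only [Fintype.card_fun, Fintype.card_subtype_compl, Fintype.card_fin, Fintype.card_subtype_eq]
  push_cast
  have ht : t = (t - 1) + 1 := by have := i.pos; omega
  conv_rhs => rw [ht]
  rw [pow_succ]
  apply le_of_eq; ring

lemma sel_low {Ω : Type} [Fintype Ω] (A : Ω → Prop) (β : ℝ)
    (hA : β * Fintype.card Ω ≤ cnt A) (t s : ℕ) :
    cnt (fun F : Fin t → Ω => cnt (fun i => A (F i)) < s) ≤
      2 ^ s * ((1 - β / 2) * Fintype.card Ω) ^ t := by
  classical
  have h1 : ∀ F : Fin t → Ω, ind (cnt (fun i => A (F i)) < s) ≤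
      2 ^ s * ∏ i, (1 - ind (A (F i)) / 2) := by
    intro F
    have hprod : ∏ i, (1 - ind (A (F i)) / 2) = (1 / 2 : ℝ) ^ (univ.filter fun i => A (F i)).card := by
      rw [← prod_const, prod_filter]
      refine prod_congr rfl fun i _ => ?_
      split_ifs with h
      · rw [ind_pos h]; norm_num
      · rw [ind_neg h]; norm_num
    rw [hprod]
    by_cases h : cnt (fun i => A (F i)) < s
    · rw [ind_pos h]
      rw [cnt_eq_card] at h
      have h' : (univ.filter fun i => A (F i)).card < s := by exact_mod_cast h
      obtain ⟨k, hk⟩ := Nat.exists_eq_add_of_lt h'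
      rw [hk, one_div, inv_pow, pow_add, pow_add]
      have : (1 : ℝ) ≤ 2 ^ k := one_le_pow₀ (by norm_num)
      have h3 : (0 : ℝ) < 2 ^ (univ.filter fun i => A (F i)).card := by positivity
      field_simp
      linarith
    · rw [ind_neg h]; positivity
  refine (sum_le_sum fun F _ => h1 F).trans ?_
  rw [← mul_sum]
  refine mul_le_mul_of_nonneg_left ?_ (by positivity)
  have h2 : ∑ F : Fin t → Ω, ∏ i, (1 - ind (A (F i)) / 2) =
      ∏ _i : Fin t, ∑ ω : Ω, (1 - ind (A ω) / 2) := by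
    rw [Finset.prod_univ_sum]; simp
  rw [h2, prod_const, card_univ, Fintype.card_fin]
  have h3 : ∑ ω : Ω, (1 - ind (A ω) / 2) = Fintype.card Ω - cnt A / 2 := by
    rw [sum_sub_distrib, ← sum_div]; simp [cnt]
  rw [h3]
  have := cnt_le_card A
  have h0 := cnt_nonneg A
  refine pow_le_pow_left₀ (by linarith) (by linarith) t

lemma sel_main {Ω Q : Type} [Fintype Ω] [Nonempty Ω] [Fintype Q] (C : Ω → Ω → Prop) (c : ℝ) (hc : 0 < c)
    (hC : ∀ b, cnt (fun a => C a b) ≤ c * Fintype.card Ω)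
    (A : Q → Ω → Prop) (β : ℝ) (hA : ∀ q, β * Fintype.card Ω ≤ cnt (A q)) (t s : ℕ) (ht : 0 < t)
    (hs : Fintype.card Q * (2 ^ s * (1 - β / 2) ^ t) < 1 / 2) :
    ∃ F : Fin t → Ω, (cnt (fun p : Fin t × Fin t => p.1 ≠ p.2 ∧ C (F p.1) (F p.2)) ≤ 2 * t ^ 2 * c) ∧
      ∀ q, (s : ℝ) ≤ cnt (fun i => A q (F i)) := by
  by_contra hcon
  push Not at hcon
  set N : ℝ := (Fintype.card Ω : ℝ) with hN
  have hN0 : 0 < N := by rw [hN]; exact_mod_cast Fintype.card_pos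
  have hT : (0 : ℝ) < 2 * t ^ 2 * c := by positivity
  have h1 : cnt (fun F : Fin t → Ω => 2 * t ^ 2 * c < cnt (fun p : Fin t × Fin t => p.1 ≠ p.2 ∧ C (F p.1) (F p.2))) * (2 * t ^ 2 * c) ≤ t ^ 2 * (c * N ^ t) := by
    unfold cnt
    rw [sum_mul]
    have h3 : ∀ F : Fin t → Ω, ind (2 * t ^ 2 * c < ∑ p : Fin t × Fin t, ind (p.1 ≠ p.2 ∧ C (F p.1) (F p.2))) * (2 * t ^ 2 * c) ≤ ∑ p : Fin t × Fin t, ind (p.1 ≠ p.2 ∧ C (F p.1) (F p.2)) := by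
      intro F
      by_cases h : 2 * t ^ 2 * c < ∑ p : Fin t × Fin t, ind (p.1 ≠ p.2 ∧ C (F p.1) (F p.2))
      · rw [ind_pos h]; linarith
      · rw [ind_neg h, zero_mul]; exact sum_nonneg fun _ _ => ind_nonneg _
    refine (sum_le_sum fun F _ => h3 F).trans ?_
    rw [sum_comm]
    have h4 : ∀ p : Fin t × Fin t, ∑ F : Fin t → Ω, ind (p.1 ≠ p.2 ∧ C (F p.1) (F p.2)) ≤ c * N ^ t := by
      intro p
      by_cases hp : p.1 = p.2
      · simp only [hp, ne_eq, not_true_eq_false, false_and]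
        rw [sum_eq_zero fun _ _ => ind_neg not_false]; positivity
      · refine le_trans (sum_le_sum fun F _ => ind_mono fun h => h.2) ?_
        exact sel_conf C c hC t p.1 p.2 hp
    refine (sum_le_sum fun p _ => h4 p).trans ?_
    rw [sum_const, nsmul_eq_mul, card_univ]
    simp [sq]
  have h1' : cnt (fun F : Fin t → Ω => 2 * t ^ 2 * c < cnt (fun p : Fin t × Fin t => p.1 ≠ p.2 ∧ C (F p.1) (F p.2))) ≤ N ^ t / 2 := by
    have : t ^ 2 * (c * N ^ t) = (N ^ t / 2) * (2 * t ^ 2 * c) := by ring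
    rw [this] at h1
    exact le_of_mul_le_mul_right h1 hT
  have h2 : cnt (fun F : Fin t → Ω => ∃ q ∈ (univ : Finset Q), cnt (fun i => A q (F i)) < s) < N ^ t / 2 := by
    refine (cnt_exists_le _ _).trans_lt ?_
    refine (sum_le_sum fun q _ => sel_low (A q) β (hA q) t s).trans_lt ?_
    rw [sum_const, nsmul_eq_mul, card_univ, mul_pow]
    have : (0 : ℝ) < N ^ t := by positivity
    calc _ = (Fintype.card Q * (2 ^ s * (1 - β / 2) ^ t)) * N ^ t := by rw [hN]; ring
      _ < 1 / 2 * N ^ t := mul_lt_mul_of_pos_right hs this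
      _ = _ := by ring
  have h3 : (N ^ t : ℝ) ≤ cnt (fun F : Fin t → Ω => 2 * t ^ 2 * c < cnt (fun p : Fin t × Fin t => p.1 ≠ p.2 ∧ C (F p.1) (F p.2))) + cnt (fun F : Fin t → Ω => ∃ q ∈ (univ : Finset Q), cnt (fun i => A q (F i)) < s) := by
    refine le_trans (le_of_eq ?_) (cnt_or_le _ _)
    have : (N ^ t : ℝ) = ∑ F : Fin t → Ω, (1 : ℝ) := by simp [hN]
    rw [this]
    refine sum_congr rfl fun F _ => ?_
    symm
    apply ind_pos
    by_cases h : 2 * t ^ 2 * c < cnt (fun p : Fin t × Fin t => p.1 ≠ p.2 ∧ C (F p.1) (F p.2))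
    · exact .inl h
    · right
      obtain ⟨q, hq⟩ := hcon F (not_lt.1 h)
      exact ⟨q, mem_univ _, hq⟩
  linarith

/-- two tuples share a vertex -/
def Meet {n : ℕ} {J : Type} (a b : J → Fin n) : Prop := ∃ p ∈ (Set.univ : Set (J × J)), a p.1 = b p.2

lemma meet_count {n : ℕ} {J : Type} [Fintype J] [DecidableEq J] (hn : 0 < n) (b : J → Fin n) :
    cnt (fun a : J → Fin n => Meet a b) ≤
      ((Fintype.card J : ℝ) ^ 2 / n) * (Fintype.card (J → Fin n) : ℝ) := by
  have hn' : (0 : ℝ) < n := by exact_mod_cast hn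
  have b2 : ∀ (j : J) (a : Fin n), cnt (fun ω : J → Fin n => ω j = a) ≤
      (n : ℝ) ^ (Fintype.card J) / n := by
    intro j a
    rw [le_div_iff₀ hn']
    have := cnt_eval_eq (fun ω : J → Fin n => ω j = a) j (by
      intro ω ω' h1 h2 h
      ext1 k
      by_cases hk : k = j
      · subst hk; rw [h1, h2]
      · exact h k hk)
    simpa using this
  have h1 : cnt (fun a : J → Fin n => Meet a b) ≤
      cnt (fun a : J → Fin n => ∃ p ∈ (univ : Finset (J × J)), a p.1 = b p.2) :=
    cnt_mono fun a ⟨p, _, hp⟩ => ⟨p, mem_univ _, hp⟩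
  refine h1.trans ((cnt_exists_le _ _).trans ((sum_le_sum fun p _ => b2 p.1 (b p.2)).trans ?_))
  rw [sum_const, nsmul_eq_mul, card_univ, Fintype.card_prod, Fintype.card_fun, Fintype.card_fin]
  push_cast
  apply le_of_eq; ring

lemma absorb_final {n : ℕ} {H : Finset (Finset (Fin n))} {J : Type} [Fintype J] [DecidableEq J]
    (t s : ℕ) (F : Fin t → J → Fin n) (I : Finset (Fin t))
    (hI : ∀ i ∈ I, HasK4mFactorOn H (univ.image (F i)))
    (hdis : ∀ i ∈ I, ∀ j ∈ I, i ≠ j → Disjoint (univ.image (F i)) (univ.image (F j)))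
    (hab : ∀ x : Fin 4 → Fin n, Function.Injective x →
      ∃ B ⊆ I, s ≤ B.card ∧ ∀ i ∈ B, AbsT H x (F i))
    (U : Finset (Fin n)) (hU : Disjoint U (I.biUnion fun i => univ.image (F i))) (r : ℕ)
    (hr : U.card = r * 4) (hrs : r ≤ s) :
    HasK4mFactorOn H (U ∪ (I.biUnion fun i => univ.image (F i))) := by
  classical
  have e : U ≃ Fin r × Fin 4 := Fintype.equivOfCardEq (by simp [hr])
  let x : Fin r → Fin 4 → Fin n := fun k a => (e.symm (k, a)).1
  have hxinj : ∀ k a k' a', x k a = x k' a' → k = k' ∧ a = a' := by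
    intro k a k' a' h
    have := e.symm.injective (Subtype.ext h)
    simpa using this
  have hxi : ∀ k, Function.Injective (x k) := fun k a a' h => (hxinj _ _ _ _ h).2
  have hxU : ∀ k a, x k a ∈ U := fun k a => (e.symm (k, a)).2
  have hUx : ∀ z ∈ U, ∃ k a, x k a = z := by
    intro z hz
    refine ⟨(e ⟨z, hz⟩).1, (e ⟨z, hz⟩).2, ?_⟩
    simp [x]
  choose B hBI hBs hBA using fun k => hab (x k) (hxi k)
  obtain ⟨f, hfinj, hf⟩ := (Finset.all_card_le_biUnion_card_iff_exists_injective B).1 (by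
    intro S
    rcases S.eq_empty_or_nonempty with rfl | ⟨k, hk⟩
    · simp
    · calc S.card ≤ r := by simpa using card_le_univ S
        _ ≤ s := hrs
        _ ≤ (B k).card := hBs k
        _ ≤ _ := card_le_card (subset_biUnion_of_mem B hk))
  let D : Fin t → Finset (Fin n) := fun i =>
    (univ.filter fun k => f k = i).biUnion (fun k => univ.image (x k)) ∪ univ.image (F i)
  have hD : U ∪ (I.biUnion fun i => univ.image (F i)) = I.biUnion D := by
    ext z
    simp only [mem_union, mem_biUnion, mem_image, mem_univ, true_and, mem_filter, D]
    constructor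
    · rintro (hz | ⟨i, hi, a, rfl⟩)
      · obtain ⟨k, a, rfl⟩ := hUx z hz
        exact ⟨f k, hBI k (hf k), .inl ⟨k, rfl, a, rfl⟩⟩
      · exact ⟨i, hi, .inr ⟨a, rfl⟩⟩
    · rintro ⟨i, hi, ⟨k, -, a, rfl⟩ | ⟨a, rfl⟩⟩
      · exact .inl (hxU _ _)
      · exact .inr ⟨i, hi, a, rfl⟩
  rw [hD]
  have hUF : ∀ i ∈ I, ∀ k a b, x k a ≠ F i b := by
    intro i hi k a b h
    rw [disjoint_left] at hU
    refine hU (hxU k a) ?_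
    rw [h]
    exact mem_biUnion.2 ⟨i, hi, mem_image_of_mem _ (mem_univ _)⟩
  refine factor_biUnion _ _ ?_ ?_
  · intro i hi
    by_cases h : ∃ k, f k = i
    · obtain ⟨k, rfl⟩ := h
      have : D (f k) = univ.image (x k) ∪ univ.image (F (f k)) := by
        have h2 : (univ.filter fun k' => f k' = f k) = {k} := by
          ext k'; simp [hfinj.eq_iff]
        simp [D, h2]
      rw [this]
      exact (hBA k _ (hf k)).2
    · push Not at h
      have : D i = univ.image (F i) := by simp [D, h]
      rw [this]; exact hI i hi
  · intro i hi j hj hij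
    have h1 := hdis i hi j hj hij
    rw [disjoint_left] at h1 ⊢
    simp only [mem_union, mem_biUnion, mem_image, mem_univ, true_and, mem_filter, D] at h1 ⊢
    rintro z (⟨k, rfl, a, rfl⟩ | ⟨a, rfl⟩) (⟨k', rfl, a', h⟩ | ⟨a', h⟩)
    · have := hxinj _ _ _ _ h
      exact hij (by rw [this.1])
    · exact hUF _ hj _ _ _ h.symm
    · exact hUF _ hi _ _ _ h
    · exact h1 ⟨a, rfl⟩ ⟨a', h⟩

lemma pow_four_small (κ : ℝ) (hκ : 0 < κ) : ∃ n₀ : ℕ, ∀ n : ℕ, n₀ ≤ n →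
    (n : ℝ) ^ 4 < 1 / 2 * 2 ^ ⌊κ * n⌋₊ := by
  have h := tendsto_pow_const_div_const_pow_of_one_lt 4 (r := (2 : ℝ)) (by norm_num)
  have h2 := h.eventually_lt_const (u := κ ^ 4 / 4) (by positivity)
  obtain ⟨s₀, hs₀⟩ := Filter.eventually_atTop.1 h2
  refine ⟨⌈(s₀ + 1) / κ⌉₊, fun n hn => ?_⟩
  set s := ⌊κ * n⌋₊
  have h3 : κ * n < s + 1 := Nat.lt_floor_add_one _
  have h4 : (s₀ : ℝ) + 1 ≤ κ * n := by
    have := (Nat.ceil_le.1 hn)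
    rw [div_le_iff₀ hκ] at this; linarith
  have h5 : s₀ ≤ s + 1 := by
    have : (s₀ : ℝ) < s + 1 := by linarith
    have : s₀ < s + 1 := by exact_mod_cast this
    omega
  have h6 := hs₀ (s + 1) h5
  rw [div_lt_iff₀ (by positivity)] at h6
  have h7 : (κ * n) ^ 4 ≤ ((s + 1 : ℕ) : ℝ) ^ 4 := by
    refine pow_le_pow_left₀ (by positivity) ?_ 4
    push_cast; exact h3.le
  rw [pow_succ (2 : ℝ) s] at h6
  have h8 : κ ^ 4 * (n : ℝ) ^ 4 < κ ^ 4 * (1 / 2 * 2 ^ s) := by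
    rw [← mul_pow]; linarith
  exact lt_of_mul_lt_mul_left h8 (by positivity)

lemma absorb {J : Type} [Fintype J] [DecidableEq J] [Nonempty J] (β ε : ℝ) (hβ : 0 < β) (hβ1 : β ≤ 1)
    (hε : 0 < ε) : ∃ φ₀ : ℝ, 0 < φ₀ ∧ ∃ n₀ : ℕ, ∀ n : ℕ, n₀ ≤ n → ∀ H : Finset (Finset (Fin n)),
      (∀ x : Fin 4 → Fin n, Function.Injective x →
        β * (n : ℝ) ^ Fintype.card J ≤ cnt (fun f : J → Fin n => AbsT H x f)) →
      ∃ W : Finset (Fin n), (W.card : ℝ) ≤ ε * n ∧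
        ∀ U : Finset (Fin n), U ⊆ Finset.univ \ W →
          (U.card : ℝ) ≤ φ₀ * n → 4 ∣ U.card →
            HasK4mFactorOn H W ∧ HasK4mFactorOn H (U ∪ W) := by
  classical
  obtain ⟨r, hr⟩ := exists_pow_lt_of_lt_one (show (0 : ℝ) < 1 / 4 by norm_num)
    (show 1 - β / 2 < 1 by linarith)
  have hr0 : 0 < r := by
    rcases Nat.eq_zero_or_pos r with rfl | h
    · norm_num at hr
    · exact h
  set M : ℝ := (Fintype.card J : ℝ) with hM
  have hM0 : 0 < M := by rw [hM]; exact_mod_cast Fintype.card_pos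
  have hr0' : (0 : ℝ) < r := by exact_mod_cast hr0
  set κ : ℝ := min (1 / (4 * r ^ 2 * M ^ 2)) (ε / (r * M)) with hκ
  have hκ0 : 0 < κ := lt_min (by positivity) (by positivity)
  have hκ1 : κ * (4 * r ^ 2 * M ^ 2) ≤ 1 := by
    have := min_le_left (1 / (4 * r ^ 2 * M ^ 2)) (ε / (r * M))
    rw [← hκ, le_div_iff₀ (by positivity)] at this; exact this
  have hκ2 : κ * (r * M) ≤ ε := by
    have := min_le_right (1 / (4 * r ^ 2 * M ^ 2)) (ε / (r * M))
    rw [← hκ, le_div_iff₀ (by positivity)] at this; exact this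
  obtain ⟨n₁, hn₁⟩ := pow_four_small κ hκ0
  refine ⟨κ, hκ0, max (max n₁ 1) ⌈2 / κ⌉₊, fun n hn H hab => ?_⟩
  have hn1 : n₁ ≤ n := le_trans (le_trans (le_max_left _ _) (le_max_left _ _)) hn
  have hn0 : 0 < n := le_trans (le_trans (le_max_right _ _) (le_max_left _ _)) hn
  have hn0' : (0 : ℝ) < n := by exact_mod_cast hn0
  have hn2 : 2 ≤ κ * n := by
    have := Nat.ceil_le.1 (le_trans (le_max_right _ _) hn)
    rw [div_le_iff₀ hκ0] at this; linarith
  have hpow := hn₁ n hn1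
  set s := ⌊κ * n⌋₊ with hs
  have hs1 : (s : ℝ) ≤ κ * n := Nat.floor_le (by positivity)
  have hs2 : κ * n < s + 1 := Nat.lt_floor_add_one _
  have hs3 : κ * n / 2 ≤ s := by linarith
  have hs0 : 0 < s := by
    have : (0 : ℝ) < s := by linarith
    exact_mod_cast this
  have : Nonempty (Fin n) := ⟨⟨0, hn0⟩⟩
  obtain ⟨t, ht⟩ : ∃ t, t = r * s := ⟨_, rfl⟩
  have hΩ : (Fintype.card (J → Fin n) : ℝ) = (n : ℝ) ^ Fintype.card J := by simp
  obtain ⟨F, hF1, hF2⟩ := sel_main (Ω := J → Fin n) (Q := {x : Fin 4 → Fin n // Function.Injective x})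
    Meet (M ^ 2 / n) (by positivity) (fun b => meet_count hn0 b)
    (fun x f => AbsT H x.1 f) β (fun q => by rw [hΩ]; exact hab q.1 q.2) t s
    (by rw [ht]; positivity) (by
      rw [ht]
      have hc : (Fintype.card {x : Fin 4 → Fin n // Function.Injective x} : ℝ) ≤ (n : ℝ) ^ 4 := by
        have := Fintype.card_subtype_le (fun x : Fin 4 → Fin n => Function.Injective x)
        rw [Fintype.card_fun, Fintype.card_fin, Fintype.card_fin] at this
        exact_mod_cast this
      have h1 : (2 : ℝ) ^ s * (1 - β / 2) ^ (r * s) ≤ (1 / 2) ^ s := by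
        rw [pow_mul, ← mul_pow]
        have : (0 : ℝ) ≤ (1 - β / 2) ^ r := pow_nonneg (by linarith) _
        exact pow_le_pow_left₀ (by positivity) (by linarith) _
      calc _ ≤ (n : ℝ) ^ 4 * (1 / 2) ^ s := by
            refine mul_le_mul hc h1 ?_ (by positivity)
            exact mul_nonneg (by positivity) (pow_nonneg (by linarith) _)
        _ < (1 / 2 * 2 ^ s) * (1 / 2) ^ s := mul_lt_mul_of_pos_right hpow (by positivity)
        _ = 1 / 2 := by rw [mul_assoc, ← mul_pow]; norm_num)
  let bad : Finset (Fin t) := univ.filter fun i => ∃ j, i ≠ j ∧ Meet (F i) (F j)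
  have hbad : (bad.card : ℝ) ≤ s / 2 := by
    have h1 : (bad.card : ℝ) ≤ cnt (fun p : Fin t × Fin t => p.1 ≠ p.2 ∧ Meet (F p.1) (F p.2)) := by
      rw [cnt_eq_card]
      have : bad ⊆ (univ.filter fun p : Fin t × Fin t => p.1 ≠ p.2 ∧ Meet (F p.1) (F p.2)).image Prod.fst := by
        intro i hi
        simp only [bad, mem_filter, mem_univ, true_and] at hi
        obtain ⟨j, hj⟩ := hi
        exact mem_image.2 ⟨(i, j), by simpa using hj, rfl⟩
      exact_mod_cast (card_le_card this).trans card_image_le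
    refine h1.trans (hF1.trans ?_)
    rw [ht]; push_cast
    have h2 : 2 * ((r : ℝ) * s) ^ 2 * (M ^ 2 / n) = (s : ℝ) * s * (2 * r ^ 2 * M ^ 2) / n := by ring
    rw [h2, div_le_iff₀ hn0']
    calc (s : ℝ) * s * (2 * r ^ 2 * M ^ 2) ≤ s * (κ * n) * (2 * r ^ 2 * M ^ 2) := by gcongr
      _ = s / 2 * n * (κ * (4 * r ^ 2 * M ^ 2)) := by ring
      _ ≤ s / 2 * n * 1 := by gcongr
      _ = _ := by ring
  let I : Finset (Fin t) := univ.filter fun i => i ∉ bad ∧ HasK4mFactorOn H (univ.image (F i))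
  have hI : ∀ i ∈ I, HasK4mFactorOn H (univ.image (F i)) := fun i hi => by
    simp only [I, mem_filter] at hi; exact hi.2.2
  have hdis : ∀ i ∈ I, ∀ j ∈ I, i ≠ j → Disjoint (univ.image (F i)) (univ.image (F j)) := by
    intro i hi j hj hij
    simp only [I, mem_filter, bad, mem_univ, true_and, not_exists, not_and] at hi
    have := hi.1 j hij
    rw [disjoint_left]
    simp only [mem_image, mem_univ, true_and, not_exists]
    rintro z ⟨a, rfl⟩ b h
    exact this ⟨(a, b), trivial, h.symm⟩
  have hW : HasK4mFactorOn H (I.biUnion fun i => univ.image (F i)) :=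
    factor_biUnion _ _ hI hdis
  refine ⟨I.biUnion fun i => univ.image (F i), ?_, fun U hU hUc hU4 => ⟨hW, ?_⟩⟩
  · have h1 : (I.biUnion fun i => univ.image (F i)).card ≤ t * Fintype.card J := by
      refine card_biUnion_le.trans ?_
      calc _ ≤ ∑ i ∈ I, Fintype.card J := sum_le_sum fun i _ => card_image_le
        _ = I.card * Fintype.card J := by simp
        _ ≤ t * Fintype.card J := Nat.mul_le_mul_right _ (by simpa using card_le_univ I)
    have h2 : ((I.biUnion fun i => univ.image (F i)).card : ℝ) ≤ (r * s) * M := by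
      rw [hM]; exact_mod_cast h1.trans (le_of_eq (by rw [ht]))
    calc _ ≤ (r * s) * M := h2
      _ ≤ r * (κ * n) * M := by gcongr
      _ = κ * (r * M) * n := by ring
      _ ≤ ε * n := by gcongr
  · obtain ⟨r', hr'⟩ := hU4
    refine absorb_final t r' F I hI hdis ?_ U ?_ r' (by omega) le_rfl
    · intro x hx
      refine ⟨(univ.filter fun i => AbsT H x (F i)) \ bad, ?_, ?_, ?_⟩
      · intro i hi
        simp only [mem_sdiff, mem_filter, mem_univ, true_and] at hi
        simp only [I, mem_filter, mem_univ, true_and]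
        exact ⟨hi.2, hi.1.1⟩
      · have h1 := hF2 ⟨x, hx⟩
        rw [cnt_eq_card] at h1
        have h2 := le_card_sdiff bad (univ.filter fun i => AbsT H x (F i))
        have h3 : ((univ.filter fun i => AbsT H x (F i)).card : ℝ) ≤
            ((univ.filter fun i => AbsT H x (F i)) \ bad).card + bad.card := by
          have : (univ.filter fun i => AbsT H x (F i)).card ≤
            ((univ.filter fun i => AbsT H x (F i)) \ bad).card + bad.card := by omega
          exact_mod_cast this
        have h4 : (r' : ℝ) * 4 ≤ κ * n := by
          rw [hr'] at hUc; push_cast at hUc; linarith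
        have h5 : (r' : ℝ) ≤ ((univ.filter fun i => AbsT H x (F i)) \ bad).card := by
          linarith
        exact_mod_cast h5
      · intro i hi
        simp only [mem_sdiff, mem_filter, mem_univ, true_and] at hi
        exact hi.1
    · rw [disjoint_left]
      intro z hz
      have := hU hz
      simp only [mem_sdiff, mem_univ, true_and] at this
      exact this

noncomputable section

/-- edge indicator -/
def hh {n : ℕ} (H : Finset (Finset (Fin n))) (a b c : Fin n) : ℝ := ind (({a, b, c} : Finset (Fin n)) ∈ H)
/-- K4minus indicator -/
def k4 {n : ℕ} (H : Finset (Finset (Fin n))) (a b c d : Fin n) : ℝ := ind (SpansK4m H {a, b, c, d})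
/-- normalized degree -/
def NN {n : ℕ} (H : Finset (Finset (Fin n))) (P : Finset (Fin n)) (a b : Fin n) : ℝ :=
  (∑ z ∈ P, hh H a b z) / n
/-- normalized double sum -/
def S2 {n : ℕ} (P Q : Finset (Fin n)) (φ : Fin n → Fin n → ℝ) : ℝ :=
  (∑ a ∈ P, ∑ b ∈ Q, φ a b) / (n : ℝ) ^ 2
/-- normalized count of K4minus -/
def KN {n : ℕ} (H : Finset (Finset (Fin n))) (P Q R M : Finset (Fin n)) : ℝ :=
  (∑ a ∈ P, ∑ b ∈ Q, ∑ c ∈ R, ∑ d ∈ M, k4 H a b c d) / (n : ℝ) ^ 4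
/-- density -/
def dn {n : ℕ} (P : Finset (Fin n)) : ℝ := (P.card : ℝ) / n
/-- diagonal -/
def dd {n : ℕ} (a b : Fin n) : ℝ := ind (a = b)

section basics
variable {n : ℕ} {H : Finset (Finset (Fin n))}

lemma hh_12 (a b c : Fin n) : hh H b a c = hh H a b c := by
  unfold hh; rw [insert_comm]
lemma hh_23 (a b c : Fin n) : hh H a c b = hh H a b c := by
  unfold hh; rw [pair_comm]
lemma hh_nonneg (a b c : Fin n) : 0 ≤ hh H a b c := ind_nonneg _
lemma hh_le_one (a b c : Fin n) : hh H a b c ≤ 1 := ind_le_one _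
lemma k4_nonneg (a b c d : Fin n) : 0 ≤ k4 H a b c d := ind_nonneg _
lemma k4_le_one (a b c d : Fin n) : k4 H a b c d ≤ 1 := ind_le_one _
lemma k4_12 (a b c d : Fin n) : k4 H b a c d = k4 H a b c d := by
  unfold k4; rw [insert_comm]
lemma k4_23 (a b c d : Fin n) : k4 H a c b d = k4 H a b c d := by
  unfold k4; rw [insert_comm b c]
lemma k4_34 (a b c d : Fin n) : k4 H a b d c = k4 H a b c d := by
  unfold k4; rw [pair_comm c d]

lemma edge_ne (h3 : Is3Graph n H) {a b c : Fin n} (h : ({a, b, c} : Finset (Fin n)) ∈ H) :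
    a ≠ b ∧ a ≠ c ∧ b ≠ c := by
  have := h3 _ h
  exact card_eq_three_iff_ne this
where
  card_eq_three_iff_ne {a b c : Fin n} (h : ({a, b, c} : Finset (Fin n)).card = 3) :
    a ≠ b ∧ a ≠ c ∧ b ≠ c := by
    refine ⟨?_, ?_, ?_⟩ <;> rintro rfl
    · have := card_le_two (a := a) (b := c); simp at h; omega
    · have := card_le_two (a := a) (b := b); rw [pair_comm b a] at h; simp at h; omega
    · have := card_le_two (a := a) (b := b); simp at h; omega

lemma spans_of (h3 : Is3Graph n H) {a b c z : Fin n} (h1 : ({a, b, c} : Finset (Fin n)) ∈ H)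
    (h2 : ({a, b, z} : Finset (Fin n)) ∈ H) (h4 : ({b, c, z} : Finset (Fin n)) ∈ H) :
    SpansK4m H {a, b, c, z} := by
  obtain ⟨ab, ac, bc⟩ := edge_ne h3 h1
  obtain ⟨-, az, bz⟩ := edge_ne h3 h2
  obtain ⟨-, -, cz⟩ := edge_ne h3 h4
  constructor
  · rw [card_insert_of_notMem, card_insert_of_notMem, card_pair cz] <;> simp [*]
  · have hsub : ({{a, b, c}, {a, b, z}, {b, c, z}} : Finset (Finset (Fin n))) ⊆
      (powersetCard 3 {a, b, c, z}).filter (· ∈ H) := by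
      intro e he
      simp only [mem_insert, mem_singleton] at he
      rw [mem_filter, mem_powersetCard]
      rcases he with rfl | rfl | rfl
      · exact ⟨⟨by intro x; simp; tauto, h3 _ h1⟩, h1⟩
      · exact ⟨⟨by intro x; simp; tauto, h3 _ h2⟩, h2⟩
      · exact ⟨⟨by intro x; simp; tauto, h3 _ h4⟩, h4⟩
    refine le_trans (le_of_eq ?_) (card_le_card hsub)
    have e1 : ({a, b, c} : Finset (Fin n)) ≠ {a, b, z} := by
      intro h; have : z ∈ ({a, b, c} : Finset (Fin n)) := by rw [h]; simp
      simp [az.symm, bz.symm, cz.symm] at this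
    have e2 : ({a, b, c} : Finset (Fin n)) ≠ {b, c, z} := by
      intro h; have : z ∈ ({a, b, c} : Finset (Fin n)) := by rw [h]; simp
      simp [az.symm, bz.symm, cz.symm] at this
    have e3 : ({a, b, z} : Finset (Fin n)) ≠ {b, c, z} := by
      intro h; have : a ∈ ({b, c, z} : Finset (Fin n)) := by rw [← h]; simp
      simp [ab, ac, az] at this
    rw [card_insert_of_notMem, card_pair e3]
    simp [e1, e2]

lemma Tpoint (h3 : Is3Graph n H) (a b c z : Fin n) :
    hh H a b c * hh H a b z + hh H b c a * hh H b c z + hh H a c b * hh H a c z ≤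
      hh H a b c + 2 * k4 H a b c z := by
  have e1 : hh H b c a = hh H a b c := by rw [hh_23, hh_12]
  have e2 : hh H a c b = hh H a b c := hh_23 _ _ _
  rw [e1, e2]
  by_cases h : ({a, b, c} : Finset (Fin n)) ∈ H
  · have hp : hh H a b c = 1 := ind_pos h
    rw [hp]
    have b1 := hh_le_one (H := H) a b z
    have b2 := hh_le_one (H := H) b c z
    have b3 := hh_le_one (H := H) a c z
    have b4 := k4_nonneg (H := H) a b c z
    by_cases h1 : ({a, b, z} : Finset (Fin n)) ∈ H
    · by_cases h2 : ({b, c, z} : Finset (Fin n)) ∈ H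
      · have : k4 H a b c z = 1 := ind_pos (spans_of h3 h h1 h2)
        linarith
      · have z2 : hh H b c z = 0 := ind_neg h2
        by_cases h4 : ({a, c, z} : Finset (Fin n)) ∈ H
        · have : k4 H b a c z = 1 := ind_pos (spans_of h3 (by rwa [insert_comm]) (by rwa [insert_comm]) h4)
          rw [k4_12] at this
          linarith
        · have z3 : hh H a c z = 0 := ind_neg h4
          linarith
    · have z1 : hh H a b z = 0 := ind_neg h1
      by_cases h2 : ({b, c, z} : Finset (Fin n)) ∈ H
      · by_cases h4 : ({a, c, z} : Finset (Fin n)) ∈ H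
        · have : k4 H a c b z = 1 := ind_pos (spans_of h3 (by rwa [pair_comm c b]) h4 (by rwa [insert_comm]))
          rw [k4_23] at this
          linarith
        · have z3 : hh H a c z = 0 := ind_neg h4
          linarith
      · have z2 : hh H b c z = 0 := ind_neg h2
        linarith
  · have hp : hh H a b c = 0 := ind_neg h
    rw [hp]
    have b4 := k4_nonneg (H := H) a b c z
    linarith

lemma NN_comm (P : Finset (Fin n)) (a b : Fin n) : NN H P a b = NN H P b a := by
  unfold NN; simp only [hh_12]
lemma NN_nonneg (P : Finset (Fin n)) (a b : Fin n) : 0 ≤ NN H P a b :=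
  div_nonneg (sum_nonneg fun _ _ => hh_nonneg _ _ _) (by positivity)
lemma NN_le (P : Finset (Fin n)) (a b : Fin n) : NN H P a b ≤ dn P := by
  unfold NN dn
  gcongr
  calc _ ≤ ∑ z ∈ P, (1 : ℝ) := sum_le_sum fun _ _ => hh_le_one _ _ _
    _ = _ := by simp
lemma dn_nonneg (P : Finset (Fin n)) : 0 ≤ dn P := by unfold dn; positivity
lemma dn_le_one (P : Finset (Fin n)) : dn P ≤ 1 := by
  unfold dn
  refine div_le_one_of_le₀ ?_ (by positivity)
  have := card_le_univ P
  rw [Fintype.card_fin] at this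
  exact_mod_cast this
lemma NN_le_one (P : Finset (Fin n)) (a b : Fin n) : NN H P a b ≤ 1 := (NN_le _ _ _).trans (dn_le_one _)
lemma NN_union (P Q : Finset (Fin n)) (h : Disjoint P Q) (a b : Fin n) :
    NN H (P ∪ Q) a b = NN H P a b + NN H Q a b := by
  unfold NN; rw [sum_union h, add_div]
lemma NN_compl (P : Finset (Fin n)) (a b : Fin n) :
    NN H univ a b = NN H P a b + NN H Pᶜ a b := by
  rw [← NN_union _ _ disjoint_compl_right, union_compl]
lemma dn_compl (hn : 0 < n) (P : Finset (Fin n)) : dn P + dn Pᶜ = 1 := by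
  have hn' : (0 : ℝ) < n := by exact_mod_cast hn
  unfold dn
  rw [← add_div, div_eq_one_iff_eq hn'.ne']
  have := card_add_card_compl P
  rw [Fintype.card_fin] at this
  exact_mod_cast this
lemma dn_univ (hn : 0 < n) : dn (univ : Finset (Fin n)) = 1 := by
  have hn' : (0 : ℝ) < n := by exact_mod_cast hn
  unfold dn; simp [hn'.ne']
lemma dn_union (P Q : Finset (Fin n)) (h : Disjoint P Q) : dn (P ∪ Q) = dn P + dn Q := by
  unfold dn; rw [card_union_of_disjoint h]; push_cast; rw [add_div]

lemma S2_mono {P Q : Finset (Fin n)} {φ ψ : Fin n → Fin n → ℝ}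
    (h : ∀ a ∈ P, ∀ b ∈ Q, φ a b ≤ ψ a b) : S2 P Q φ ≤ S2 P Q ψ := by
  unfold S2
  gcongr with a ha b hb
  exact h a ha b hb
lemma S2_nonneg {P Q : Finset (Fin n)} {φ : Fin n → Fin n → ℝ}
    (h : ∀ a ∈ P, ∀ b ∈ Q, 0 ≤ φ a b) : 0 ≤ S2 P Q φ :=
  div_nonneg (sum_nonneg fun a ha => sum_nonneg fun b hb => h a ha b hb) (by positivity)
lemma S2_add (P Q : Finset (Fin n)) (φ ψ : Fin n → Fin n → ℝ) :
    S2 P Q (fun a b => φ a b + ψ a b) = S2 P Q φ + S2 P Q ψ := by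
  unfold S2; simp only [sum_add_distrib, add_div]
lemma S2_sub (P Q : Finset (Fin n)) (φ ψ : Fin n → Fin n → ℝ) :
    S2 P Q (fun a b => φ a b - ψ a b) = S2 P Q φ - S2 P Q ψ := by
  unfold S2; simp only [sum_sub_distrib, sub_div]
lemma S2_smul (P Q : Finset (Fin n)) (c : ℝ) (φ : Fin n → Fin n → ℝ) :
    S2 P Q (fun a b => c * φ a b) = c * S2 P Q φ := by
  unfold S2; rw [← mul_div_assoc, mul_sum]; simp only [mul_sum]
lemma S2_const (P Q : Finset (Fin n)) (c : ℝ) :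
    S2 P Q (fun _ _ => c) = c * (dn P * dn Q) := by
  unfold S2 dn; simp only [sum_const, nsmul_eq_mul]; ring
lemma S2_swap (P Q : Finset (Fin n)) (φ : Fin n → Fin n → ℝ) :
    S2 P Q φ = S2 Q P (fun a b => φ b a) := by
  unfold S2; rw [sum_comm]
lemma S2_dd (P Q : Finset (Fin n)) : S2 P Q dd ≤ 1 / n := by
  unfold S2 dd
  have h1 : ∀ a ∈ P, ∑ b ∈ Q, ind (a = b) ≤ 1 := by
    intro a _
    calc ∑ b ∈ Q, ind (a = b) ≤ ∑ b, ind (a = b) :=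
          sum_le_sum_of_subset_of_nonneg (subset_univ _) fun _ _ _ => ind_nonneg _
      _ = ind (a = a) := sum_eq_single a (fun b _ hb => ind_neg (Ne.symm hb)) (by simp)
      _ = 1 := ind_pos rfl
  rcases Nat.eq_zero_or_pos n with rfl | hn
  · simp
  have hn' : (0 : ℝ) < n := by exact_mod_cast hn
  calc _ ≤ (n : ℝ) / n ^ 2 := by
        gcongr
        calc _ ≤ ∑ a ∈ P, (1 : ℝ) := sum_le_sum h1
          _ = P.card := by simp
          _ ≤ n := by
            have := card_le_univ P
            rw [Fintype.card_fin] at this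
            exact_mod_cast this
    _ = _ := by field_simp
lemma dd_nonneg (a b : Fin n) : 0 ≤ dd a b := ind_nonneg _

lemma S2_CS (P Q : Finset (Fin n)) (φ ψ : Fin n → Fin n → ℝ) :
    (S2 P Q (fun a b => φ a b * ψ a b)) ^ 2 ≤
      S2 P Q (fun a b => φ a b ^ 2) * S2 P Q (fun a b => ψ a b ^ 2) := by
  unfold S2
  simp only [← sum_product']
  rw [div_pow, div_mul_div_comm, ← sq]
  gcongr
  exact sum_mul_sq_le_sq_mul_sq _ _ _

lemma S2_sq (P Q : Finset (Fin n)) (φ : Fin n → Fin n → ℝ) :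
    (S2 P Q φ) ^ 2 ≤ S2 P Q (fun a b => φ a b ^ 2) * (dn P * dn Q) := by
  have := S2_CS P Q φ (fun _ _ => 1)
  simp only [mul_one, one_pow] at this
  rwa [S2_const, one_mul] at this

lemma E_swap (P Q R : Finset (Fin n)) : S2 P Q (NN H R) = S2 P R (NN H Q) := by
  unfold S2 NN
  simp only [← sum_div]
  congr 2
  refine sum_congr rfl fun a _ => ?_
  rw [sum_comm]
  simp only [hh_23]

lemma E_comm (P Q R : Finset (Fin n)) : S2 P Q (NN H R) = S2 Q P (NN H R) := by
  rw [S2_swap]; congr 1; ext a b; exact NN_comm _ _ _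

lemma Tprime (h3 : Is3Graph n H) (hn : 0 < n) (P Q R M : Finset (Fin n)) :
    S2 P Q (fun a b => NN H R a b * NN H M a b) + S2 Q R (fun a b => NN H P a b * NN H M a b) +
      S2 P R (fun a b => NN H Q a b * NN H M a b) ≤
    dn M * S2 P Q (NN H R) + 2 * KN H P Q R M := by
  have hn' : (0 : ℝ) < n := by exact_mod_cast hn
  have hs : ∑ a ∈ P, ∑ b ∈ Q, ∑ c ∈ R, ∑ z ∈ M, (hh H a b c * hh H a b z + hh H b c a * hh H b c z +
      hh H a c b * hh H a c z) ≤ ∑ a ∈ P, ∑ b ∈ Q, ∑ c ∈ R, ∑ z ∈ M, (hh H a b c + 2 * k4 H a b c z) :=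
    sum_le_sum fun a _ => sum_le_sum fun b _ => sum_le_sum fun c _ => sum_le_sum fun z _ =>
      Tpoint h3 a b c z
  simp only [sum_add_distrib, ← mul_sum] at hs
  have e1 : S2 P Q (fun a b => NN H R a b * NN H M a b) =
      (∑ a ∈ P, ∑ b ∈ Q, ∑ c ∈ R, hh H a b c * ∑ z ∈ M, hh H a b z) / (n : ℝ) ^ 4 := by
    unfold S2 NN
    simp only [div_mul_div_comm, ← sum_div, sum_mul, div_div]
    congr 1; ring
  have e2 : S2 Q R (fun a b => NN H P a b * NN H M a b) =
      (∑ a ∈ P, ∑ b ∈ Q, ∑ c ∈ R, hh H b c a * ∑ z ∈ M, hh H b c z) / (n : ℝ) ^ 4 := by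
    unfold S2 NN
    simp only [div_mul_div_comm, ← sum_div, sum_mul, div_div]
    congr 1
    · symm; rw [sum_comm]
      refine sum_congr rfl fun b _ => ?_
      rw [sum_comm]
    · ring
  have e3 : S2 P R (fun a b => NN H Q a b * NN H M a b) =
      (∑ a ∈ P, ∑ b ∈ Q, ∑ c ∈ R, hh H a c b * ∑ z ∈ M, hh H a c z) / (n : ℝ) ^ 4 := by
    unfold S2 NN
    simp only [div_mul_div_comm, ← sum_div, sum_mul, div_div]
    congr 1
    · refine sum_congr rfl fun a _ => ?_
      rw [sum_comm]
    · ring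
  have e4 : dn M * S2 P Q (NN H R) =
      (∑ a ∈ P, ∑ b ∈ Q, ∑ c ∈ R, ∑ z ∈ M, hh H a b c) / (n : ℝ) ^ 4 := by
    unfold S2 NN dn
    simp only [← sum_div, sum_const, nsmul_eq_mul, ← mul_sum]
    field_simp
  have e5 : 2 * KN H P Q R M = (2 * ∑ a ∈ P, ∑ b ∈ Q, ∑ c ∈ R, ∑ z ∈ M, k4 H a b c z) / (n : ℝ) ^ 4 := by
    unfold KN; ring
  rw [e1, e2, e3, e4, e5, ← add_div, ← add_div, ← add_div]
  gcongr

lemma KN_nonneg (P Q R M : Finset (Fin n)) : 0 ≤ KN H P Q R M :=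
  div_nonneg (sum_nonneg fun _ _ => sum_nonneg fun _ _ => sum_nonneg fun _ _ => sum_nonneg fun _ _ =>
    k4_nonneg _ _ _ _) (by positivity)
lemma KN_12 (P Q R M : Finset (Fin n)) : KN H Q P R M = KN H P Q R M := by
  unfold KN; rw [sum_comm]; simp only [k4_12]
lemma KN_23 (P Q R M : Finset (Fin n)) : KN H P R Q M = KN H P Q R M := by
  unfold KN; congr 1
  refine sum_congr rfl fun a _ => ?_
  rw [sum_comm]; simp only [k4_23]
lemma KN_34 (P Q R M : Finset (Fin n)) : KN H P Q M R = KN H P Q R M := by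
  unfold KN; congr 1
  refine sum_congr rfl fun a _ => sum_congr rfl fun b _ => ?_
  rw [sum_comm]; simp only [k4_34]
lemma KN_mono (P Q R : Finset (Fin n)) {M M' : Finset (Fin n)} (h : M ⊆ M') :
    KN H P Q R M ≤ KN H P Q R M' := by
  unfold KN
  gcongr
  exact fun _ _ _ => k4_nonneg _ _ _ _
lemma KN_union (P Q R M M' : Finset (Fin n)) :
    KN H P Q R (M ∪ M') ≤ KN H P Q R M + KN H P Q R M' := by
  unfold KN
  rw [← add_div]
  gcongr
  simp only [← sum_add_distrib]
  refine sum_le_sum fun a _ => sum_le_sum fun b _ => sum_le_sum fun c _ => ?_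
  rw [← sum_union_inter]
  have : 0 ≤ ∑ d ∈ M ∩ M', k4 H a b c d := sum_nonneg fun _ _ => k4_nonneg _ _ _ _
  linarith
lemma KN_le_dn (hn : 0 < n) (P Q R M : Finset (Fin n)) : KN H P Q R M ≤ dn M := by
  have hn' : (0 : ℝ) < n := by exact_mod_cast hn
  have hc : ∀ P : Finset (Fin n), (P.card : ℝ) ≤ n := fun P => by
    have := card_le_univ P
    rw [Fintype.card_fin] at this
    exact_mod_cast this
  unfold KN dn
  rw [div_le_div_iff₀ (by positivity) hn']
  calc (∑ a ∈ P, ∑ b ∈ Q, ∑ c ∈ R, ∑ d ∈ M, k4 H a b c d) * n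
      ≤ (∑ a ∈ P, ∑ b ∈ Q, ∑ c ∈ R, ∑ d ∈ M, (1 : ℝ)) * n := by
        gcongr with a _ b _ c _ d _; exact k4_le_one _ _ _ _
    _ = (P.card : ℝ) * (Q.card * (R.card * M.card)) * n := by simp
    _ ≤ (n : ℝ) * (n * (n * M.card)) * n := by
      gcongr <;> exact_mod_cast hc _
    _ = _ := by ring

end basics
end

lemma subhalf_aux (s T c r e : ℝ) (hs : 0 ≤ s) (hc : 0 ≤ c) (hc1 : c ≤ 1) (hr : 0 ≤ r) (hr1 : r ≤ 1)
    (he0 : 0 ≤ e) (he : e ≤ 1 / 10 ^ 14) (h1 : 2 * T ≤ c * s + 2 * e) (h2 : s ^ 2 ≤ T * (c * r)) :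
    s ≤ c ^ 2 * r / 2 + 1 / 10 ^ 7 := by
  by_contra hcon
  push Not at hcon
  have hcr : 0 ≤ c * r := by positivity
  have hcr1 : c * r ≤ 1 := by nlinarith
  have h3 : 2 * s ^ 2 ≤ (c * s + 2 * e) * (c * r) := by nlinarith
  have h4 : s * (2 * s - c ^ 2 * r) ≤ 2 * e := by nlinarith
  have h5 : 0 ≤ c ^ 2 * r := by positivity
  have h6 : (1 / 10 ^ 7 : ℝ) < s := by linarith
  have h7 : (2 / 10 ^ 7 : ℝ) < 2 * s - c ^ 2 * r := by linarith
  have h8 : (1 / 10 ^ 7 : ℝ) * (2 / 10 ^ 7) < s * (2 * s - c ^ 2 * r) := by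
    apply mul_lt_mul'' h6 h7 <;> norm_num
  norm_num at h8 he
  linarith

lemma subthird_aux (s T c e : ℝ) (hs : 0 ≤ s) (hc : 0 ≤ c) (hc1 : c ≤ 1)
    (he0 : 0 ≤ e) (he : e ≤ 1 / 10 ^ 14) (h1 : 3 * T ≤ c * s + 2 * e) (h2 : s ^ 2 ≤ T * (c * c)) :
    s ≤ c ^ 3 / 3 + 1 / 10 ^ 7 := by
  by_contra hcon
  push Not at hcon
  have hcr : 0 ≤ c * c := by positivity
  have hcr1 : c * c ≤ 1 := by nlinarith
  have h3 : 3 * s ^ 2 ≤ (c * s + 2 * e) * (c * c) := by nlinarith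
  have h4 : s * (3 * s - c ^ 3) ≤ 2 * e := by nlinarith
  have h5 : 0 ≤ c ^ 3 := by positivity
  have h6 : (1 / 10 ^ 7 : ℝ) < s := by linarith
  have h7 : (3 / 10 ^ 7 : ℝ) < 3 * s - c ^ 3 := by linarith
  have h8 : (1 / 10 ^ 7 : ℝ) * (3 / 10 ^ 7) < s * (3 * s - c ^ 3) := by
    apply mul_lt_mul'' h6 h7 <;> norm_num
  norm_num at h8 he
  linarith

lemma lemB_arith2 (c sf G2 F2 FG : ℝ) (hc : 6 / 25 ≤ c) (hc2 : c ≤ 17 / 50) (hG0 : 0 ≤ G2)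
    (cs3 : FG ^ 2 ≤ F2 * G2) (b3 : c ^ 2 * (2 * c / 3) - 0.000001 ≤ sf) (b3' : 0.009 ≤ sf)
    (b4 : G2 ≤ c ^ 4 / 9 + 0.000001) (b5 : (0.4998 - c) * sf ≤ FG) (b6 : F2 ≤ (c + 0.0001) * sf) : False := by
  have h1 : ((0.4998 - c) * sf) ^ 2 ≤ FG ^ 2 := by
    apply pow_le_pow_left₀ _ b5
    apply mul_nonneg <;> linarith
  have h2 : F2 * G2 ≤ ((c + 0.0001) * sf) * (c ^ 4 / 9 + 0.000001) := by
    apply mul_le_mul b6 b4 hG0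
    apply mul_nonneg <;> linarith
  have b8 : (0.4998 - c) ^ 2 * sf ≤ (c + 0.0001) * (c ^ 4 / 9 + 0.000001) := by
    have : ((0.4998 - c) ^ 2 * sf) * sf ≤ ((c + 0.0001) * (c ^ 4 / 9 + 0.000001)) * sf := by
      calc _ = ((0.4998 - c) * sf) ^ 2 := by ring
        _ ≤ _ := h1.trans (cs3.trans h2)
        _ = _ := by ring
    exact le_of_mul_le_mul_right this (by linarith)
  have b9 : 0.0255 ≤ (0.4998 - c) ^ 2 := by
    have := pow_le_pow_left₀ (by norm_num) (by linarith : (0.1598:ℝ) ≤ 0.4998 - c) 2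
    norm_num at this ⊢; linarith
  have c3 : 0.0138 ≤ c ^ 3 := by
    have := pow_le_pow_left₀ (by norm_num) hc 3
    norm_num at this ⊢; linarith
  have c2u : c ^ 2 ≤ 0.1156 := by
    have := pow_le_pow_left₀ (by linarith) hc2 2
    norm_num at this ⊢; linarith
  have b10 : 0.0255 * (c ^ 2 * (2 * c / 3) - 0.000001) ≤ (0.4998 - c) ^ 2 * sf := by
    apply mul_le_mul b9 b3 _ (by positivity)
    have : c ^ 2 * (2 * c / 3) = 2 / 3 * c ^ 3 := by ring
    rw [this]; linarith
  have p1 : c ^ 5 ≤ 0.1156 * c ^ 3 := by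
    have : c ^ 5 = c ^ 2 * c ^ 3 := by ring
    rw [this]; apply mul_le_mul_of_nonneg_right c2u; positivity
  have p2 : c ^ 4 ≤ 1 := pow_le_one₀ (by linarith) (by linarith)
  have b12 : (c + 0.0001) * (c ^ 4 / 9 + 0.000001) ≤ 0.1156 / 9 * c ^ 3 + 0.00002 := by
    have : (c + 0.0001) * (c ^ 4 / 9 + 0.000001) = c ^ 5 / 9 + 0.0001 / 9 * c ^ 4 + 0.000001 * c + 0.0000000001 := by ring
    rw [this]; linarith
  have : c ^ 2 * (2 * c / 3) = 2 / 3 * c ^ 3 := by ring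
  rw [this] at b10
  linarith

lemma lemB_arith (h e c d sg sm sf G2 F2 FM FG : ℝ) (g1 : 49999999 / 100000000 ≤ h) (ge : e ≤ 1 / 100000000000000)
    (e0 : 0 ≤ e) (hc : 6 / 25 ≤ c) (hc2 : c ≤ 17 / 50) (hcd : c ≤ d) (u : sg ≤ c ^ 3 / 3 + 1 / 10000000)
    (v : sm ≤ c ^ 2 * (1 - c - d) / 2 + 1 / 10000000) (fm0 : 0 ≤ FM) (hG0 : 0 ≤ G2)
    (x1 : F2 + FM ≤ (1 + c - 2 * h) * sf + 2 * e) (x2 : h * sf - F2 - FM - e ≤ FG)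
    (x3 : h * (c * c) - e ≤ sg + (sf + sm)) (x4 : 3 * G2 ≤ c * sg + 2 * e) (x5 : 0 ≤ sf)
    (cs3 : FG ^ 2 ≤ F2 * G2) : False := by
  have b1 : F2 + FM ≤ (1 + c - 2 * h) * sf + 2 * e := by linarith
  have b2 : (3 * h - 1 - c) * sf - 3 * e ≤ FG := by linarith
  have b3 : c ^ 2 * (2 * c / 3) - 0.000001 ≤ sf := by
    nlinarith [mul_nonneg (sq_nonneg c) (sub_nonneg.2 hcd), mul_nonneg (sq_nonneg c) (sub_nonneg.2 g1)]
  have b3' : 0.009 ≤ sf := by nlinarith [sq_nonneg c, mul_nonneg (sub_nonneg.2 hc) (sub_nonneg.2 hc)]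
  have b4 : G2 ≤ c ^ 4 / 9 + 0.000001 := by
    have := mul_nonneg (by linarith : 0 ≤ c) (sub_nonneg.2 u)
    nlinarith
  have b5 : (0.4998 - c) * sf ≤ FG := by nlinarith
  have b6 : F2 ≤ (c + 0.0001) * sf := by nlinarith
  exact lemB_arith2 c sf G2 F2 FG hc hc2 hG0 cs3 b3 b3' b4 b5 b6

section
variable {n : ℕ} {H : Finset (Finset (Fin n))}

/-- basic hypotheses -/
structure Good (H : Finset (Finset (Fin n))) (h e : ℝ) : Prop where
  h3 : Is3Graph n H
  hn : 0 < n
  hne : 1 / (n : ℝ) ≤ e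
  h1 : 1 / 2 - 1 / 10 ^ 8 ≤ h
  h2 : h ≤ 1 / 2
  he : e ≤ 1 / 10 ^ 14
  cod : ∀ a b : Fin n, h - dd a b ≤ NN H univ a b

lemma Good.e0 {h e : ℝ} (G : Good H h e) : 0 ≤ e := le_trans (by positivity) G.hne
lemma Good.ddS {h e : ℝ} (G : Good H h e) (P Q : Finset (Fin n)) : S2 P Q dd ≤ e :=
  (S2_dd P Q).trans G.hne

lemma dd_disj {P Q : Finset (Fin n)} (hd : Disjoint P Q) {a b : Fin n} (ha : a ∈ P) (hb : b ∈ Q) :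
    dd a b = 0 := ind_neg (by rintro rfl; exact disjoint_left.1 hd ha hb)

lemma dd_cases (a b : Fin n) : dd a b = 0 ∨ dd a b = 1 := by
  by_cases h : a = b
  · exact .inr (ind_pos h)
  · exact .inl (ind_neg h)

/-- lower bound for the sum of the product of two complementary degrees -/
lemma FG_lower {h e : ℝ} (G : Good H h e) (X : Finset (Fin n)) (hX : dn X ≤ h) :
    (h - dn X) * (h * (dn X * dn X) - S2 X X (NN H Xᶜ)) - e ≤
      S2 X X (fun a b => NN H Xᶜ a b * NN H X a b) := by
  have h1 : S2 X X (fun a b => (h - dn X) * (h - NN H Xᶜ a b) - dd a b) ≤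
      S2 X X (fun a b => NN H Xᶜ a b * NN H X a b) := by
    refine S2_mono fun a _ b _ => ?_
    have c1 := G.cod a b
    rw [NN_compl X] at c1
    have c2 := NN_le (H := H) X a b
    have c3 := NN_nonneg (H := H) X a b
    have c4 := NN_nonneg (H := H) Xᶜ a b
    have c5 := dn_nonneg X
    have gh := G.h2
    rcases dd_cases a b with h0 | h0
    · rw [h0] at c1 ⊢
      rcases le_total h (NN H Xᶜ a b) with h6 | h6 <;> nlinarith
    · rw [h0]; nlinarith
  rw [S2_sub, S2_smul, S2_sub, S2_const] at h1
  have := G.ddS X X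
  linarith

lemma lemS1 {h e : ℝ} (G : Good H h e) (X : Finset (Fin n)) (β : ℝ)
    (hK : KN H X X univ univ ≤ β) (hβ : 100 * β ≤ dn X ^ 2) (he : 100 * e ≤ dn X ^ 2)
    (hX : 0 < dn X) : False := by
  have t := Tprime G.h3 G.hn X X univ univ
  rw [dn_univ G.hn, one_mul] at t
  set E := S2 X X (NN H univ) with hE
  have hE' : S2 X univ (NN H X) = E := by rw [hE, E_swap]
  have a1 : h * E - e ≤ S2 X univ (fun a b => NN H X a b * NN H univ a b) := by
    have : S2 X univ (fun a b => h * NN H X a b - dd a b) ≤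
      S2 X univ (fun a b => NN H X a b * NN H univ a b) := by
      refine S2_mono fun a _ b _ => ?_
      have c1 := G.cod a b
      have c2 := NN_nonneg (H := H) X a b
      have c3 := NN_le_one (H := H) X a b
      have c4 := dd_nonneg a b
      nlinarith
    rw [S2_sub, S2_smul, hE'] at this
    have := G.ddS X univ
    linarith
  have a2 : h * E - e ≤ S2 X X (fun a b => NN H univ a b * NN H univ a b) := by
    have : S2 X X (fun a b => h * NN H univ a b - dd a b) ≤
      S2 X X (fun a b => NN H univ a b * NN H univ a b) := by
      refine S2_mono fun a _ b _ => ?_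
      have c1 := G.cod a b
      have c2 := NN_nonneg (H := H) univ a b
      have c3 := NN_le_one (H := H) univ a b
      have c4 := dd_nonneg a b
      nlinarith
    rw [S2_sub, S2_smul] at this
    have := G.ddS X X
    linarith
  have a3 : h * dn X ^ 2 - e ≤ E := by
    have : S2 X X (fun a b => h - dd a b) ≤ E := S2_mono fun a _ b _ => G.cod a b
    rw [S2_sub, S2_const] at this
    have := G.ddS X X
    nlinarith
  have g1 := G.h1
  have g3 : 0 < dn X ^ 2 := by positivity
  have e0 := G.e0
  norm_num at g1
  have b1 : (3 * h - 1) * E ≤ 2 * β + 3 * e := by nlinarith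
  have b2 : 0.48 * dn X ^ 2 ≤ E := by nlinarith
  have b3 : 0 ≤ E := by linarith
  have b4 : 0.4 * E ≤ (3 * h - 1) * E := by
    apply mul_le_mul_of_nonneg_right _ b3
    linarith
  linarith

lemma lemA {h e : ℝ} (G : Good H h e) (X : Finset (Fin n)) (hc : 0.24 ≤ dn X) (hc2 : dn X ≤ 0.34)
    (hK : KN H X X X Xᶜ ≤ e) : False := by
  have t := Tprime G.h3 G.hn X X Xᶜ X
  rw [KN_34] at t
  have g1 := G.h1
  have g2 := G.h2
  have ge := G.he
  norm_num at g1 ge hc hc2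
  have fg := FG_lower G X (by linarith)
  have cs := S2_sq X Xᶜ (NN H X)
  have hd := dn_compl G.hn X
  simp only [sq] at cs
  rw [← E_swap X X Xᶜ] at cs
  set s := S2 X X (NN H Xᶜ)
  set T := S2 X Xᶜ (fun a b => NN H X a b * NN H X a b)
  set FG := S2 X X (fun a b => NN H Xᶜ a b * NN H X a b)
  set c := dn X
  have hd' : dn Xᶜ = 1 - c := by linarith
  rw [hd'] at cs
  have hs : 0 ≤ s := S2_nonneg fun a _ b _ => NN_nonneg _ _ _
  have hcc : 0 < c * (1 - c) := by nlinarith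
  have hT : s / 4 - c * (1 - c) / 64 ≤ T := by
    have h1 : (s / 4 - c * (1 - c) / 64) * (c * (1 - c)) ≤ T * (c * (1 - c)) := by
      nlinarith [sq_nonneg (s - c * (1 - c) / 8)]
    exact le_of_mul_le_mul_right h1 hcc
  have e0 := G.e0
  have f1 : (h - c) * h * c ^ 2 + s * (1 / 2 - h) - c * (1 - c) / 32 ≤ 3 * e := by nlinarith
  have f2 : (0.4999 - c) * 0.4999 ≤ (h - c) * h := by nlinarith
  have f3 : (0.4999 - c) * 0.4999 * c ^ 2 ≤ (h - c) * h * c ^ 2 := by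
    apply mul_le_mul_of_nonneg_right f2; positivity
  have f4 : 0 ≤ s * (1 / 2 - h) := by apply mul_nonneg hs; linarith
  have f5 : 0.001 ≤ c * ((0.4999 - c) * 0.4999 * c - (1 - c) / 32) := by
    have : 0.005 ≤ (0.4999 - c) * 0.4999 * c - (1 - c) / 32 := by nlinarith
    nlinarith
  nlinarith

lemma lemB {h e : ℝ} (G : Good H h e) (X D : Finset (Fin n)) (hXD : Disjoint X D)
    (hc : 0.24 ≤ dn X) (hc2 : dn X ≤ 0.34) (hcd : dn X ≤ dn D)
    (hK1 : KN H X X X Dᶜ ≤ e) (hK2 : KN H X X D Xᶜ ≤ e) : False := by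
  have g1 := G.h1
  have g2 := G.h2
  have ge := G.he
  have e0 := G.e0
  set R := (X ∪ D)ᶜ with hR
  have hXc : Xᶜ = D ∪ R := by
    ext z; simp only [hR, mem_compl, mem_union]
    constructor
    · intro hz; by_cases hD : z ∈ D
      · exact .inl hD
      · exact .inr (by tauto)
    · rintro (hz | hz)
      · exact fun hx => disjoint_left.1 hXD hx hz
      · tauto
  have hDR : Disjoint D R := by
    rw [disjoint_left]; intro z hz; simp [hR, hz]
  have hXR : Disjoint X R := by
    rw [disjoint_left]; intro z hz; simp [hR, hz]
  have hN : ∀ a b, NN H univ a b = NN H X a b + (NN H D a b + NN H R a b) := fun a b => by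
    rw [NN_compl X, hXc, NN_union _ _ hDR]
  have hN' : ∀ a b, NN H Xᶜ a b = (NN H D a b + NN H R a b) := fun a b => by
    rw [hXc, NN_union _ _ hDR]
  have hdn : dn X + (dn D + dn R) = 1 := by
    have := dn_compl G.hn X
    rwa [hXc, dn_union _ _ hDR] at this
  have t1 := Tprime G.h3 G.hn X X X X
  have k1 : KN H X X X X ≤ e := (KN_mono _ _ _ (fun z hz => by
    rw [mem_compl]; exact disjoint_left.1 hXD hz)).trans hK1
  have t2 := Tprime G.h3 G.hn X X R X
  have k2 : KN H X X R X ≤ e := by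
    rw [KN_34]
    exact (KN_mono _ _ _ (fun z hz => by
      rw [mem_compl]; exact fun hD => disjoint_left.1 hDR hD hz)).trans hK1
  have t3 := Tprime G.h3 G.hn X X D Xᶜ
  have cs1 := S2_sq X X (NN H X)
  have cs2 := S2_sq X R (NN H X)
  have cs3 := S2_CS X X (NN H D) (NN H X)
  rw [← E_swap X X R] at cs2
  simp only [sq] at cs1 cs2 cs3
  have hsg : 0 ≤ S2 X X (NN H X) := S2_nonneg fun a _ b _ => NN_nonneg _ _ _
  have hsm : 0 ≤ S2 X X (NN H R) := S2_nonneg fun a _ b _ => NN_nonneg _ _ _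
  have hsf : 0 ≤ S2 X X (NN H D) := S2_nonneg fun a _ b _ => NN_nonneg _ _ _
  have m0 : 0 ≤ S2 X X (fun a b => NN H R a b * NN H X a b) :=
    S2_nonneg fun a _ b _ => mul_nonneg (NN_nonneg _ _ _) (NN_nonneg _ _ _)
  have fm0 : 0 ≤ S2 X X (fun a b => NN H D a b * NN H R a b) :=
    S2_nonneg fun a _ b _ => mul_nonneg (NN_nonneg _ _ _) (NN_nonneg _ _ _)
  have a1 : (h - dn X) * S2 X X (NN H D) ≤ S2 X D (fun a b => NN H X a b * NN H Xᶜ a b) := by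
    rw [E_swap X X D, ← S2_smul]
    refine S2_mono fun a ha b hb => ?_
    have c1 := G.cod a b
    rw [NN_compl X, dd_disj hXD ha hb] at c1
    have c2 := NN_nonneg (H := H) X a b
    have c3 := NN_le (H := H) X a b
    nlinarith
  have a2 : S2 X X (fun a b => NN H D a b * NN H Xᶜ a b) =
      S2 X X (fun a b => NN H D a b * NN H D a b) + S2 X X (fun a b => NN H D a b * NN H R a b) := by
    rw [← S2_add]; congr 1; ext a b; rw [hN']; ring
  have a3 : h * S2 X X (NN H D) - S2 X X (fun a b => NN H D a b * NN H D a b) -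
      S2 X X (fun a b => NN H D a b * NN H R a b) - e ≤ S2 X X (fun a b => NN H D a b * NN H X a b) := by
    have : S2 X X (fun a b => h * NN H D a b - NN H D a b * NN H D a b - NN H D a b * NN H R a b - dd a b)
      ≤ S2 X X (fun a b => NN H D a b * NN H X a b) := by
      refine S2_mono fun a _ b _ => ?_
      have c1 := G.cod a b
      rw [hN] at c1
      have c2 := NN_nonneg (H := H) D a b
      have c3 := NN_le_one (H := H) D a b
      have c4 := dd_nonneg a b
      nlinarith
    rw [S2_sub, S2_sub, S2_sub, S2_smul] at this
    have := G.ddS X X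
    linarith
  have a4 : h * (dn X * dn X) - e ≤ S2 X X (NN H X) + (S2 X X (NN H D) + S2 X X (NN H R)) := by
    have : S2 X X (fun a b => h - dd a b) ≤ S2 X X (fun a b => NN H X a b + (NN H D a b + NN H R a b)) :=
      S2_mono fun a _ b _ => by rw [← hN]; exact G.cod a b
    rw [S2_sub, S2_const, S2_add, S2_add] at this
    have := G.ddS X X
    linarith
  have hR0 := dn_nonneg R
  have hR1 := dn_le_one R
  have hcompl := dn_compl G.hn X
  have hG0 : 0 ≤ S2 X X (fun a b => NN H X a b * NN H X a b) :=
    S2_nonneg fun a _ b _ => mul_nonneg (NN_nonneg _ _ _) (NN_nonneg _ _ _)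
  set sg := S2 X X (NN H X)
  set sm := S2 X X (NN H R)
  set sf := S2 X X (NN H D)
  set G2 := S2 X X (fun a b => NN H X a b * NN H X a b)
  set F2 := S2 X X (fun a b => NN H D a b * NN H D a b)
  set FM := S2 X X (fun a b => NN H D a b * NN H R a b)
  set FG := S2 X X (fun a b => NN H D a b * NN H X a b)
  set T2 := S2 X R (fun a b => NN H X a b * NN H X a b)
  set TD := S2 X D (fun a b => NN H X a b * NN H Xᶜ a b)
  set c := dn X
  set d := dn D
  have u := subthird_aux sg G2 c e hsg (dn_nonneg X) (dn_le_one X) e0 ge (by linarith) (by linarith [sq sg])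
  have v := subhalf_aux sm T2 c (dn R) e hsm (dn_nonneg X) (dn_le_one X) hR0 hR1 e0 ge (by linarith)
    (by linarith [sq sm])
  have hRe : dn R = 1 - c - d := by linarith
  rw [hRe] at v
  have hXce : dn Xᶜ = 1 - c := by linarith
  rw [hXce] at t3
  norm_num at g1 ge hc hc2 u v
  clear_value sg sm sf G2 F2 FM FG T2 TD c d
  exact lemB_arith h e c d sg sm sf G2 F2 FM FG g1 ge e0 hc hc2 hcd u v fm0 hG0 (by linarith) (by linarith)
    (by linarith) (by linarith) (by linarith) (by rw [sq]; exact cs3)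

end

section
variable {n : ℕ} {H : Finset (Finset (Fin n))}

lemma odd_arith (h e a b q F2 s s' sg t : ℝ) (g1 : 49999999 / 100000000 ≤ h) (ge : e ≤ 1 / 100000000000000)
    (hab : a + b = 1) (ha : 0.24 ≤ a) (ha2 : a ≤ 0.76)
    (hq : q = 1 / 2 - a / 3)
    (u : sg ≤ a ^ 3 / 3 + 1 / 10000000) (v : t ≤ b ^ 3 / 3 + 1 / 10000000)
    (x1 : h * (a * a) - e ≤ sg + s) (x2 : h * (b * b) - e ≤ t + s')
    (x3 : F2 + b * s + 2 * a * s' - 2 * (a * b) * (a * b) ≤ 2 * e)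
    (x4 : 2 * q * s - q ^ 2 * (a * a) ≤ F2) : False := by
  obtain rfl : b = 1 - a := by linarith
  subst hq
  have a1 : a ^ 2 ≤ 1 := by nlinarith
  have b1 : (1 - a) ^ 2 ≤ 1 := by nlinarith
  have y1 : a ^ 2 * (1 / 2 - a / 3) - 0.000001 ≤ s := by nlinarith
  have y2 : (1 - a) ^ 2 * (1 / 2 - (1 - a) / 3) - 0.000001 ≤ s' := by nlinarith
  have z1 : (2 * (1 / 2 - a / 3) + (1 - a)) * (a ^ 2 * (1 / 2 - a / 3) - 0.000001) ≤
      (2 * (1 / 2 - a / 3) + (1 - a)) * s := mul_le_mul_of_nonneg_left y1 (by linarith)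
  have z2 : 2 * a * ((1 - a) ^ 2 * (1 / 2 - (1 - a) / 3) - 0.000001) ≤ 2 * a * s' :=
    mul_le_mul_of_nonneg_left y2 (by linarith)
  have p : 0.01 ≤ 1 / 3 - 5 / 4 * a + 11 / 6 * a ^ 2 - 8 / 9 * a ^ 3 := by
    nlinarith [mul_nonneg (sub_nonneg.2 ha2) (sq_nonneg (a - 0.6)), sq_nonneg (a - 0.655)]
  have p2 : a * 0.01 ≤ a * (1 / 3 - 5 / 4 * a + 11 / 6 * a ^ 2 - 8 / 9 * a ^ 3) :=
    mul_le_mul_of_nonneg_left p (by linarith)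
  nlinarith only [p2, z1, z2, x3, x4, ge, ha, ha2]

lemma lemOdd {h e : ℝ} (G : Good H h e) (X : Finset (Fin n)) (hc : 0.24 ≤ dn X) (hc2 : dn X ≤ 0.76)
    (k4' : KN H X X X X ≤ e) (k2 : KN H X X Xᶜ Xᶜ ≤ e) (k0 : KN H Xᶜ Xᶜ Xᶜ Xᶜ ≤ e) : False := by
  have g1 := G.h1
  have g2 := G.h2
  have ge := G.he
  have e0 := G.e0
  have hd := dn_compl G.hn X
  have t1 := Tprime G.h3 G.hn X X X X
  have t2 := Tprime G.h3 G.hn Xᶜ Xᶜ Xᶜ Xᶜ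
  have t3 := Tprime G.h3 G.hn X X Xᶜ Xᶜ
  have c1 := S2_sq X X (NN H X)
  have c2 := S2_sq Xᶜ Xᶜ (NN H Xᶜ)
  simp only [sq (NN _ _ _ _)] at c1 c2
  have hsg : 0 ≤ S2 X X (NN H X) := S2_nonneg fun a _ b _ => NN_nonneg _ _ _
  have ht : 0 ≤ S2 Xᶜ Xᶜ (NN H Xᶜ) := S2_nonneg fun a _ b _ => NN_nonneg _ _ _
  have u := subthird_aux _ _ (dn X) e hsg (dn_nonneg X) (dn_le_one X) e0 ge (by linarith) c1
  have v := subthird_aux _ _ (dn Xᶜ) e ht (dn_nonneg _) (dn_le_one _) e0 ge (by linarith) c2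
  have x1 : h * (dn X * dn X) - e ≤ S2 X X (NN H X) + S2 X X (NN H Xᶜ) := by
    have : S2 X X (fun a b => h - dd a b) ≤ S2 X X (fun a b => NN H X a b + NN H Xᶜ a b) :=
      S2_mono fun a _ b _ => by rw [← NN_compl]; exact G.cod a b
    rw [S2_sub, S2_const, S2_add] at this
    have := G.ddS X X
    linarith
  have x2 : h * (dn Xᶜ * dn Xᶜ) - e ≤ S2 Xᶜ Xᶜ (NN H Xᶜ) + S2 Xᶜ Xᶜ (NN H X) := by
    have : S2 Xᶜ Xᶜ (fun a b => h - dd a b) ≤ S2 Xᶜ Xᶜ (fun a b => NN H Xᶜ a b + NN H X a b) :=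
      S2_mono fun a _ b _ => by rw [add_comm, ← NN_compl]; exact G.cod a b
    rw [S2_sub, S2_const, S2_add] at this
    have := G.ddS Xᶜ Xᶜ
    linarith
  have x3 : dn Xᶜ * S2 X X (NN H Xᶜ) + dn X * S2 Xᶜ Xᶜ (NN H X) - dn X * dn Xᶜ * (dn X * dn Xᶜ) ≤
      S2 X Xᶜ (fun a b => NN H X a b * NN H Xᶜ a b) := by
    rw [E_swap X X, E_swap Xᶜ Xᶜ X, E_comm Xᶜ X Xᶜ, ← S2_smul, ← S2_smul, ← S2_add, ← S2_const, ← S2_sub]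
    refine S2_mono fun a _ b _ => ?_
    nlinarith [mul_nonneg (sub_nonneg.2 (NN_le (H := H) X a b)) (sub_nonneg.2 (NN_le (H := H) Xᶜ a b))]
  have x4 : 2 * (1 / 2 - dn X / 3) * S2 X X (NN H Xᶜ) - (1 / 2 - dn X / 3) ^ 2 * (dn X * dn X) ≤
      S2 X X (fun a b => NN H Xᶜ a b * NN H Xᶜ a b) := by
    rw [← S2_const, ← S2_smul, ← S2_sub]
    refine S2_mono fun a _ b _ => ?_
    nlinarith [sq_nonneg (NN H Xᶜ a b - (1 / 2 - dn X / 3))]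
  norm_num at g1 ge u v
  exact odd_arith h e (dn X) (dn Xᶜ) _ (S2 X X (fun a b => NN H Xᶜ a b * NN H Xᶜ a b))
    (S2 X X (NN H Xᶜ)) (S2 Xᶜ Xᶜ (NN H X)) _ _ g1 ge hd hc hc2 rfl u v x1 x2 (by linarith) x4

end

section
variable {n : ℕ} {H : Finset (Finset (Fin n))}

/-- the monochromatic argument -/
lemma mono_arg (hn : 0 < n) (X : Finset (Fin n)) (b : ℝ) (f g : Fin n → Fin n → ℝ)
    (hg : ∀ x y, g x y = NN H X x y) (hfs : ∀ x y, f x y = f y x)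
    (hf0 : ∀ x y, 0 ≤ f x y) (hfb : ∀ x y, f x y ≤ b) :
    S2 X X f * S2 X X g ≤ S2 X X (fun x y => f x y * g x y) +
      4 * (S2 X X (fun x y => f x y * g x y) + S2 X X (fun x y => (dn X - g x y) * (b - f x y))) := by
  have hn' : (0 : ℝ) < n := by exact_mod_cast hn
  have hXn : (X.card : ℝ) ≤ n := by
    have := card_le_univ X
    rw [Fintype.card_fin] at this
    exact_mod_cast this
  have hg0 : ∀ x y, 0 ≤ g x y := fun x y => by rw [hg]; exact NN_nonneg _ _ _
  have hg1 : ∀ x y, g x y ≤ 1 := fun x y => by rw [hg]; exact NN_le_one _ _ _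
  have hgs : ∀ x y, g x y = g y x := fun x y => by rw [hg, hg, NN_comm]
  have hgn : ∀ x y, ∑ z ∈ X, hh H x y z = n * g x y := fun x y => by
    rw [hg]; unfold NN; field_simp
  set A := ∑ x ∈ X, ∑ y ∈ X, f x y * g x y with hA
  set B := ∑ x ∈ X, ∑ y ∈ X, (dn X - g x y) * (b - f x y) with hB
  set D := ∑ x ∈ X, ∑ y ∈ X, ∑ z ∈ X, |f x y - f x z| with hD
  have e1 : ∑ x ∈ X, ∑ y ∈ X, ∑ z ∈ X, hh H x y z * f x y = n * A := by
    rw [hA, mul_sum]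
    refine sum_congr rfl fun x _ => ?_
    rw [mul_sum]
    refine sum_congr rfl fun y _ => ?_
    rw [← sum_mul, hgn]; ring
  have e2 : ∑ x ∈ X, ∑ y ∈ X, ∑ z ∈ X, hh H x y z * f x z = n * A := by
    rw [← e1]
    refine sum_congr rfl fun x _ => ?_
    rw [sum_comm]
    simp only [hh_23]
  have e3 : ∑ x ∈ X, ∑ y ∈ X, ∑ z ∈ X, (1 - hh H x y z) * (b - f x y) = n * B := by
    rw [hB, mul_sum]
    refine sum_congr rfl fun x _ => ?_
    rw [mul_sum]
    refine sum_congr rfl fun y _ => ?_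
    rw [← sum_mul, sum_sub_distrib, hgn]
    unfold dn
    simp
    field_simp
  have e4 : ∑ x ∈ X, ∑ y ∈ X, ∑ z ∈ X, (1 - hh H x y z) * (b - f x z) = n * B := by
    rw [← e3]
    refine sum_congr rfl fun x _ => ?_
    rw [sum_comm]
    simp only [hh_23]
  have hD1 : D ≤ n * A + n * A + n * B + n * B := by
    nth_rw 1 [← e1]; rw [← e2]; nth_rw 1 [← e3]; rw [← e4]
    simp only [hD, ← sum_add_distrib]
    refine sum_le_sum fun x _ => sum_le_sum fun y _ => sum_le_sum fun z _ => ?_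
    have i1 := hf0 x y; have i2 := hf0 x z; have i3 := hfb x y; have i4 := hfb x z
    by_cases hc : ({x, y, z} : Finset (Fin n)) ∈ H
    · have : hh H x y z = 1 := ind_pos hc
      rw [this, abs_le]; constructor <;> linarith
    · have : hh H x y z = 0 := ind_neg hc
      rw [this, abs_le]; constructor <;> linarith
  have hP : (∑ x ∈ X, ∑ y ∈ X, f x y) * (∑ x ∈ X, ∑ y ∈ X, g x y) ≤ (X.card : ℝ) ^ 2 * A + 2 * X.card * D := by
    have q1 : (∑ x ∈ X, ∑ y ∈ X, f x y) * (∑ x ∈ X, ∑ y ∈ X, g x y) =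
        ∑ x ∈ X, ∑ y ∈ X, ∑ x' ∈ X, ∑ y' ∈ X, f x y * g x' y' := by
      rw [sum_mul]
      refine sum_congr rfl fun x _ => ?_
      rw [sum_mul]
      refine sum_congr rfl fun y _ => ?_
      rw [mul_sum]
      refine sum_congr rfl fun y _ => ?_
      rw [mul_sum]
    have q2 : ∑ x ∈ X, ∑ y ∈ X, ∑ x' ∈ X, ∑ y' ∈ X, f x y * g x' y' ≤
        ∑ x ∈ X, ∑ y ∈ X, ∑ x' ∈ X, ∑ y' ∈ X, (f x' y' * g x' y' + |f x y - f x y'| + |f y' x - f y' x'|) := by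
      refine sum_le_sum fun x _ => sum_le_sum fun y _ => sum_le_sum fun x' _ => sum_le_sum fun y' _ => ?_
      have i1 := le_abs_self (f x y - f x y')
      have i2 := le_abs_self (f y' x - f y' x')
      have i3 := hg0 x' y'
      have i4 := hg1 x' y'
      rw [hfs y' x, hfs y' x'] at *
      have i5 := abs_nonneg (f x y - f x y')
      have i6 := abs_nonneg (f x y' - f x' y')
      nlinarith
    rw [q1]
    refine q2.trans (le_of_eq ?_)
    have r1 : ∑ x ∈ X, ∑ y ∈ X, ∑ x' ∈ X, ∑ y' ∈ X, f x' y' * g x' y' = (X.card : ℝ) ^ 2 * A := by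
      simp only [sum_const, nsmul_eq_mul]; rw [hA]; ring
    have r2 : ∑ x ∈ X, ∑ y ∈ X, ∑ x' ∈ X, ∑ y' ∈ X, |f x y - f x y'| = X.card * D := by
      simp only [sum_const, nsmul_eq_mul, ← mul_sum]; rw [hD]
    have r3 : ∑ x ∈ X, ∑ y ∈ X, ∑ x' ∈ X, ∑ y' ∈ X, |f y' x - f y' x'| = X.card * D := by
      simp only [sum_const, nsmul_eq_mul]
      rw [← mul_sum]
      rw [hD]
      congr 1
      calc ∑ x ∈ X, ∑ x' ∈ X, ∑ y' ∈ X, |f y' x - f y' x'|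
          = ∑ x ∈ X, ∑ y' ∈ X, ∑ x' ∈ X, |f y' x - f y' x'| := sum_congr rfl fun x _ => sum_comm
        _ = _ := sum_comm
    simp only [sum_add_distrib, r1, r2, r3]
    ring
  have hA0 : 0 ≤ A := sum_nonneg fun x _ => sum_nonneg fun y _ => mul_nonneg (hf0 _ _) (hg0 _ _)
  have hB0 : 0 ≤ B := sum_nonneg fun x _ => sum_nonneg fun y _ =>
    mul_nonneg (sub_nonneg.2 (by rw [hg]; exact NN_le _ _ _)) (sub_nonneg.2 (hfb _ _))
  have hD0 : 0 ≤ D := sum_nonneg fun x _ => sum_nonneg fun y _ => sum_nonneg fun z _ => abs_nonneg _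
  have fin : (∑ x ∈ X, ∑ y ∈ X, f x y) * (∑ x ∈ X, ∑ y ∈ X, g x y) ≤
      (n : ℝ) ^ 2 * (A + 4 * (A + B)) := by
    have w1 : (X.card : ℝ) ^ 2 * A ≤ (n : ℝ) ^ 2 * A := by gcongr
    have w2 : 2 * X.card * D ≤ 2 * n * (n * A + n * A + n * B + n * B) := by gcongr
    nlinarith
  unfold S2
  rw [← hA, ← hB, div_mul_div_comm, div_le_iff₀ (by positivity)]
  calc _ ≤ _ := fin
    _ = _ := by field_simp

lemma even_arith (h e a b s s' sg T T' FG P2 : ℝ) (g1 : 49999999 / 100000000 ≤ h) (g2 : h ≤ 1 / 2)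
    (ge : e ≤ 1 / 100000000000000) (e0 : 0 ≤ e)
    (hab : a + b = 1) (ha : 0.24 ≤ a) (ha2 : a ≤ 1 / 2)
    (hs : 0 ≤ s) (hs1 : s ≤ a * a * b) (hFG : 0 ≤ FG) 
    (u : s ≤ a ^ 2 * b / 2 + 1 / 10000000)
    (v : s' ≤ b ^ 2 * a / 2 + 1 / 10000000)
    (x1 : FG + 2 * T ≤ a * s + 2 * e) (x2 : s ^ 2 ≤ T * (a * b))
    (x3 : h * (a * b) ≤ s + s') (x4 : h * (a * a) - e ≤ sg + s)
    (x5 : a ≤ h → (h - a) * (h * (a * a) - s) - e ≤ FG)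
    (x6 : 0.4998 ≤ a → P2 ≤ FG + 0.00012 * (a * a) + e)
    (x7 : s * sg ≤ FG + 4 * (FG + P2)) : False := by
  obtain rfl : b = 1 - a := by linarith
  have hab : 0 < a * (1 - a) := by nlinarith
  have hab1 : a * (1 - a) ≤ 1 / 4 := by nlinarith [sq_nonneg (a - 1 / 2)]
  have y1 : a ^ 2 * (1 - a) / 2 - 0.0000002 ≤ s := by nlinarith
  have y2 : FG ≤ 0.000001 := by
    have h1 : FG * (a * (1 - a)) ≤ 0.000001 * (a * (1 - a)) := by
      have h2 : FG * (a * (1 - a)) ≤ (a * s + 2 * e) * (a * (1 - a)) - 2 * s ^ 2 := by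
        have := mul_le_mul_of_nonneg_right x1 hab.le
        linarith
      have h3 : s * (a ^ 2 * (1 - a) - 2 * s) ≤ s * 0.0000004 :=
        mul_le_mul_of_nonneg_left (by linarith) hs
      have h4 : a * a * (1 - a) ≤ a * (1 - a) * 1 := by nlinarith
      nlinarith
    exact le_of_mul_le_mul_right h1 hab
  have a2 : 0.0576 ≤ a * a := by nlinarith
  have y3 : 0.4998 ≤ a := by
    by_contra hcon
    push Not at hcon
    have h1 := x5 (by linarith)
    have h2 : 0.006 ≤ h * (a * a) - s := by nlinarith
    have h3 : 0.00019 * 0.006 ≤ (h - a) * (h * (a * a) - s) := by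
      apply mul_le_mul _ h2 (by norm_num) <;> linarith
    linarith
  have y4 := x6 y3
  have a3 : a * a ≤ 1 / 4 := by nlinarith
  have a4 : 0.2498 ≤ a * a := by nlinarith
  have y5 : 0.062 ≤ s := by nlinarith
  have y6 : 0.06 ≤ sg := by nlinarith
  have y7 : 0.062 * 0.06 ≤ s * sg := by apply mul_le_mul y5 y6 <;> linarith
  linarith

lemma lemEven {h e : ℝ} (G : Good H h e) (X : Finset (Fin n)) (hc : 0.24 ≤ dn X) (hc2 : dn X ≤ 1 / 2)
    (k3 : KN H X X X Xᶜ ≤ e) (k1 : KN H X Xᶜ Xᶜ Xᶜ ≤ e) : False := by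
  have g1 := G.h1
  have g2 := G.h2
  have ge := G.he
  have e0 := G.e0
  have hd := dn_compl G.hn X
  have t1 := Tprime G.h3 G.hn X X Xᶜ X
  have t2 := Tprime G.h3 G.hn Xᶜ Xᶜ X Xᶜ
  rw [KN_34] at t1
  have k1' : KN H Xᶜ Xᶜ X Xᶜ ≤ e := by rw [KN_23, KN_12]; exact k1
  have c1 := S2_sq X Xᶜ (NN H X)
  have c2 := S2_sq Xᶜ X (NN H Xᶜ)
  simp only [sq (NN _ _ _ _)] at c1 c2
  rw [← E_swap X X Xᶜ] at c1
  rw [← E_swap Xᶜ Xᶜ X] at c2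
  have hs : 0 ≤ S2 X X (NN H Xᶜ) := S2_nonneg fun a _ b _ => NN_nonneg _ _ _
  have hs' : 0 ≤ S2 Xᶜ Xᶜ (NN H X) := S2_nonneg fun a _ b _ => NN_nonneg _ _ _
  have hFG : 0 ≤ S2 X X (fun a b => NN H Xᶜ a b * NN H X a b) :=
    S2_nonneg fun a _ b _ => mul_nonneg (NN_nonneg _ _ _) (NN_nonneg _ _ _)
  have hFG' : 0 ≤ S2 Xᶜ Xᶜ (fun a b => NN H X a b * NN H Xᶜ a b) :=
    S2_nonneg fun a _ b _ => mul_nonneg (NN_nonneg _ _ _) (NN_nonneg _ _ _)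
  have u := subhalf_aux _ _ (dn X) (dn Xᶜ) e hs (dn_nonneg X) (dn_le_one X) (dn_nonneg _) (dn_le_one _) e0 ge
    (by linarith) c1
  have v := subhalf_aux _ _ (dn Xᶜ) (dn X) e hs' (dn_nonneg _) (dn_le_one _) (dn_nonneg _) (dn_le_one _) e0 ge
    (by linarith) c2
  have x3 : h * (dn X * dn Xᶜ) ≤ S2 X X (NN H Xᶜ) + S2 Xᶜ Xᶜ (NN H X) := by
    rw [E_swap X X, E_swap Xᶜ Xᶜ X, E_comm Xᶜ X Xᶜ, ← S2_add, ← S2_const]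
    refine S2_mono fun a ha b hb => ?_
    rw [← NN_compl]
    have := G.cod a b
    rwa [dd_disj disjoint_compl_right ha hb, sub_zero] at this
  have x4 : h * (dn X * dn X) - e ≤ S2 X X (NN H X) + S2 X X (NN H Xᶜ) := by
    have : S2 X X (fun a b => h - dd a b) ≤ S2 X X (fun a b => NN H X a b + NN H Xᶜ a b) :=
      S2_mono fun a _ b _ => by rw [← NN_compl]; exact G.cod a b
    rw [S2_sub, S2_const, S2_add] at this
    have := G.ddS X X
    linarith
  have hs1 : S2 X X (NN H Xᶜ) ≤ dn X * dn X * dn Xᶜ := by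
    have : S2 X X (NN H Xᶜ) ≤ S2 X X (fun _ _ => dn Xᶜ) := S2_mono fun a _ b _ => NN_le _ _ _
    rw [S2_const] at this
    linarith
  have x7 := mono_arg (H := H) G.hn X (dn Xᶜ) (NN H Xᶜ) (NN H X) (fun _ _ => rfl) (fun _ _ => NN_comm _ _ _)
    (fun _ _ => NN_nonneg _ _ _) (fun _ _ => NN_le _ _ _)
  norm_num at g1 ge u v
  have x6 : 0.4998 ≤ dn X → S2 X X (fun x y => (dn X - NN H X x y) * (dn Xᶜ - NN H Xᶜ x y)) ≤
      S2 X X (fun a b => NN H Xᶜ a b * NN H X a b) + 0.00012 * (dn X * dn X) + e := by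
    intro hx
    have : S2 X X (fun x y => (dn X - NN H X x y) * (dn Xᶜ - NN H Xᶜ x y)) ≤
      S2 X X (fun a b => NN H Xᶜ a b * NN H X a b + 0.00012 + dd a b) := by
      refine S2_mono fun a _ b _ => ?_
      have c1 := G.cod a b
      rw [NN_compl X] at c1
      have i1 := NN_nonneg (H := H) X a b
      have i2 := NN_nonneg (H := H) Xᶜ a b
      have i3 := dd_nonneg a b
      have hb : dn Xᶜ = 1 - dn X := by linarith
      have j1 : dn X * dn Xᶜ ≤ 1 / 4 := by rw [hb]; nlinarith [sq_nonneg (dn X - 1 / 2)]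
      have j2 : 0.4998 * NN H X a b ≤ dn Xᶜ * NN H X a b := mul_le_mul_of_nonneg_right (by linarith) i1
      have j3 : 0.4998 * NN H Xᶜ a b ≤ dn X * NN H Xᶜ a b := mul_le_mul_of_nonneg_right (by linarith) i2
      nlinarith
    rw [S2_add, S2_add, S2_const] at this
    have := G.ddS X X
    linarith
  exact even_arith h e (dn X) (dn Xᶜ) _ _ _ _ 0 _ _ g1 g2 ge e0 hd hc hc2 hs hs1 hFG u v (by linarith) c1 x3 x4
    (FG_lower G X) x6 x7

end

section
variable {n : ℕ} {H : Finset (Finset (Fin n))}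

lemma miss_card (hn : 0 < n) (P Q R : Finset (Fin n)) :
    (((P ×ˢ Q ×ˢ R).filter fun t => ({t.1, t.2.1, t.2.2} : Finset (Fin n)) ∉ H).card : ℝ) =
      (dn P * dn Q * dn R - S2 P Q (NN H R)) * (n : ℝ) ^ 3 := by
  have hn' : (0 : ℝ) < n := by exact_mod_cast hn
  have h1 : (((P ×ˢ Q ×ˢ R).filter fun t => ({t.1, t.2.1, t.2.2} : Finset (Fin n)) ∉ H).card : ℝ) =
      ∑ a ∈ P, ∑ b ∈ Q, ∑ c ∈ R, (1 - hh H a b c) := by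
    rw [card_filter]
    push_cast
    rw [sum_product]
    refine sum_congr rfl fun a _ => ?_
    rw [sum_product]
    refine sum_congr rfl fun b _ => sum_congr rfl fun c _ => ?_
    unfold hh
    by_cases h : ({a, b, c} : Finset (Fin n)) ∈ H
    · simp [h, ind_pos]
    · simp [h, ind_neg]
  rw [h1]
  unfold S2 NN dn
  simp only [sum_sub_distrib, sum_const, nsmul_eq_mul, ← sum_div]
  field_simp

lemma odd_cases {X A : Finset (Fin n)} {a b c : Fin n} (hab : a ≠ b) (hac : a ≠ c) (hbc : b ≠ c)
    (ha : a ∈ A ↔ a ∈ X) (hb : b ∈ A ↔ b ∈ X) (hc : c ∈ A ↔ c ∈ X)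
    (ho : (({a, b, c} : Finset (Fin n)) ∩ A).card % 2 = 1) :
    (a ∈ X ∧ b ∈ X ∧ c ∈ X) ∨ (a ∈ X ∧ b ∉ X ∧ c ∉ X) ∨ (a ∉ X ∧ b ∈ X ∧ c ∉ X) ∨ (a ∉ X ∧ b ∉ X ∧ c ∈ X) := by
  by_cases h1 : a ∈ X <;> by_cases h2 : b ∈ X <;> by_cases h3 : c ∈ X <;> simp only [h1, h2, h3] at * <;>
    simp_all [insert_inter_of_mem, insert_inter_of_notMem, singleton_inter_of_mem, singleton_inter_of_notMem]

lemma bgraph_sub (X A B : Finset (Fin n)) :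
    BGraph A B \ H ⊆ ((((X ×ˢ X ×ˢ X).filter fun t => ({t.1, t.2.1, t.2.2} : Finset (Fin n)) ∉ H) ∪
      ((X ×ˢ Xᶜ ×ˢ Xᶜ).filter fun t => ({t.1, t.2.1, t.2.2} : Finset (Fin n)) ∉ H)) ∪
      ((A \ X ∪ X \ A) ×ˢ univ ×ˢ univ)).image
        fun t => ({t.1, t.2.1, t.2.2} : Finset (Fin n)) := by
  intro S hS
  rw [mem_sdiff, BGraph, mem_filter, mem_powersetCard] at hS
  obtain ⟨⟨⟨-, hc⟩, ho⟩, hH⟩ := hS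
  by_cases hD : ∃ a ∈ S, a ∈ A \ X ∪ X \ A
  · obtain ⟨a, haS, haD⟩ := hD
    have : (S.erase a).card = 2 := by rw [card_erase_of_mem haS, hc]
    obtain ⟨b, c, -, hbc⟩ := card_eq_two.1 this
    rw [mem_image]
    refine ⟨(a, b, c), ?_, ?_⟩
    · exact mem_union_right _ (by simp only [mem_product]; exact ⟨haD, mem_univ _, mem_univ _⟩)
    · simp only; rw [← hbc, insert_erase haS]
  · push Not at hD
    have hD' : ∀ a ∈ S, (a ∈ A ↔ a ∈ X) := by
      intro a ha
      have := hD a ha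
      simp only [mem_union, mem_sdiff] at this
      tauto
    obtain ⟨a, b, c, hab, hac, hbc, rfl⟩ := card_eq_three.1 hc
    have := odd_cases hab hac hbc (hD' a (by simp)) (hD' b (by simp)) (hD' c (by simp)) ho
    rw [mem_image]
    rcases this with h | h | h | h
    · refine ⟨(a, b, c), ?_, rfl⟩
      simp only [mem_union, mem_filter, mem_product, mem_compl]
      exact .inl (.inl ⟨⟨h.1, h.2⟩, hH⟩)
    · refine ⟨(a, b, c), ?_, rfl⟩
      simp only [mem_union, mem_filter, mem_product, mem_compl]
      exact .inl (.inr ⟨⟨h.1, h.2⟩, hH⟩)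
    · have e : ({b, a, c} : Finset (Fin n)) = {a, b, c} := insert_comm _ _ _
      refine ⟨(b, a, c), ?_, e⟩
      simp only [mem_union, mem_filter, mem_product, mem_compl]
      exact .inl (.inr ⟨⟨h.2.1, h.1, h.2.2⟩, by rw [e]; exact hH⟩)
    · have e : ({c, a, b} : Finset (Fin n)) = {a, b, c} := by
        rw [insert_comm c a, pair_comm c b]
      refine ⟨(c, a, b), ?_, e⟩
      simp only [mem_union, mem_filter, mem_product, mem_compl]
      exact .inl (.inr ⟨⟨h.2.2, h.1, h.2.1⟩, by rw [e]; exact hH⟩)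

lemma rebalance (X : Finset (Fin n)) : ∃ A : Finset (Fin n), A.card = n / 2 ∧
    ((A \ X ∪ X \ A).card : ℝ) ≤ |(X.card : ℝ) - (n / 2 : ℕ)| := by
  rcases le_total X.card (n / 2) with h | h
  · obtain ⟨A, hA, -, hc⟩ := exists_subsuperset_card_eq (subset_univ X) h
      (by rw [card_univ, Fintype.card_fin]; exact Nat.div_le_self _ _)
    refine ⟨A, hc, ?_⟩
    rw [sdiff_eq_empty_iff_subset.2 hA, union_empty, abs_sub_comm, ← hc, ← Nat.cast_sub (card_le_card hA),
      card_sdiff_of_subset hA]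
    exact le_abs_self _
  · obtain ⟨A, hA, hc⟩ := exists_subset_card_eq h
    refine ⟨A, hc, ?_⟩
    rw [sdiff_eq_empty_iff_subset.2 hA, empty_union, ← hc, ← Nat.cast_sub (card_le_card hA),
      card_sdiff_of_subset hA]
    exact le_abs_self _

lemma ext_arith (γ e a b E SX SY : ℝ) (hγ : 0 < γ) (hγ1 : γ ≤ 1 / 10 ^ 8) (he : 10 ^ 6 * e ≤ γ) (e0 : 0 ≤ e)
    (hab : a + b = 1) (ha : 0.24 ≤ a) (hb : 0.24 ≤ b) (hE0 : 0 ≤ E)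
    (x1 : (3 * (1 / 2 - γ) - 1) * E ≤ 5 * e) (x2 : (1 / 2 - γ) * (a * b) ≤ E + SY)
    (x3 : (1 / 2 - γ) * (a * a) - e ≤ E + SX) (x4 : SX ≤ a * a * a) (x5 : SY ≤ a * b * b) :
    (a * a * a - SX) + (a * b * b - SY) ≤ 1.3 * γ ∧ |a - 1 / 2| ≤ 1.1 * γ := by
  norm_num at hγ1 he
  have y1 : E ≤ 11 * e := by
    have : 0.49 * E ≤ (3 * (1 / 2 - γ) - 1) * E := mul_le_mul_of_nonneg_right (by linarith) hE0
    linarith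
  have pab : 0.18 ≤ a * b := by
    obtain rfl : b = 1 - a := by linarith
    nlinarith
  have paa : 0.0576 ≤ a * a := by nlinarith
  have y2 : (1 / 2 - γ) - b ≤ 70 * e := by
    by_contra hcon
    push Not at hcon
    have h1 : 0.18 * (70 * e) ≤ (a * b) * (1 / 2 - γ - b) := by apply mul_le_mul pab hcon.le <;> nlinarith
    have h2 : 0 ≤ 11 * e - a * b * (1 / 2 - γ - b) := by linarith
    have h3 : e = 0 := by linarith
    subst h3
    have : 0 < a * b * (1 / 2 - γ - b) := by apply mul_pos <;> linarith
    linarith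
  have y3 : (1 / 2 - γ) - a ≤ 300 * e := by
    by_contra hcon
    push Not at hcon
    have h1 : 0.0576 * (300 * e) ≤ (a * a) * (1 / 2 - γ - a) := by apply mul_le_mul paa hcon.le <;> nlinarith
    have h2 : 0 ≤ 12 * e - a * a * (1 / 2 - γ - a) := by linarith
    have h3 : e = 0 := by linarith
    subst h3
    have : 0 < a * a * (1 / 2 - γ - a) := by apply mul_pos <;> linarith
    linarith
  refine ⟨?_, by rw [abs_le]; constructor <;> linarith⟩
  obtain rfl : b = 1 - a := by linarith
  have z1 : a * (a - (1 / 2 - γ)) ≤ (a - (1 / 2 - γ)) + 300 * e := by nlinarith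
  have z2 : (1 - a) * ((1 - a) - (1 / 2 - γ)) ≤ ((1 - a) - (1 / 2 - γ)) + 300 * e := by nlinarith
  have z3 : a * (a * (a - (1 / 2 - γ)) + (1 - a) * ((1 - a) - (1 / 2 - γ))) ≤ a * (2 * γ + 600 * e) :=
    mul_le_mul_of_nonneg_left (by linarith) (by linarith)
  have z4 : a * (2 * γ + 600 * e) ≤ 0.6 * (2 * γ + 600 * e) :=
    mul_le_mul_of_nonneg_right (by linarith) (by linarith)
  nlinarith

lemma lemExt {γ e : ℝ} (G : Good H (1 / 2 - γ) e) (hγ : 0 < γ) (he : 10 ^ 6 * e ≤ γ) (X : Finset (Fin n))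
    (hc : 0.24 ≤ dn X) (hc2 : 0.24 ≤ dn Xᶜ)
    (k3 : KN H X X X Xᶜ ≤ e) (k2 : KN H X X Xᶜ Xᶜ ≤ e) : IsExtremal H (3 * γ) := by
  have g1 := G.h1
  have e0 := G.e0
  have hn' : (0 : ℝ) < n := by exact_mod_cast G.hn
  have hd := dn_compl G.hn X
  have t := Tprime G.h3 G.hn X X Xᶜ univ
  have ku := KN_union (H := H) X X Xᶜ X Xᶜ
  rw [union_compl, KN_34 X X X Xᶜ] at ku
  rw [dn_univ G.hn, one_mul] at t
  have hE' : S2 X Xᶜ (NN H X) = S2 X X (NN H Xᶜ) := by rw [E_swap]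
  have hE0 : 0 ≤ S2 X X (NN H Xᶜ) := S2_nonneg fun a _ b _ => NN_nonneg _ _ _
  have a1 : (1 / 2 - γ) * S2 X X (NN H Xᶜ) ≤ S2 X Xᶜ (fun a b => NN H X a b * NN H univ a b) := by
    rw [← hE', ← S2_smul]
    refine S2_mono fun a ha b hb => ?_
    have c1 := G.cod a b
    rw [dd_disj disjoint_compl_right ha hb] at c1
    have c2 := NN_nonneg (H := H) X a b
    nlinarith
  have a2 : (1 / 2 - γ) * S2 X X (NN H Xᶜ) - e ≤ S2 X X (fun a b => NN H Xᶜ a b * NN H univ a b) := by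
    have : S2 X X (fun a b => (1 / 2 - γ) * NN H Xᶜ a b - dd a b) ≤
      S2 X X (fun a b => NN H Xᶜ a b * NN H univ a b) := by
      refine S2_mono fun a _ b _ => ?_
      have c1 := G.cod a b
      have c2 := NN_nonneg (H := H) Xᶜ a b
      have c3 := NN_le_one (H := H) Xᶜ a b
      have c4 := dd_nonneg a b
      nlinarith
    rw [S2_sub, S2_smul] at this
    have := G.ddS X X
    linarith
  have x2 : (1 / 2 - γ) * (dn X * dn Xᶜ) ≤ S2 X X (NN H Xᶜ) + S2 X Xᶜ (NN H Xᶜ) := by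
    rw [← hE', ← S2_add, ← S2_const]
    refine S2_mono fun a ha b hb => ?_
    rw [← NN_compl]
    have := G.cod a b
    rwa [dd_disj disjoint_compl_right ha hb, sub_zero] at this
  have x3 : (1 / 2 - γ) * (dn X * dn X) - e ≤ S2 X X (NN H Xᶜ) + S2 X X (NN H X) := by
    have : S2 X X (fun a b => (1 / 2 - γ) - dd a b) ≤ S2 X X (fun a b => NN H Xᶜ a b + NN H X a b) :=
      S2_mono fun a _ b _ => by rw [add_comm, ← NN_compl]; exact G.cod a b
    rw [S2_sub, S2_const, S2_add] at this
    have := G.ddS X X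
    linarith
  have x4 : S2 X X (NN H X) ≤ dn X * dn X * dn X := by
    have : S2 X X (NN H X) ≤ S2 X X (fun _ _ => dn X) := S2_mono fun a _ b _ => NN_le _ _ _
    rw [S2_const] at this
    linarith
  have x5 : S2 X Xᶜ (NN H Xᶜ) ≤ dn X * dn Xᶜ * dn Xᶜ := by
    have : S2 X Xᶜ (NN H Xᶜ) ≤ S2 X Xᶜ (fun _ _ => dn Xᶜ) := S2_mono fun a _ b _ => NN_le _ _ _
    rw [S2_const] at this
    linarith
  obtain ⟨r1, r2⟩ := ext_arith γ e (dn X) (dn Xᶜ) _ _ _ hγ (by linarith) he e0 hd hc hc2 hE0 (by nlinarith) x2 x3 x4 x5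
  obtain ⟨A, hA, hΔ⟩ := rebalance X
  refine ⟨A, Aᶜ, disjoint_compl_right, union_compl _, hA, by rw [card_compl, hA, Fintype.card_fin], ?_⟩
  have hsub := card_le_card (bgraph_sub (H := H) X A Aᶜ)
  have hle := (hsub.trans card_image_le).trans (card_union_le _ _)
  have hle2 := hle.trans (Nat.add_le_add_right (card_union_le _ _) _)
  have hle3 : ((BGraph A Aᶜ \ H).card : ℝ) ≤
    (dn X * dn X * dn X - S2 X X (NN H X)) * (n : ℝ) ^ 3 + (dn X * dn Xᶜ * dn Xᶜ - S2 X Xᶜ (NN H Xᶜ)) * (n : ℝ) ^ 3 +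
      ((A \ X ∪ X \ A).card : ℝ) * (n * n) := by
    rw [← miss_card G.hn, ← miss_card G.hn]
    have : (((A \ X ∪ X \ A) ×ˢ (univ : Finset (Fin n)) ×ˢ (univ : Finset (Fin n))).card : ℝ) = ((A \ X ∪ X \ A).card : ℝ) * (n * n) := by
      rw [card_product, card_product]; simp
    rw [← this]
    exact_mod_cast hle2
  have hΔ2 : ((A \ X ∪ X \ A).card : ℝ) ≤ (1.1 * γ + e) * n := by
    refine hΔ.trans ?_
    have h1 : (X.card : ℝ) = dn X * n := by unfold dn; field_simp
    have h2 : |((n / 2 : ℕ) : ℝ) - n / 2| ≤ 1 := by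
      have := Nat.div_add_mod n 2
      have h3 := Nat.mod_lt n (show 2 > 0 by norm_num)
      have h4 : (n : ℝ) = 2 * ((n / 2 : ℕ) : ℝ) + ((n % 2 : ℕ) : ℝ) := by exact_mod_cast this.symm
      have h5 : ((n % 2 : ℕ) : ℝ) ≤ 1 := by exact_mod_cast Nat.lt_succ_iff.1 h3
      have h6 : (0 : ℝ) ≤ ((n % 2 : ℕ) : ℝ) := by positivity
      rw [abs_le]; constructor <;> linarith
    have h3 : 1 ≤ e * n := by
      have := G.hne
      rwa [div_le_iff₀ hn'] at this
    rw [abs_le] at r2 h2 ⊢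
    rw [h1]
    constructor <;> nlinarith
  have h7 : ((A \ X ∪ X \ A).card : ℝ) * (n * n) ≤ (1.1 * γ + e) * (n : ℝ) ^ 3 := by
    calc _ ≤ ((1.1 * γ + e) * n) * (n * n) := by gcongr
      _ = _ := by ring
  have n3 : (0 : ℝ) < (n : ℝ) ^ 3 := by positivity
  have h8 := mul_le_mul_of_nonneg_right r1 n3.le
  have h9 : e ≤ 0.1 * γ := by linarith
  have h10 := mul_le_mul_of_nonneg_right h9 n3.le
  have h11 : 0 < γ * (n : ℝ) ^ 3 := by positivity
  linarith

end

section
variable {n : ℕ} {H : Finset (Finset (Fin n))}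

lemma KN_biUnion (P Q R : Finset (Fin n)) (S : Finset (Finset (Fin n))) (ζ : ℝ)
    (h : ∀ A ∈ S, KN H P Q R A ≤ ζ) : KN H P Q R (S.biUnion id) ≤ S.card * ζ := by
  induction S using Finset.induction_on with
  | empty => simp [KN]
  | insert A S hA ih =>
    rw [biUnion_insert, card_insert_of_notMem hA]
    have h1 := KN_union (H := H) P Q R (id A) (S.biUnion id)
    have h2 := ih fun B hB => h B (mem_insert_of_mem hB)
    have h3 := h A (mem_insert_self _ _)
    push_cast
    simp only [id] at h1 h2 h3 ⊢
    linarith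

lemma dn_biUnion (S : Finset (Finset (Fin n))) (hd : ∀ A ∈ S, ∀ B ∈ S, A ≠ B → Disjoint A B) :
    dn (S.biUnion id) = ∑ A ∈ S, dn A := by
  unfold dn
  rw [card_biUnion (t := id) (fun A hA B hB hAB => hd A hA B hB hAB)]
  push_cast
  rw [sum_div]
  rfl

lemma dn_mono {P Q : Finset (Fin n)} (h : P ⊆ Q) : dn P ≤ dn Q := by
  unfold dn
  gcongr

theorem structural {γ ζ : ℝ} (hγ : 0 < γ) (G : Good H (1 / 2 - γ) (5 * ζ)) (hz : 10 ^ 6 * (5 * ζ) ≤ γ)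
    (L : Finset (Finset (Fin n))) (hd : ∀ A ∈ L, ∀ B ∈ L, A ≠ B → Disjoint A B)
    (hL : ∀ A ∈ L, 0.24 ≤ dn A) (h2 : 2 ≤ L.card) (hZ : dn (L.biUnion id)ᶜ ≤ ζ)
    (NB : ∀ P ∈ L, ∀ Q ∈ L, ∀ R ∈ L, ∀ A ∈ L, ∀ B ∈ L, A ≠ B → ζ ≤ KN H P Q R A → ζ ≤ KN H P Q R B → False) :
    IsExtremal H (3 * γ) := by
  have z0 : 0 ≤ ζ := by have := G.e0; linarith
  have hsum : ∑ A ∈ L, dn A ≤ 1 := by rw [← dn_biUnion L hd]; exact dn_le_one _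
  have hcard : (L.card : ℝ) * 0.24 ≤ 1 := by
    calc (L.card : ℝ) * 0.24 = ∑ A ∈ L, (0.24 : ℝ) := by simp
      _ ≤ _ := (sum_le_sum hL).trans hsum
  have hcard4 : L.card ≤ 4 := by
    by_contra hcon
    have : (5 : ℝ) ≤ L.card := by exact_mod_cast (by omega : 5 ≤ L.card)
    linarith
  -- complements
  have hcompl : ∀ D ∈ L, ∀ P Q R, (∀ A ∈ L, A ≠ D → KN H P Q R A ≤ ζ) → KN H P Q R Dᶜ ≤ 5 * ζ := by
    intro D hD P Q R hA
    have hsub : Dᶜ ⊆ (L.erase D).biUnion id ∪ (L.biUnion id)ᶜ := by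
      intro z hz
      by_cases hzL : z ∈ L.biUnion id
      · rw [mem_biUnion] at hzL
        obtain ⟨A, hAL, hzA⟩ := hzL
        refine mem_union_left _ (mem_biUnion.2 ⟨A, mem_erase.2 ⟨?_, hAL⟩, hzA⟩)
        rintro rfl
        exact (mem_compl.1 hz) hzA
      · exact mem_union_right _ (mem_compl.2 hzL)
    have h1 := (KN_mono (H := H) P Q R hsub).trans (KN_union _ _ _ _ _)
    have h2 := KN_biUnion (H := H) P Q R (L.erase D) ζ
      (fun A h => hA A (mem_of_mem_erase h) (ne_of_mem_erase h))
    have h3 := (KN_le_dn (H := H) G.hn P Q R (L.biUnion id)ᶜ).trans hZ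
    have h4 : ((L.erase D).card : ℝ) * ζ ≤ 4 * ζ := by
      apply mul_le_mul_of_nonneg_right _ z0
      exact_mod_cast (card_le_card (erase_subset D L)).trans hcard4
    linarith
  rcases Nat.lt_or_ge 2 L.card with h3 | h3
  · -- at least three classes
    exfalso
    obtain ⟨X, hX, hmin⟩ := exists_min_image L dn (card_pos.1 (by omega))
    have hX3 : dn X ≤ 0.34 := by
      have h1 : (L.card : ℝ) * dn X ≤ 1 := by
        calc (L.card : ℝ) * dn X = ∑ A ∈ L, dn X := by simp
          _ ≤ _ := (sum_le_sum hmin).trans hsum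
      have h2 : (3 : ℝ) ≤ L.card := by exact_mod_cast h3
      have := dn_nonneg X
      nlinarith
    by_cases hcase : ∃ D ∈ L, D ≠ X ∧ ζ ≤ KN H X X X D
    · obtain ⟨D, hD, hDX, hk⟩ := hcase
      refine lemB G X D (hd X hX D hD hDX.symm) (hL X hX) hX3 (hmin D hD) ?_ ?_
      · refine hcompl D hD _ _ _ fun A hA hne => ?_
        by_contra hcon
        exact NB X hX X hX X hX A hA D hD hne (not_le.1 hcon).le hk
      · refine hcompl X hX _ _ _ fun A hA hne => ?_
        by_contra hcon
        refine NB X hX X hX D hD A hA X hX hne (not_le.1 hcon).le ?_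
        rw [KN_34]; exact hk
    · push Not at hcase
      refine lemA G X (hL X hX) hX3 (hcompl X hX _ _ _ fun A hA hne => (hcase A hA hne).le)
  · obtain ⟨X, Y, hXY, rfl⟩ := card_eq_two.1 (le_antisymm h3 h2)
    have hXm : X ∈ ({X, Y} : Finset (Finset (Fin n))) := by simp
    have hYm : Y ∈ ({X, Y} : Finset (Finset (Fin n))) := by simp
    have hdis := hd X hXm Y hYm hXY
    have hX := hL X hXm
    have hY := hL Y hYm
    have hYs : Y ⊆ Xᶜ := fun z hz => mem_compl.2 fun h => disjoint_left.1 hdis h hz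
    have hYc : 0.24 ≤ dn Xᶜ := hY.trans (dn_mono hYs)
    have hr : ∀ P Q R, KN H P Q R Xᶜ ≤ KN H P Q R Y + ζ := by
      intro P Q R
      have hsub : Xᶜ ⊆ Y ∪ (({X, Y} : Finset (Finset (Fin n))).biUnion id)ᶜ := by
        intro z hz
        rw [mem_compl] at hz
        by_cases hzY : z ∈ Y <;> simp [hz, hzY]
      have h1 := (KN_mono (H := H) P Q R hsub).trans (KN_union _ _ _ _ _)
      have h3 := (KN_le_dn (H := H) G.hn P Q R (({X, Y} : Finset (Finset (Fin n))).biUnion id)ᶜ).trans hZ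
      linarith
    have hr3 : ∀ P Q R, KN H P Q Xᶜ R ≤ KN H P Q Y R + ζ := fun P Q R => by
      rw [KN_34 P Q R, KN_34 P Q R]; exact hr _ _ _
    have hr2 : ∀ P Q R, KN H P Xᶜ Q R ≤ KN H P Y Q R + ζ := fun P Q R => by
      rw [KN_23 P Q, KN_23 P Q]; exact hr3 _ _ _
    have hr1 : ∀ P Q R, KN H Xᶜ P Q R ≤ KN H Y P Q R + ζ := fun P Q R => by
      rw [KN_12 P, KN_12 P]; exact hr2 _ _ _
    have m3 : KN H X X X Xᶜ ≤ KN H X X X Y + ζ := hr _ _ _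
    have m2 : KN H X X Xᶜ Xᶜ ≤ KN H X X Y Y + 2 * ζ := by
      have := hr X X Xᶜ; have := hr3 X X Y; linarith
    have m1 : KN H X Xᶜ Xᶜ Xᶜ ≤ KN H X Y Y Y + 3 * ζ := by
      have := hr X Xᶜ Xᶜ; have := hr3 X Xᶜ Y; have := hr2 X Y Y; linarith
    have m0 : KN H Xᶜ Xᶜ Xᶜ Xᶜ ≤ KN H Y Y Y Y + 4 * ζ := by
      have := hr Xᶜ Xᶜ Xᶜ; have := hr3 Xᶜ Xᶜ Y; have := hr2 Xᶜ Y Y; have := hr1 Y Y Y; linarith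
    have n43 : ζ ≤ KN H X X X X → ζ ≤ KN H X X X Y → False := fun a b =>
      NB X hXm X hXm X hXm X hXm Y hYm hXY a b
    have n32 : ζ ≤ KN H X X X Y → ζ ≤ KN H X X Y Y → False := fun a b =>
      NB X hXm X hXm Y hYm X hXm Y hYm hXY (by rw [KN_34]; exact a) b
    have n21 : ζ ≤ KN H X X Y Y → ζ ≤ KN H X Y Y Y → False := fun a b =>
      NB X hXm Y hYm Y hYm X hXm Y hYm hXY (by rw [KN_34, KN_23]; exact a) b
    have n10 : ζ ≤ KN H X Y Y Y → ζ ≤ KN H Y Y Y Y → False := fun a b =>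
      NB Y hYm Y hYm Y hYm X hXm Y hYm hXY (by rw [KN_34, KN_23, KN_12]; exact a) b
    have hdc := dn_compl G.hn X
    rcases lt_or_ge (KN H X X X Y) ζ with a3 | a3
    · rcases lt_or_ge (KN H X X Y Y) ζ with a2 | a2
      · exact lemExt G hγ hz X hX hYc (by linarith) (by linarith)
      · exfalso
        have a1 : KN H X Y Y Y < ζ := by by_contra hcon; exact n21 a2 (not_lt.1 hcon)
        rcases le_total (dn X) (1 / 2) with hh | hh
        · exact lemEven G X hX hh (by linarith) (by linarith)
        · refine lemEven G Xᶜ hYc (by linarith) ?_ ?_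
          · rw [compl_compl, KN_34, KN_23, KN_12]; linarith
          · rw [compl_compl, KN_12, KN_23, KN_34]; linarith
    · have a4 : KN H X X X X < ζ := by by_contra hcon; exact n43 (not_lt.1 hcon) a3
      have a2 : KN H X X Y Y < ζ := by by_contra hcon; exact n32 a3 (not_lt.1 hcon)
      rcases lt_or_ge (KN H X Y Y Y) ζ with a1 | a1
      · refine lemExt G hγ hz Xᶜ hYc (by rw [compl_compl]; exact hX) ?_ ?_
        · rw [compl_compl, KN_34, KN_23, KN_12]; linarith
        · rw [compl_compl, KN_23, KN_12, KN_34, KN_23]; linarith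
      · exfalso
        have a0 : KN H Y Y Y Y < ζ := by by_contra hcon; exact n10 a1 (not_lt.1 hcon)
        exact lemOdd G X hX (by linarith) (by linarith) (by linarith) (by linarith)

end

section
variable {n : ℕ} {H : Finset (Finset (Fin n))}

/-- triples as a product -/
def eqv3 (n : ℕ) : (Fin 3 → Fin n) ≃ Fin n × Fin n × Fin n where
  toFun s := (s 0, s 1, s 2)
  invFun p := ![p.1, p.2.1, p.2.2]
  left_inv s := by ext i; fin_cases i <;> rfl
  right_inv p := rfl

/-- quadruples as a product -/
def eqv4 (n : ℕ) : (Fin 4 → Fin n) ≃ Fin n × Fin n × Fin n × Fin n where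
  toFun s := (s 0, s 1, s 2, s 3)
  invFun p := ![p.1, p.2.1, p.2.2.1, p.2.2.2]
  left_inv s := by ext i; fin_cases i <;> rfl
  right_inv p := rfl

lemma sum3 (f : Fin n → Fin n → Fin n → ℝ) :
    ∑ s : Fin 3 → Fin n, f (s 0) (s 1) (s 2) = ∑ a, ∑ b, ∑ c, f a b c := by
  rw [Fintype.sum_equiv (eqv3 n) (fun s => f (s 0) (s 1) (s 2)) (fun p => f p.1 p.2.1 p.2.2) (fun _ => rfl)]
  simp only [Fintype.sum_prod_type]

lemma sum4 (f : Fin n → Fin n → Fin n → Fin n → ℝ) :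
    ∑ s : Fin 4 → Fin n, f (s 0) (s 1) (s 2) (s 3) = ∑ a, ∑ b, ∑ c, ∑ d, f a b c d := by
  rw [Fintype.sum_equiv (eqv4 n) (fun s => f (s 0) (s 1) (s 2) (s 3))
    (fun p => f p.1 p.2.1 p.2.2.1 p.2.2.2) (fun _ => rfl)]
  simp only [Fintype.sum_prod_type]

lemma k4_rot (a b c x : Fin n) : k4 H x a b c = k4 H a b c x := by
  rw [k4_12, k4_23, k4_34]

/-- number of triples in `P × Q × R` spanning with `x` -/
noncomputable def ph (H : Finset (Finset (Fin n))) (P Q R : Finset (Fin n)) (x : Fin n) : ℝ :=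
  ∑ a ∈ P, ∑ b ∈ Q, ∑ c ∈ R, k4 H a b c x

lemma ph_nonneg (P Q R : Finset (Fin n)) (x : Fin n) : 0 ≤ ph H P Q R x :=
  sum_nonneg fun _ _ => sum_nonneg fun _ _ => sum_nonneg fun _ _ => k4_nonneg _ _ _ _

lemma ph_le (P Q R : Finset (Fin n)) (x : Fin n) : ph H P Q R x ≤ cnt (fun s : Fin 3 → Fin n =>
    FF H x s ∧ (s 0 ∈ P ∧ s 1 ∈ Q ∧ s 2 ∈ R)) := by
  unfold cnt FF
  rw [sum3 (fun a b c => ind (SpansK4m H {x, a, b, c} ∧ (a ∈ P ∧ b ∈ Q ∧ c ∈ R)))]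
  unfold ph
  have h : ∀ a ∈ P, ∀ b ∈ Q, ∀ c ∈ R, k4 H a b c x =
      ind (SpansK4m H {x, a, b, c} ∧ (a ∈ P ∧ b ∈ Q ∧ c ∈ R)) := by
    intro a ha b hb c hc
    rw [← k4_rot]; unfold k4
    congr 1
    simp [ha, hb, hc]
  calc _ = ∑ a ∈ P, ∑ b ∈ Q, ∑ c ∈ R, ind (SpansK4m H {x, a, b, c} ∧ (a ∈ P ∧ b ∈ Q ∧ c ∈ R)) :=
        sum_congr rfl fun a ha => sum_congr rfl fun b hb => sum_congr rfl fun c hc => h a ha b hb c hc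
    _ ≤ _ := by
        refine (sum_le_univ_sum_of_nonneg fun a => sum_nonneg fun _ _ => sum_nonneg fun _ _ =>
          ind_nonneg _).trans (sum_le_sum fun a _ => ?_)
        refine (sum_le_univ_sum_of_nonneg fun a => sum_nonneg fun _ _ =>
          ind_nonneg _).trans (sum_le_sum fun b _ => ?_)
        exact sum_le_univ_sum_of_nonneg fun a => ind_nonneg _

lemma cnt_FF2 (x y : Fin n) : cnt (fun s : Fin 3 → Fin n => FF H x s ∧ FF H y s) =
    ∑ a, ∑ b, ∑ c, k4 H a b c x * k4 H a b c y := by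
  unfold cnt FF
  rw [sum3 (fun a b c => ind (SpansK4m H {x, a, b, c} ∧ SpansK4m H {y, a, b, c}))]
  refine sum_congr rfl fun a _ => sum_congr rfl fun b _ => sum_congr rfl fun c _ => ?_
  rw [ind_and, ← k4_rot a b c x, ← k4_rot a b c y]; rfl

lemma cnt_KK : cnt (fun s : Fin 4 → Fin n => KK H s) = ∑ x, ph H univ univ univ x := by
  have : ∀ s : Fin 4 → Fin n, univ.image s = {s 0, s 1, s 2, s 3} := by
    intro s; ext z; simp [Fin.exists_fin_succ, eq_comm]
  unfold cnt KK ph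
  simp only [this]
  rw [sum4 (fun a b c d => ind (SpansK4m H {a, b, c, d}))]
  refine sum_congr rfl fun x _ => sum_congr rfl fun a _ => sum_congr rfl fun b _ => sum_congr rfl fun c _ => ?_
  rw [← k4_rot]; rfl

/-- abstract closeness system -/
structure Sys (H : Finset (Finset (Fin n))) (α : ℝ) (Cl : ℕ → Fin n → Fin n → Prop) : Prop where
  symm : ∀ t x y, Cl t x y → Cl t y x
  p0 : ∀ x y, α * (n : ℝ) ^ 3 ≤ ∑ a, ∑ b, ∑ c, k4 H a b c x * k4 H a b c y → Cl 0 x y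
  mono1 : ∀ t < 30, ∀ x y, Cl t x y → Cl (t + 1) x y
  p2 : ∀ t < 30, ∀ x y, α * n ≤ cnt (fun z => Cl t x z ∧ Cl t z y) → Cl (t + 1) x y
  p3 : ∀ t < 30, ∀ x y, ∀ P Q R : Finset (Fin n), (∀ p ∈ P, ∀ p' ∈ P, Cl t p p') →
    (∀ p ∈ Q, ∀ p' ∈ Q, Cl t p p') → (∀ p ∈ R, ∀ p' ∈ R, Cl t p p') →
    α * (n : ℝ) ^ 6 ≤ ph H P Q R x * ph H P Q R y → Cl (t + 1) x y

/-- connector sizes -/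
def kk : ℕ → ℕ
  | 0 => 0
  | t + 1 => 3 * kk t + 3

/-- closeness constants -/
noncomputable def ee (α κ : ℝ) : ℕ → ℝ
  | 0 => α / 2
  | t + 1 => α * ee α κ t ^ 3 * κ ^ (2 * kk t + 3) / 8

lemma ee_pos {α κ : ℝ} (hα : 0 < α) (hκ : 0 < κ) (t : ℕ) : 0 < ee α κ t := by
  induction t with
  | zero => unfold ee; positivity
  | succ t ih => unfold ee; positivity

lemma ee_le {α κ : ℝ} (hα : 0 < α) (hα1 : α ≤ 1) (hκ : 0 < κ) (hκ1 : κ ≤ 1) (t : ℕ) : ee α κ t ≤ 1 := by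
  induction t with
  | zero => unfold ee; linarith
  | succ t ih =>
    have h0 := ee_pos hα hκ t
    have h1 : ee α κ t ^ 3 ≤ 1 := pow_le_one₀ h0.le ih
    have h2 : κ ^ (2 * kk t + 3) ≤ 1 := pow_le_one₀ hκ.le hκ1
    have h3 : α * ee α κ t ^ 3 ≤ 1 := mul_le_one₀ hα1 (by positivity) h1
    have h4 : α * ee α κ t ^ 3 * κ ^ (2 * kk t + 3) ≤ 1 := mul_le_one₀ h3 (by positivity) h2
    unfold ee; linarith

lemma large_n {α κ : ℝ} (hα : 0 < α) (hκ : 0 < κ) : ∃ n₀ : ℕ, ∀ n : ℕ, n₀ ≤ n → ∀ t ≤ 30,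
    (((4 * kk t + 3 : ℕ) : ℝ) ^ 2 + 2 * (4 * kk t + 3 : ℕ)) ≤ ee α κ t * n := by
  refine ⟨⌈∑ t ∈ range 31, (((4 * kk t + 3 : ℕ) : ℝ) ^ 2 + 2 * (4 * kk t + 3 : ℕ)) / ee α κ t⌉₊, fun n hn t ht => ?_⟩
  have h1 := Nat.ceil_le.1 hn
  have h2 : (((4 * kk t + 3 : ℕ) : ℝ) ^ 2 + 2 * (4 * kk t + 3 : ℕ)) / ee α κ t ≤ n := by
    refine le_trans ?_ h1
    refine single_le_sum (f := fun t => (((4 * kk t + 3 : ℕ) : ℝ) ^ 2 + 2 * (4 * kk t + 3 : ℕ)) / ee α κ t)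
      (fun i _ => ?_) (mem_range.2 (by omega))
    have := ee_pos hα hκ i
    positivity
  rw [div_le_iff₀ (ee_pos hα hκ t)] at h2
  linarith

theorem sys_mk {α κ : ℝ} (hα : 0 < α) (hα1 : α ≤ 1) (hκ : 0 < κ) (hκ1 : κ ≤ 1)
    (hn : ∀ t ≤ 30, (((4 * kk t + 3 : ℕ) : ℝ) ^ 2 + 2 * (4 * kk t + 3 : ℕ)) ≤ ee α κ t * n)
    (hK : κ * (n : ℝ) ^ 4 ≤ cnt (fun s : Fin 4 → Fin n => KK H s)) :
    Sys H α (fun t => CloseT H (4 * kk t + 3) (ee α κ t)) := by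
  have pw : ∀ t, ∀ r ≤ 2 * kk t + 3, κ ^ (2 * kk t + 3) ≤ κ ^ r := fun t r hr =>
    pow_le_pow_of_le_one hκ.le hκ1 hr
  have e3 : ∀ t, ee α κ t ^ 3 ≤ ee α κ t ^ 2 := fun t =>
    pow_le_pow_of_le_one (ee_pos hα hκ t).le (ee_le hα hα1 hκ hκ1 t) (by norm_num)
  have e1 : ∀ t, ee α κ t ^ 3 ≤ ee α κ t := fun t => by
    have := pow_le_pow_of_le_one (ee_pos hα hκ t).le (ee_le hα hα1 hκ hκ1 t) (show 1 ≤ 3 by norm_num)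
    rwa [pow_one] at this
  have es : ∀ t, ee α κ (t + 1) = α * ee α κ t ^ 3 * κ ^ (2 * kk t + 3) / 8 := fun t => rfl
  have ks : ∀ t, kk (t + 1) = 3 * kk t + 3 := fun t => rfl
  refine ⟨fun t x y => CloseT_symm, ?_, ?_, ?_, ?_⟩
  · intro x y h
    refine close_zero x y (ee α κ 0) (ee_pos hα hκ 0) ?_ ?_
    · have := hn 0 (by norm_num)
      norm_num [kk] at this ⊢
      linarith
    · rw [cnt_FF2]
      have : 2 * ee α κ 0 = α := by unfold ee; ring
      rwa [this]
  · intro t ht x y h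
    have p := ee_pos hα hκ t
    refine close_pad x y κ (ee α κ t) _ hκ.le (ee_pos hα hκ _) (4 * kk t + 3) (2 * kk t + 3) _
      (by rw [ks]; ring) ?_ (hn (t + 1) (by omega)) hK h
    rw [es]
    have h1 : α * ee α κ t ^ 3 ≤ 1 * ee α κ t := mul_le_mul hα1 (e1 t) (by positivity) (by norm_num)
    have h2 := mul_le_mul_of_nonneg_right h1 (show 0 ≤ κ ^ (2 * kk t + 3) by positivity)
    have : 0 < α * ee α κ t ^ 3 * κ ^ (2 * kk t + 3) := by positivity
    linarith
  · intro t ht x y h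
    have p := ee_pos hα hκ t
    have hnt := hn (t + 1) (by omega)
    have b1 : ee α κ (t + 1) ≤ α * ee α κ t ^ 2 / 2 := by
      rw [es]
      have h1 : α * ee α κ t ^ 3 ≤ α * ee α κ t ^ 2 := mul_le_mul_of_nonneg_left (e3 t) hα.le
      have h2 : κ ^ (2 * kk t + 3) ≤ 1 := pow_le_one₀ hκ.le hκ1
      have h3 : α * ee α κ t ^ 3 * κ ^ (2 * kk t + 3) ≤ α * ee α κ t ^ 2 * 1 :=
        mul_le_mul h1 h2 (by positivity) (by positivity)
      have : 0 < α * ee α κ t ^ 2 := by positivity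
      linarith
    have c := close_trans (H := H) x y α (ee α κ t) (α * ee α κ t ^ 2 / 2) p.le (by positivity) (4 * kk t + 3)
      (by linarith) (by
        refine le_trans ?_ (hnt.trans (mul_le_mul_of_nonneg_right b1 (by positivity)))
        have : ((2 * (4 * kk t + 3) + 1 : ℕ) : ℝ) ≤ ((4 * kk (t + 1) + 3 : ℕ) : ℝ) := by
          rw [ks]; exact_mod_cast (by omega)
        gcongr) h
    refine close_pad x y κ _ _ hκ.le (ee_pos hα hκ _) _ (kk t + 2) _ (by rw [ks]; ring) ?_ hnt hK c
    rw [es]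
    have h1 : α * ee α κ t ^ 3 ≤ α * ee α κ t ^ 2 := mul_le_mul_of_nonneg_left (e3 t) hα.le
    have h3 : α * ee α κ t ^ 3 * κ ^ (2 * kk t + 3) ≤ α * ee α κ t ^ 2 * κ ^ (kk t + 2) :=
      mul_le_mul h1 (pw t _ (by omega)) (by positivity) (by positivity)
    have : 0 < α * ee α κ t ^ 2 * κ ^ (kk t + 2) := by positivity
    linarith
  · intro t ht x y P Q R hP hQ hR h
    have p := ee_pos hα hκ t
    have hnt := hn (t + 1) (by omega)
    have hm : 4 * kk (t + 1) + 3 = 3 * (4 * kk t + 3) + 6 := by rw [ks]; ring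
    rw [hm] at hnt ⊢
    refine close_bridge x y α (ee α κ t) _ p.le (ee_pos hα hκ _) (4 * kk t + 3) ?_ hnt ?_
    · rw [es]
      have h2 : κ ^ (2 * kk t + 3) ≤ 1 := pow_le_one₀ hκ.le hκ1
      have h3 : α * ee α κ t ^ 3 * κ ^ (2 * kk t + 3) ≤ α * ee α κ t ^ 3 * 1 :=
        mul_le_mul_of_nonneg_left h2 (by positivity)
      have : 0 < α * ee α κ t ^ 3 := by positivity
      linarith
    · refine h.trans ?_
      have q := cnt_prod (A := Fin 3 → Fin n) (B := Fin 3 → Fin n)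
        (fun s => FF H x s ∧ (s 0 ∈ P ∧ s 1 ∈ Q ∧ s 2 ∈ R))
        (fun _ s => FF H y s ∧ (s 0 ∈ P ∧ s 1 ∈ Q ∧ s 2 ∈ R)) _ _ (ph_nonneg P Q R y) (ph_le P Q R x)
        (fun _ _ => ph_le P Q R y)
      refine q.trans ?_
      rw [← cnt_equiv (Equiv.sumArrowEquivProdArrow (Fin 3) (Fin 3) (Fin n))]
      refine cnt_mono fun ω hω => ?_
      obtain ⟨⟨f1, a0, a1, a2⟩, f2, b0, b1, b2⟩ := hω
      refine ⟨⟨f1, f2⟩, fun i => ?_⟩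
      fin_cases i
      · exact hP _ a0 _ b0
      · exact hQ _ a1 _ b1
      · exact hR _ a2 _ b2

end

section
variable {n : ℕ} {H : Finset (Finset (Fin n))}

lemma swap3 {I : Type*} (S : Finset I) (P Q R : Finset (Fin n)) (f : I → Fin n → Fin n → Fin n → ℝ) :
    ∑ x ∈ S, ∑ a ∈ P, ∑ b ∈ Q, ∑ c ∈ R, f x a b c = ∑ a ∈ P, ∑ b ∈ Q, ∑ c ∈ R, ∑ x ∈ S, f x a b c := by
  rw [sum_comm]
  refine sum_congr rfl fun a _ => ?_
  rw [sum_comm]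
  refine sum_congr rfl fun b _ => ?_
  rw [sum_comm]

lemma k4_sq (a b c d : Fin n) : k4 H a b c d * k4 H a b c d = k4 H a b c d := by
  unfold k4; rw [← ind_and, and_self]

lemma Good.nbig {h e : ℝ} (G : Good H h e) : (10 : ℝ) ^ 14 ≤ n := by
  have h1 := G.hne.trans G.he
  have hn' : (0 : ℝ) < n := by exact_mod_cast G.hn
  rw [div_le_div_iff₀ hn' (by norm_num)] at h1
  linarith

lemma Good.sumdeg {h e : ℝ} (G : Good H h e) (a b : Fin n) : (h - dd a b) * n ≤ ∑ z, hh H a b z := by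
  have hn' : (0 : ℝ) < n := by exact_mod_cast G.hn
  have := G.cod a b
  unfold NN at this
  rwa [le_div_iff₀ hn'] at this

lemma edge_k4 {h e : ℝ} (G : Good H h e) (a b c : Fin n) :
    hh H a b c * (0.2499 * n) ≤ ∑ z, hh H a b c * k4 H a b c z := by
  by_cases hE : ({a, b, c} : Finset (Fin n)) ∈ H
  · have hn' : (0 : ℝ) < n := by exact_mod_cast G.hn
    obtain ⟨ab, ac, bc⟩ := edge_ne G.h3 hE
    have e0 : hh H a b c = 1 := ind_pos hE
    have e1 : hh H b c a = 1 := by rw [hh_23, hh_12, e0]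
    have e2 : hh H a c b = 1 := by rw [hh_23, e0]
    have h1 := G.sumdeg a b
    have h2 := G.sumdeg b c
    have h3 := G.sumdeg a c
    rw [show dd a b = 0 from ind_neg ab] at h1
    rw [show dd b c = 0 from ind_neg bc] at h2
    rw [show dd a c = 0 from ind_neg ac] at h3
    have h4 : ∑ z, (hh H a b z + hh H b c z + hh H a c z) ≤ ∑ z, (1 + 2 * k4 H a b c z) := by
      refine sum_le_sum fun z _ => ?_
      have := Tpoint G.h3 a b c z
      rw [e0, e1, e2] at this
      linarith
    simp only [sum_add_distrib, ← mul_sum] at h4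
    simp only [sum_const, card_univ, Fintype.card_fin, nsmul_eq_mul, mul_one] at h4
    rw [e0]
    simp only [one_mul]
    have h5 : (1 / 2 - 1 / 10 ^ 8) * (n : ℝ) ≤ h * n := mul_le_mul_of_nonneg_right G.h1 hn'.le
    norm_num at h5 h1 h2 h3 ⊢
    linarith
  · have e0 : hh H a b c = 0 := ind_neg hE
    simp [e0]

lemma ph_big {h e : ℝ} (G : Good H h e) (x : Fin n) : 0.11 * (n : ℝ) ^ 3 ≤ ph H univ univ univ x := by
  have hn' : (0 : ℝ) < n := by exact_mod_cast G.hn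
  have hb := G.nbig
  have h1 : ∑ a, ∑ b, hh H x a b * (0.2499 * n) ≤ ph H univ univ univ x := by
    unfold ph
    refine sum_le_sum fun a _ => sum_le_sum fun b _ => (edge_k4 G x a b).trans (sum_le_sum fun c _ => ?_)
    rw [k4_rot]
    have := k4_nonneg (H := H) a b c x
    have := hh_le_one (H := H) x a b
    nlinarith
  have h2 : ∑ a : Fin n, (h - dd x a) * n ≤ ∑ a, ∑ b, hh H x a b := sum_le_sum fun a _ => G.sumdeg x a
  have h3 : ∑ a : Fin n, (h - dd x a) * (n : ℝ) = (h * n - 1) * n := by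
    rw [← sum_mul, sum_sub_distrib]
    have : ∑ a, dd x a = 1 := by
      unfold dd
      rw [sum_eq_single x (fun b _ hb => ind_neg (Ne.symm hb)) (by simp)]
      exact ind_pos rfl
    rw [this, sum_const, card_univ, Fintype.card_fin, nsmul_eq_mul, mul_comm (n : ℝ) h]
  simp only [← sum_mul] at h1
  rw [h3] at h2
  have h4 : (1 / 2 - 1 / 10 ^ 8) * (n : ℝ) ≤ h * n := mul_le_mul_of_nonneg_right G.h1 hn'.le
  have h5 : 0.45 * (n : ℝ) ≤ h * n - 1 := by
    have hb' : (100 : ℝ) ≤ n := le_trans (by norm_num) hb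
    norm_num at h4 ⊢; linarith
  have h6 : 0.45 * (n : ℝ) * n ≤ ∑ a, ∑ b, hh H x a b := (mul_le_mul_of_nonneg_right h5 hn'.le).trans h2
  have h7 := mul_le_mul_of_nonneg_right h6 (show 0 ≤ 0.2499 * (n : ℝ) by positivity)
  have : 0 < (n : ℝ) ^ 3 := by positivity
  nlinarith

lemma KK_big {h e : ℝ} (G : Good H h e) : 0.1 * (n : ℝ) ^ 4 ≤ cnt (fun s : Fin 4 → Fin n => KK H s) := by
  rw [cnt_KK]
  calc 0.1 * (n : ℝ) ^ 4 ≤ n * (0.11 * (n : ℝ) ^ 3) := by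
        have : 0 ≤ (n : ℝ) ^ 4 := by positivity
        nlinarith
    _ = ∑ x : Fin n, (0.11 * (n : ℝ) ^ 3) := by simp
    _ ≤ _ := sum_le_sum fun x _ => ph_big G x

/-- the overlap of two links -/
noncomputable def ov (H : Finset (Finset (Fin n))) (x y : Fin n) : ℝ :=
  ∑ a, ∑ b, ∑ c, k4 H a b c x * k4 H a b c y

lemma ov_self (x : Fin n) : ov H x x = ph H univ univ univ x := by
  unfold ov ph; simp only [k4_sq]

lemma ov_le (x y : Fin n) : ov H x y ≤ (n : ℝ) ^ 3 := by
  calc ov H x y ≤ ∑ a : Fin n, ∑ b : Fin n, ∑ c : Fin n, (1 : ℝ) := by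
        refine sum_le_sum fun a _ => sum_le_sum fun b _ => sum_le_sum fun c _ => ?_
        exact mul_le_one₀ (k4_le_one _ _ _ _) (k4_nonneg _ _ _ _) (k4_le_one _ _ _ _)
    _ = _ := by simp; ring

lemma pair11 {h e α : ℝ} (G : Good H h e) (hα : α ≤ 0.001) (S : Finset (Fin n)) (hS : S.card = 11) :
    ∃ x ∈ S, ∃ y ∈ S, x ≠ y ∧ α * (n : ℝ) ^ 3 ≤ ov H x y := by
  by_contra hc
  push Not at hc
  have hn' : (0 : ℝ) < n := by exact_mod_cast G.hn
  have hn3 : 0 < (n : ℝ) ^ 3 := by positivity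
  -- sum of all overlaps
  have h1 : ∑ x ∈ S, ∑ y ∈ S, ov H x y = ∑ a, ∑ b, ∑ c, (∑ x ∈ S, k4 H a b c x) ^ 2 := by
    have : ∀ a b c, (∑ x ∈ S, k4 H a b c x) ^ 2 = ∑ x ∈ S, ∑ y ∈ S, k4 H a b c x * k4 H a b c y := by
      intro a b c; rw [sq, sum_mul_sum]
    simp only [this]
    unfold ov
    refine Eq.trans ?_ (swap3 S univ univ univ _)
    exact sum_congr rfl fun x _ => swap3 S univ univ univ _
  have h2 : ∑ x ∈ S, ov H x x = ∑ a, ∑ b, ∑ c, (∑ x ∈ S, k4 H a b c x) := by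
    simp only [ov_self]
    exact swap3 S univ univ univ _
  have h3 : 2 * ∑ x ∈ S, ov H x x - (n : ℝ) ^ 3 ≤ ∑ x ∈ S, ∑ y ∈ S, ov H x y := by
    rw [h1, h2]
    have : (n : ℝ) ^ 3 = ∑ a : Fin n, ∑ b : Fin n, ∑ c : Fin n, (1 : ℝ) := by simp; ring
    rw [this]
    simp only [mul_sum, ← sum_sub_distrib]
    refine sum_le_sum fun a _ => sum_le_sum fun b _ => sum_le_sum fun c _ => ?_
    rw [← mul_sum]
    nlinarith [sq_nonneg (∑ x ∈ S, k4 H a b c x - 1)]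
  have h4 : ∑ x ∈ S, ∑ y ∈ S, ov H x y ≤ ∑ x ∈ S, ov H x x + 121 * (0.001 * (n : ℝ) ^ 3) := by
    have : ∀ x ∈ S, ∑ y ∈ S, ov H x y ≤ ov H x x + 11 * (0.001 * (n : ℝ) ^ 3) := by
      intro x hx
      rw [← add_sum_erase _ _ hx]
      have : ∑ y ∈ S.erase x, ov H x y ≤ ∑ y ∈ S.erase x, (0.001 * (n : ℝ) ^ 3) := by
        refine sum_le_sum fun y hy => ?_
        have := hc x hx y (mem_of_mem_erase hy) (ne_of_mem_erase hy).symm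
        have := mul_le_mul_of_nonneg_right hα hn3.le
        linarith
      rw [sum_const, card_erase_of_mem hx, hS, nsmul_eq_mul] at this
      norm_num at this ⊢
      linarith
    refine (sum_le_sum this).trans (le_of_eq ?_)
    rw [sum_add_distrib, sum_const, hS, nsmul_eq_mul]
    norm_num; ring
  have h5 : 11 * (0.11 * (n : ℝ) ^ 3) ≤ ∑ x ∈ S, ov H x x := by
    have : ∑ x ∈ S, (0.11 * (n : ℝ) ^ 3) ≤ ∑ x ∈ S, ov H x x := by
      refine sum_le_sum fun x _ => ?_
      rw [ov_self]; exact ph_big G x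
    rw [sum_const, hS, nsmul_eq_mul] at this
    exact_mod_cast this
  linarith

lemma Sys.mono {α : ℝ} {Cl : ℕ → Fin n → Fin n → Prop} (S : Sys H α Cl) {s t : ℕ} (hst : s ≤ t) (ht : t ≤ 30)
    {x y : Fin n} (h : Cl s x y) : Cl t x y := by
  induction t, hst using Nat.le_induction with
  | base => exact h
  | succ t _ ih => exact S.mono1 t (by omega) x y (ih (by omega))

lemma exists_level {Cl : ℕ → Fin n → Fin n → Prop} (hn : 0 < n)
    (h11 : ∀ S : Finset (Fin n), S.card = 11 → ∃ x ∈ S, ∃ y ∈ S, x ≠ y ∧ Cl 0 x y) :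
    ∃ s ≤ 27, ∃ W : Finset (Fin n), W.card ≤ 10 ∧ (∀ v ∈ W, ∀ w ∈ W, v ≠ w → ¬ Cl (s + 3) v w) ∧
      ∀ S : Finset (Fin n), S.card = W.card + 1 → ∃ x ∈ S, ∃ y ∈ S, x ≠ y ∧ Cl s x y := by
  classical
  let P : ℕ → Prop := fun d => ∃ W : Finset (Fin n), W.card = d + 1 ∧
    ∀ v ∈ W, ∀ w ∈ W, v ≠ w → ¬ Cl (3 * (10 - d)) v w
  have h0 : P 0 := ⟨{⟨0, hn⟩}, by simp, by
    intro v hv w hw hvw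
    rw [mem_singleton] at hv hw
    exact absurd (hv.trans hw.symm) hvw⟩
  have h10 : ¬ P 10 := by
    rintro ⟨W, hW, h⟩
    obtain ⟨x, hx, y, hy, hxy, hc⟩ := h11 W hW
    exact h x hx y hy hxy hc
  have hP := Nat.findGreatest_spec (P := P) (Nat.zero_le 10) h0
  set d := Nat.findGreatest P 10 with hd
  have hd10 : d ≤ 10 := Nat.findGreatest_le 10
  have hd9 : d ≤ 9 := by
    rcases Nat.lt_or_ge d 10 with h | h
    · omega
    · have : d = 10 := by omega
      rw [this] at hP; exact absurd hP h10
  have hnext : ¬ P (d + 1) := Nat.findGreatest_is_greatest (n := 10) (by omega) (by omega)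
  obtain ⟨W, hW, hWc⟩ := hP
  refine ⟨3 * (9 - d), by omega, W, by omega, ?_, ?_⟩
  · rwa [show 3 * (9 - d) + 3 = 3 * (10 - d) by omega]
  · intro S hS
    by_contra hc
    push Not at hc
    refine hnext ⟨S, by omega, ?_⟩
    rw [show 10 - (d + 1) = 9 - d by omega]
    exact hc

end

section
variable {n : ℕ} {H : Finset (Finset (Fin n))}

set_option maxHeartbeats 1000000 in
lemma partition1 {α : ℝ} {Cl : ℕ → Fin n → Fin n → Prop} (hn : 0 < n) (hα : 0 < α) (S : Sys H α Cl)
    (hrefl : ∀ x, Cl 0 x x)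
    (h11 : ∀ S : Finset (Fin n), S.card = 11 → ∃ x ∈ S, ∃ y ∈ S, x ≠ y ∧ Cl 0 x y) :
    ∃ s ≤ 27, ∃ W : Finset (Fin n), ∃ X : Fin n → Finset (Fin n), W.card ≤ 10 ∧
      (∀ v ∈ W, ∀ x ∈ X v, ∀ y ∈ X v, Cl s x y) ∧
      (∀ v ∈ W, ∀ w ∈ W, v ≠ w → Disjoint (X v) (X w)) ∧
      (∀ v ∈ W, ∀ w ∈ W, v ≠ w → ∑ a ∈ X v, ∑ b ∈ X w, ind (Cl (s + 1) a b) ≤ 2 * α * (n : ℝ) ^ 2) ∧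
      dn (W.biUnion X)ᶜ ≤ 100 * α := by
  classical
  have hn' : (0 : ℝ) < n := by exact_mod_cast hn
  obtain ⟨s, hs, W, hW, hsep, hext⟩ := exists_level hn h11
  have refl : ∀ x, Cl s x x := fun x => S.mono (Nat.zero_le s) (by omega) (hrefl x)
  have hsep' : ∀ v ∈ W, ∀ w ∈ W, v ≠ w → ¬ Cl s v w := fun v hv w hw hvw h =>
    hsep v hv w hw hvw (S.mono (by omega) (by omega) h)
  have cover : ∀ z, ∃ v ∈ W, Cl s v z := by
    intro z
    by_cases hz : z ∈ W
    · exact ⟨z, hz, refl z⟩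
    · obtain ⟨x, hx, y, hy, hxy, hc⟩ := hext (insert z W) (card_insert_of_notMem hz)
      rw [mem_insert] at hx hy
      rcases hx with rfl | hx
      · rcases hy with rfl | hy
        · exact absurd rfl hxy
        · exact ⟨y, hy, S.symm _ _ _ hc⟩
      · rcases hy with rfl | hy
        · exact ⟨x, hx, hc⟩
        · exact absurd hc (hsep' x hx y hy hxy)
  let X : Fin n → Finset (Fin n) := fun v => univ.filter fun z => Cl s v z ∧ ∀ w ∈ W, w ≠ v → ¬ Cl s w z
  have memX : ∀ v z, z ∈ X v ↔ Cl s v z ∧ ∀ w ∈ W, w ≠ v → ¬ Cl s w z := fun v z => by simp [X]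
  refine ⟨s, hs, W, X, hW, ?_, ?_, ?_, ?_⟩
  · intro v hv x hx y hy
    rw [memX] at hx hy
    by_cases hxy : x = y
    · rw [hxy]; exact refl y
    have hxW : x ∉ W.erase v := fun h => hx.2 x (mem_of_mem_erase h) (ne_of_mem_erase h) (refl x)
    have hyW : y ∉ W.erase v := fun h => hy.2 y (mem_of_mem_erase h) (ne_of_mem_erase h) (refl y)
    have hxi : x ∉ insert y (W.erase v) := by
      rw [mem_insert]; rintro (h | h)
      · exact hxy h
      · exact hxW h
    obtain ⟨p, hp, q, hq, hpq, hc⟩ := hext (insert x (insert y (W.erase v))) (by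
      rw [card_insert_of_notMem hxi, card_insert_of_notMem hyW, card_erase_of_mem hv]
      have := card_pos.2 ⟨v, hv⟩
      omega)
    have hno : ∀ u, u ∈ W.erase v → ¬ Cl s u x ∧ ¬ Cl s u y := fun u hu =>
      ⟨hx.2 u (mem_of_mem_erase hu) (ne_of_mem_erase hu), hy.2 u (mem_of_mem_erase hu) (ne_of_mem_erase hu)⟩
    rw [mem_insert, mem_insert] at hp hq
    rcases hp with rfl | rfl | hp <;> rcases hq with rfl | rfl | hq
    · exact absurd rfl hpq
    · exact hc
    · exact absurd (S.symm _ _ _ hc) (hno q hq).1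
    · exact S.symm _ _ _ hc
    · exact absurd rfl hpq
    · exact absurd (S.symm _ _ _ hc) (hno q hq).2
    · exact absurd hc (hno p hp).1
    · exact absurd hc (hno p hp).2
    · exact absurd hc (hsep' p (mem_of_mem_erase hp) q (mem_of_mem_erase hq) hpq)
  · intro v hv w hw hvw
    rw [disjoint_left]
    intro z hz hz'
    rw [memX] at hz hz'
    exact hz.2 w hw hvw.symm hz'.1
  · intro v hv w hw hvw
    by_contra hcon
    push Not at hcon
    rw [sum_comm] at hcon
    let g : Fin n → ℝ := fun b => ∑ a ∈ X v, ind (Cl (s + 1) a b)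
    have gle : ∀ b, g b ≤ cnt (fun z => Cl (s + 1) v z ∧ Cl (s + 1) z b) := by
      intro b
      unfold cnt
      refine le_trans (sum_le_sum fun a ha => ?_)
        (sum_le_sum_of_subset_of_nonneg (subset_univ (X v)) fun _ _ _ => ind_nonneg _)
      exact ind_mono fun h => ⟨S.mono1 s (by omega) _ _ ((memX _ _).1 ha).1, h⟩
    have gn : ∀ b, g b ≤ n := fun b => (gle b).trans (by simpa using cnt_le_card (fun z => Cl (s + 1) v z ∧ Cl (s + 1) z b))
    have key : ∀ b ∈ X w, g b ≤ n * ind (α * n ≤ g b) + α * n := by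
      intro b _
      by_cases h : α * n ≤ g b
      · rw [ind_pos h]
        have := gn b
        have : 0 < α * n := by positivity
        linarith
      · rw [ind_neg h]; push Not at h; linarith
    have k2 : ∑ b ∈ X w, g b ≤ n * ∑ b ∈ X w, ind (α * n ≤ g b) + α * n * n := by
      refine (sum_le_sum key).trans ?_
      rw [sum_add_distrib, ← mul_sum, sum_const, nsmul_eq_mul]
      have : ((X w).card : ℝ) ≤ n := by
        have := card_le_univ (X w)
        rw [Fintype.card_fin] at this
        exact_mod_cast this
      have : ((X w).card : ℝ) * (α * n) ≤ n * (α * n) := mul_le_mul_of_nonneg_right this (by positivity)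
      linarith
    have k3 : ∑ b ∈ X w, ind (α * n ≤ g b) ≤ cnt (fun z => Cl (s + 2) v z ∧ Cl (s + 2) z w) := by
      unfold cnt
      refine le_trans (sum_le_sum fun b hb => ?_)
        (sum_le_sum_of_subset_of_nonneg (subset_univ (X w)) fun _ _ _ => ind_nonneg _)
      refine ind_mono fun h => ⟨?_, ?_⟩
      · exact S.p2 (s + 1) (by omega) _ _ (h.trans (gle b))
      · exact S.symm _ _ _ (S.mono (by omega) (by omega) ((memX _ _).1 hb).1)
    have k4' : α * n < ∑ b ∈ X w, ind (α * n ≤ g b) := by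
      have : 2 * α * (n : ℝ) ^ 2 < n * ∑ b ∈ X w, ind (α * n ≤ g b) + α * n * n := lt_of_lt_of_le hcon k2
      have : (n : ℝ) * (α * n) < n * ∑ b ∈ X w, ind (α * n ≤ g b) := by nlinarith
      exact lt_of_mul_lt_mul_left this hn'.le
    exact hsep v hv w hw hvw (S.p2 (s + 2) (by omega) _ _ (k4'.le.trans k3))
  · obtain ⟨D, hD⟩ : ∃ D : Finset (Fin n × Fin n), D = (W ×ˢ W).filter (fun p => p.1 ≠ p.2) := ⟨_, rfl⟩
    have hsub : ∀ z ∈ (W.biUnion X)ᶜ, ∃ p ∈ D, Cl s p.1 z ∧ Cl s z p.2 := by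
      intro z hz
      obtain ⟨v, hv, hc⟩ := cover z
      have : z ∉ X v := fun h => (mem_compl.1 hz) (mem_biUnion.2 ⟨v, hv, h⟩)
      rw [memX] at this
      push Not at this
      obtain ⟨w, hw, hwv, hwc⟩ := this hc
      exact ⟨(v, w), by rw [hD]; simp [hv, hw, hwv.symm], hc, S.symm _ _ _ hwc⟩
    have h1 : (((W.biUnion X)ᶜ).card : ℝ) ≤ cnt (fun z => ∃ p ∈ D,
        Cl s p.1 z ∧ Cl s z p.2) := by
      have e : (((W.biUnion X)ᶜ).card : ℝ) = ∑ z ∈ (W.biUnion X)ᶜ, (1 : ℝ) := by simp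
      rw [e]
      unfold cnt
      refine le_trans (sum_le_sum fun z hz => ?_)
        (sum_le_sum_of_subset_of_nonneg (subset_univ _) fun _ _ _ => ind_nonneg _)
      exact (ind_pos (hsub z hz)).ge
    have h2 := h1.trans (cnt_exists_le (D) (fun p z => Cl s p.1 z ∧ Cl s z p.2))
    have h3 : ∑ p ∈ D, cnt (fun z => Cl s p.1 z ∧ Cl s z p.2) ≤
        ∑ p ∈ D, α * n := by
      refine sum_le_sum fun p hp => ?_
      rw [hD, mem_filter, mem_product] at hp
      by_contra hcon
      push Not at hcon
      exact hsep p.1 hp.1.1 p.2 hp.1.2 hp.2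
        (S.mono (show s + 1 ≤ s + 3 by omega) (by omega) (S.p2 s (by omega) _ _ hcon.le))
    rw [sum_const, nsmul_eq_mul] at h3
    have h4 : (((D).card : ℕ) : ℝ) ≤ 100 := by
      rw [hD]
      have h5 := card_filter_le (W ×ˢ W) (fun p => p.1 ≠ p.2)
      rw [card_product] at h5
      have h6 : W.card * W.card ≤ 10 * 10 := Nat.mul_le_mul hW hW
      exact_mod_cast h5.trans h6
    have h7 := mul_le_mul_of_nonneg_right h4 (show 0 ≤ α * n by positivity)
    unfold dn
    rw [div_le_iff₀ hn']
    linarith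

lemma partition2 {α ζ : ℝ} {Cl : ℕ → Fin n → Fin n → Prop} (hn : 0 < n) (hα : 0 < α) (S : Sys H α Cl)
    (hζ : 200 * α ≤ ζ) (hrefl : ∀ x, Cl 0 x x)
    (h11 : ∀ S : Finset (Fin n), S.card = 11 → ∃ x ∈ S, ∃ y ∈ S, x ≠ y ∧ Cl 0 x y) :
    ∃ s ≤ 27, ∃ L : Finset (Finset (Fin n)), L.card ≤ 10 ∧
      (∀ A ∈ L, ∀ x ∈ A, ∀ y ∈ A, Cl s x y) ∧
      (∀ A ∈ L, ∀ B ∈ L, A ≠ B → Disjoint A B) ∧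
      (∀ A ∈ L, ∀ B ∈ L, A ≠ B → ∑ a ∈ A, ∑ b ∈ B, ind (Cl (s + 1) a b) ≤ 2 * α * (n : ℝ) ^ 2) ∧
      (∀ A ∈ L, ζ / 20 ≤ dn A) ∧
      dn (L.biUnion id)ᶜ ≤ ζ := by
  classical
  obtain ⟨s, hs, W, X, hW, hcl, hdis, hsp, hg⟩ := partition1 hn hα S hrefl h11
  have hn' : (0 : ℝ) < n := by exact_mod_cast hn
  let Wb := W.filter fun v => ζ / 20 ≤ dn (X v)
  let Ws := W.filter fun v => ¬ ζ / 20 ≤ dn (X v)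
  refine ⟨s, hs, Wb.image X, card_image_le.trans ((card_filter_le _ _).trans hW), ?_, ?_, ?_, ?_, ?_⟩
  · intro A hA
    obtain ⟨v, hv, rfl⟩ := mem_image.1 hA
    exact hcl v (mem_filter.1 hv).1
  · intro A hA B hB hAB
    obtain ⟨v, hv, rfl⟩ := mem_image.1 hA
    obtain ⟨w, hw, rfl⟩ := mem_image.1 hB
    exact hdis v (mem_filter.1 hv).1 w (mem_filter.1 hw).1 (fun h => hAB (by rw [h]))
  · intro A hA B hB hAB
    obtain ⟨v, hv, rfl⟩ := mem_image.1 hA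
    obtain ⟨w, hw, rfl⟩ := mem_image.1 hB
    exact hsp v (mem_filter.1 hv).1 w (mem_filter.1 hw).1 (fun h => hAB (by rw [h]))
  · intro A hA
    obtain ⟨v, hv, rfl⟩ := mem_image.1 hA
    exact (mem_filter.1 hv).2
  · have hsub : ((Wb.image X).biUnion id)ᶜ ⊆ (W.biUnion X)ᶜ ∪ Ws.biUnion X := by
      intro z hz
      rw [mem_union]
      by_cases h : z ∈ W.biUnion X
      · right
        obtain ⟨v, hv, hzv⟩ := mem_biUnion.1 h
        refine mem_biUnion.2 ⟨v, ?_, hzv⟩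
        refine mem_filter.2 ⟨hv, fun hc => (mem_compl.1 hz) ?_⟩
        exact mem_biUnion.2 ⟨X v, mem_image_of_mem X (mem_filter.2 ⟨hv, hc⟩), hzv⟩
      · left; exact mem_compl.2 h
    have h1 := dn_mono hsub
    have h2 : dn ((W.biUnion X)ᶜ ∪ Ws.biUnion X) ≤ dn (W.biUnion X)ᶜ + dn (Ws.biUnion X) := by
      unfold dn
      rw [← add_div]
      gcongr
      exact_mod_cast card_union_le _ _
    have h3 : dn (Ws.biUnion X) ≤ ∑ v ∈ Ws, dn (X v) := by
      unfold dn
      rw [← sum_div]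
      gcongr
      exact_mod_cast card_biUnion_le
    have h4 : ∑ v ∈ Ws, dn (X v) ≤ ∑ v ∈ Ws, ζ / 20 := sum_le_sum fun v hv =>
      (not_le.1 (mem_filter.1 hv).2).le
    rw [sum_const, nsmul_eq_mul] at h4
    have h5 : (Ws.card : ℝ) ≤ 10 := by exact_mod_cast (card_filter_le _ _).trans hW
    have h6 := mul_le_mul_of_nonneg_right h5 (show 0 ≤ ζ / 20 by linarith)
    linarith

end

section
variable {n : ℕ} {H : Finset (Finset (Fin n))}

lemma spans_edge {x y a b : Fin n} (h : SpansK4m H {x, y, a, b}) :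
    ({x, a, b} : Finset (Fin n)) ∈ H ∨ ({y, a, b} : Finset (Fin n)) ∈ H := by
  classical
  obtain ⟨hc, h3⟩ := h
  by_contra hcon
  push Not at hcon
  have hx : x ∉ ({y, a, b} : Finset (Fin n)) := by
    intro hx
    rw [insert_eq_of_mem hx] at hc
    have := card_le_three (a := y) (b := a) (c := b)
    omega
  have hy : y ∉ ({x, a, b} : Finset (Fin n)) := by
    intro hy
    rw [insert_comm, insert_eq_of_mem hy] at hc
    have := card_le_three (a := x) (b := a) (c := b)
    omega
  have cA : ({x, a, b} : Finset (Fin n)).card = 3 := by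
    rw [insert_comm, card_insert_of_notMem hy] at hc; omega
  have cB : ({y, a, b} : Finset (Fin n)).card = 3 := by
    rw [card_insert_of_notMem hx] at hc; omega
  have hAB : ({x, a, b} : Finset (Fin n)) ≠ {y, a, b} := by
    intro h
    apply hx
    rw [← h]; simp
  have mA : ({x, a, b} : Finset (Fin n)) ∈ ({x, y, a, b} : Finset (Fin n)).powersetCard 3 := by
    rw [mem_powersetCard]
    refine ⟨?_, cA⟩
    rw [insert_comm x y]; exact subset_insert y _
  have mB : ({y, a, b} : Finset (Fin n)) ∈ ({x, y, a, b} : Finset (Fin n)).powersetCard 3 := by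
    rw [mem_powersetCard]
    exact ⟨subset_insert _ _, cB⟩
  have hsub : (({x, y, a, b} : Finset (Fin n)).powersetCard 3).filter (· ∈ H) ⊆
      ((({x, y, a, b} : Finset (Fin n)).powersetCard 3).erase {x, a, b}).erase {y, a, b} := by
    intro e he
    rw [mem_filter] at he
    refine mem_erase.2 ⟨?_, mem_erase.2 ⟨?_, he.1⟩⟩
    · rintro rfl; exact hcon.2 he.2
    · rintro rfl; exact hcon.1 he.2
  have h5 := card_le_card hsub
  rw [card_erase_of_mem (mem_erase.2 ⟨hAB.symm, mB⟩), card_erase_of_mem mA, card_powersetCard, hc] at h5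
  have : Nat.choose 4 3 = 4 := by decide
  omega

lemma k4_le_edges (x y a b : Fin n) :
    k4 H x y a b ≤ hh H x a b * k4 H x y a b + hh H y a b * k4 H x y a b := by
  have h0 := hh_nonneg (H := H) x a b
  have h1 := hh_nonneg (H := H) y a b
  by_cases h : SpansK4m H {x, y, a, b}
  · have e : k4 H x y a b = 1 := ind_pos h
    rw [e]
    rcases spans_edge h with h | h
    · have : hh H x a b = 1 := ind_pos h
      linarith
    · have : hh H y a b = 1 := ind_pos h
      linarith
  · have e : k4 H x y a b = 0 := ind_neg h
    rw [e]; simp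

lemma card_le_n (A : Finset (Fin n)) : (A.card : ℝ) ≤ n := by
  have := card_le_univ A
  rw [Fintype.card_fin] at this
  exact_mod_cast this

lemma pair_count (A B : Finset (Fin n)) (f : Fin n → Fin n → ℝ) (R : Fin n → Fin n → Prop) (M α c : ℝ)
    (hM : 0 ≤ M) (hα : 0 ≤ α) (h1 : ∀ a b, f a b ≤ M) (h2 : ∀ a b, α * M ≤ f a b → R a b)
    (h3 : ∑ a ∈ A, ∑ b ∈ B, ind (R a b) ≤ c * (n : ℝ) ^ 2) :
    ∑ a ∈ A, ∑ b ∈ B, f a b ≤ (c + α) * M * (n : ℝ) ^ 2 := by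
  have h4 : ∑ a ∈ A, ∑ b ∈ B, f a b ≤ ∑ a ∈ A, ∑ b ∈ B, (M * ind (R a b) + α * M) := by
    refine sum_le_sum fun a _ => sum_le_sum fun b _ => ?_
    by_cases h : R a b
    · rw [ind_pos h]
      have := h1 a b
      have : 0 ≤ α * M := by positivity
      linarith
    · rw [ind_neg h]
      have := lt_of_not_ge (fun hc => h (h2 a b hc))
      linarith
  simp only [sum_add_distrib, ← mul_sum, sum_const, nsmul_eq_mul] at h4
  have h5 : (A.card : ℝ) * ((B.card : ℝ) * (α * M)) ≤ n * (n * (α * M)) := by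
    have := card_le_n A
    have := card_le_n B
    gcongr
  have h6 := mul_le_mul_of_nonneg_left h3 hM
  linarith

lemma ph_le_prod (P Q R : Finset (Fin n)) (x : Fin n) : ph H P Q R x ≤ P.card * (Q.card * R.card) := by
  calc ph H P Q R x ≤ ∑ a ∈ P, ∑ b ∈ Q, ∑ c ∈ R, (1 : ℝ) :=
        sum_le_sum fun a _ => sum_le_sum fun b _ => sum_le_sum fun c _ => k4_le_one _ _ _ _
    _ = _ := by simp

lemma ph_le_n (P Q R : Finset (Fin n)) (x : Fin n) : ph H P Q R x ≤ (n : ℝ) ^ 3 := by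
  refine (ph_le_prod P Q R x).trans ?_
  calc (P.card : ℝ) * (Q.card * R.card) ≤ n * (n * n) := by
        have := card_le_n P
        have := card_le_n Q
        have := card_le_n R
        gcongr
    _ = _ := by ring

lemma ph_restrict (X : Finset (Fin n)) (x : Fin n) :
    ph H univ univ univ x ≤ ph H X X X x + 3 * (Xᶜ.card * (n : ℝ) ^ 2) := by
  have a1 : ph H univ univ univ x = ph H X univ univ x + ph H Xᶜ univ univ x := by
    unfold ph; rw [sum_add_sum_compl]
  have a2 : ph H X univ univ x = ph H X X univ x + ph H X Xᶜ univ x := by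
    unfold ph; rw [← sum_add_distrib]
    exact sum_congr rfl fun a _ => (sum_add_sum_compl _ _).symm
  have a3 : ph H X X univ x = ph H X X X x + ph H X X Xᶜ x := by
    unfold ph; simp only [← sum_add_distrib]
    exact sum_congr rfl fun a _ => sum_congr rfl fun b _ => (sum_add_sum_compl _ _).symm
  have b1 := ph_le_prod (H := H) Xᶜ univ univ x
  have b2 := ph_le_prod (H := H) X Xᶜ univ x
  have b3 := ph_le_prod (H := H) X X Xᶜ x
  simp only [card_univ, Fintype.card_fin] at b1 b2 b3
  have hX := card_le_n X
  have c2 : (X.card : ℝ) * (Xᶜ.card * n) ≤ n * (Xᶜ.card * n) := by gcongr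
  have c3 : (X.card : ℝ) * (X.card * Xᶜ.card) ≤ n * (n * Xᶜ.card) := by gcongr
  nlinarith

/-- small classes are impossible -/
lemma small_class {h β ζ : ℝ} (G : Good H h (1 / n)) (X O Z : Finset (Fin n)) (hβ : 0 < β)
    (hβX : 100 * β ≤ dn X ^ 2) (hnX : 100 * (1 / (n : ℝ)) ≤ dn X ^ 2) (hX0 : 0 < dn X) (hX : dn X < 0.24)
    (hcov : univ = X ∪ (O ∪ Z)) (hZ : dn Z ≤ ζ) (hζ : ζ ≤ 0.0001)
    (hov : ∑ a ∈ X, ∑ b ∈ O, ov H a b ≤ β / 10 ^ 4 * (n : ℝ) ^ 5) : False := by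
  have hn' : (0 : ℝ) < n := by exact_mod_cast G.hn
  rcases le_or_gt (KN H X X univ univ) β with hK | hK
  · exact lemS1 G X β hK hβX hnX hX0
  set T := ∑ x ∈ X, ∑ a, ∑ b, ∑ y ∈ X, hh H x a b * k4 H x a b y with hT
  have k1 : β * (n : ℝ) ^ 4 ≤ 2 * T := by
    unfold KN at hK
    rw [lt_div_iff₀ (by positivity)] at hK
    refine hK.le.trans ?_
    have s1 : ∑ x ∈ X, ∑ y ∈ X, ∑ a, ∑ b, hh H x a b * k4 H x y a b = T := by
      rw [hT]
      refine sum_congr rfl fun x _ => ?_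
      rw [sum_comm]
      refine sum_congr rfl fun a _ => ?_
      rw [sum_comm]
      refine sum_congr rfl fun b _ => sum_congr rfl fun y _ => ?_
      rw [k4_23, k4_34]
    have s2 : ∑ x ∈ X, ∑ y ∈ X, ∑ a, ∑ b, hh H y a b * k4 H x y a b = T := by
      rw [← s1, sum_comm]
      refine sum_congr rfl fun x _ => sum_congr rfl fun y _ => sum_congr rfl fun a _ => sum_congr rfl fun b _ => ?_
      rw [k4_12]
    calc ∑ x ∈ X, ∑ y ∈ X, ∑ a, ∑ b, k4 H x y a b
        ≤ ∑ x ∈ X, ∑ y ∈ X, ∑ a, ∑ b, (hh H x a b * k4 H x y a b + hh H y a b * k4 H x y a b) :=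
          sum_le_sum fun x _ => sum_le_sum fun y _ => sum_le_sum fun a _ => sum_le_sum fun b _ =>
            k4_le_edges x y a b
      _ = 2 * T := by
          simp only [sum_add_distrib]
          rw [s1, s2]; ring
  have hXc : (X.card : ℝ) ≤ 0.24 * n := by
    unfold dn at hX
    rw [div_lt_iff₀ hn'] at hX
    exact hX.le
  have hZc : (Z.card : ℝ) ≤ 0.0001 * n := by
    have := hZ.trans hζ
    unfold dn at this
    rwa [div_le_iff₀ hn'] at this
  have k2 : ∀ x a b, hh H x a b * (0.009 * n) ≤ hh H x a b * ∑ z ∈ O, k4 H x a b z := by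
    intro x a b
    have e := edge_k4 G x a b
    rw [← mul_sum] at e
    by_cases hE : ({x, a, b} : Finset (Fin n)) ∈ H
    · have e0 : hh H x a b = 1 := ind_pos hE
      rw [e0] at e ⊢
      have u1 : ∑ z, k4 H x a b z ≤ ∑ z ∈ X, k4 H x a b z + (∑ z ∈ O, k4 H x a b z + ∑ z ∈ Z, k4 H x a b z) := by
        have un : ∀ P Q : Finset (Fin n), ∑ z ∈ P ∪ Q, k4 H x a b z ≤
            ∑ z ∈ P, k4 H x a b z + ∑ z ∈ Q, k4 H x a b z := by
          intro P Q
          rw [← sum_union_inter]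
          have : 0 ≤ ∑ z ∈ P ∩ Q, k4 H x a b z := sum_nonneg fun _ _ => k4_nonneg _ _ _ _
          linarith
        have := un X (O ∪ Z)
        rw [← hcov] at this
        have := un O Z
        linarith
      have cb : ∀ P : Finset (Fin n), ∑ z ∈ P, k4 H x a b z ≤ P.card := fun P =>
        (sum_le_sum fun z _ => k4_le_one _ _ _ _).trans (by simp)
      have := cb X
      have := cb Z
      norm_num at e ⊢
      norm_num at hXc hZc
      linarith
    · have e0 : hh H x a b = 0 := ind_neg hE
      simp [e0]
  have k3 : T * (0.009 * n) ≤ ∑ y ∈ X, ∑ z ∈ O, ov H y z := by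
    have e1 : ∑ y ∈ X, ∑ z ∈ O, ov H y z = ∑ p, ∑ q, ∑ r, ∑ y ∈ X, ∑ z ∈ O, k4 H p q r y * k4 H p q r z := by
      rw [← swap3]
      refine sum_congr rfl fun y _ => ?_
      unfold ov
      exact swap3 O univ univ univ _
    rw [e1, hT]
    simp only [sum_mul]
    refine le_trans (sum_le_sum fun x hx => ?_) (sum_le_sum_of_subset_of_nonneg (subset_univ X) fun p _ _ =>
      sum_nonneg fun q _ => sum_nonneg fun r _ => sum_nonneg fun y _ => sum_nonneg fun z _ =>
        mul_nonneg (k4_nonneg _ _ _ _) (k4_nonneg _ _ _ _))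
    refine sum_le_sum fun a _ => sum_le_sum fun b _ => sum_le_sum fun y _ => ?_
    rw [← mul_sum]
    have hk := k4_nonneg (H := H) x a b y
    have hs : 0 ≤ ∑ z ∈ O, k4 H x a b z := sum_nonneg fun _ _ => k4_nonneg _ _ _ _
    calc hh H x a b * k4 H x a b y * (0.009 * n) = k4 H x a b y * (hh H x a b * (0.009 * n)) := by ring
      _ ≤ k4 H x a b y * (hh H x a b * ∑ z ∈ O, k4 H x a b z) := mul_le_mul_of_nonneg_left (k2 x a b) hk
      _ ≤ k4 H x a b y * (1 * ∑ z ∈ O, k4 H x a b z) := by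
          have := hh_le_one (H := H) x a b
          gcongr
      _ = _ := by ring
  have k5 := mul_le_mul_of_nonneg_right k1 (show 0 ≤ 0.009 * (n : ℝ) by positivity)
  have pos : 0 < β * (n : ℝ) ^ 5 := by positivity
  norm_num at k5 k3 hov
  nlinarith

end

section
variable {n : ℕ} {H : Finset (Finset (Fin n))}

theorem all_close {γ ζ α : ℝ} {Cl : ℕ → Fin n → Fin n → Prop} (hγ : 0 < γ) (hγ1 : γ ≤ 1 / 10 ^ 8)
    (hζ : ζ = γ / 10 ^ 7) (hα : α = (ζ / 20) ^ 2 / 10 ^ 8)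
    (G : Good H (1 / 2 - γ) (1 / n)) (hn2 : 100 * (1 / (n : ℝ)) ≤ (ζ / 20) ^ 2) (S : Sys H α Cl)
    (hne : ¬ IsExtremal H (3 * γ)) : ∀ x y, Cl 30 x y := by
  classical
  have hn := G.hn
  have hn' : (0 : ℝ) < n := by exact_mod_cast hn
  have ζ0 : 0 < ζ := by rw [hζ]; positivity
  have ζ1 : ζ ≤ 1 / 10 ^ 15 := by
    rw [hζ]
    have := div_le_div_of_nonneg_right hγ1 (show (0 : ℝ) ≤ 10 ^ 7 by norm_num)
    norm_num at this ⊢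
    linarith
  have α0 : 0 < α := by rw [hα]; positivity
  have hα2 : α * (400 * 10 ^ 8) = ζ ^ 2 := by rw [hα]; ring
  have ζsq : ζ ^ 2 ≤ ζ * (1 / 10 ^ 15) := by rw [sq]; exact mul_le_mul_of_nonneg_left ζ1 ζ0.le
  have αζ : 200 * α ≤ ζ := by norm_num at ζsq hα2 ⊢; linarith
  have α1 : α ≤ 0.001 := by norm_num at ζ1 ⊢; linarith
  have hrefl : ∀ x, Cl 0 x x := by
    intro x
    refine S.p0 x x ?_
    change _ ≤ ov H x x
    rw [ov_self]
    refine le_trans ?_ (ph_big G x)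
    have : α ≤ 0.11 := by norm_num at α1 ⊢; linarith
    gcongr
  obtain ⟨s, hs, L, hLc, hcl, hdis, hsp, hbig, hg⟩ := partition2 hn α0 S αζ hrefl (by
    intro T hT
    obtain ⟨x, hx, y, hy, hxy, h⟩ := pair11 G α1 T hT
    exact ⟨x, hx, y, hy, hxy, S.p0 x y h⟩)
  rcases Nat.lt_or_ge L.card 2 with h1 | h2
  · -- at most one class
    have hne0 : L.Nonempty := by
      rw [nonempty_iff_ne_empty]
      rintro rfl
      simp only [biUnion_empty, compl_empty, dn_univ hn] at hg
      norm_num at ζ1; linarith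
    obtain ⟨X, rfl⟩ := card_eq_one.1 (show L.card = 1 by have := card_pos.2 hne0; omega)
    rw [singleton_biUnion] at hg
    simp only [id] at hg
    have hXc : (Xᶜ.card : ℝ) ≤ 0.001 * n := by
      unfold dn at hg
      rw [div_le_iff₀ hn'] at hg
      refine hg.trans ?_
      have : ζ ≤ 0.001 := ζ1.trans (by norm_num)
      gcongr
    have hp : ∀ x, 0.1 * (n : ℝ) ^ 3 ≤ ph H X X X x := by
      intro x
      have h1 := ph_big G x
      have h2 := ph_restrict (H := H) X x
      have h3 : (Xᶜ.card : ℝ) * (n : ℝ) ^ 2 ≤ 0.001 * n * (n : ℝ) ^ 2 := by gcongr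
      have : 0 < (n : ℝ) ^ 3 := by positivity
      norm_num at h1 h3 ⊢
      nlinarith
    have hX := hcl X (mem_singleton_self X)
    intro x y
    refine S.mono (show s + 1 ≤ 30 by omega) le_rfl (S.p3 s (by omega) x y X X X hX hX hX ?_)
    calc α * (n : ℝ) ^ 6 ≤ (0.1 * (n : ℝ) ^ 3) * (0.1 * (n : ℝ) ^ 3) := by
          have : α ≤ 0.01 := α1.trans (by norm_num)
          have h6 : 0 < (n : ℝ) ^ 6 := by positivity
          have := mul_le_mul_of_nonneg_right this h6.le
          norm_num at this ⊢
          nlinarith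
      _ ≤ _ := mul_le_mul (hp x) (hp y) (by positivity) (ph_nonneg _ _ _ _)
  · exfalso
    have G' : Good H (1 / 2 - γ) (5 * ζ) := by
      refine ⟨G.h3, G.hn, ?_, G.h1, G.h2, ?_, G.cod⟩
      · have : (ζ / 20) ^ 2 = ζ ^ 2 / 400 := by ring
        rw [this] at hn2
        norm_num at hn2 ζsq ⊢
        linarith
      · norm_num at ζ1 ⊢; linarith
    refine hne (structural (γ := γ) (ζ := ζ) hγ G' ?_ L hdis ?_ h2 hg ?_)
    · rw [hζ]; norm_num; linarith
    · -- big classes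
      intro X hX
      by_contra hcon
      push Not at hcon
      have hXζ := hbig X hX
      have hX0 : 0 < dn X := lt_of_lt_of_le (by positivity) hXζ
      have hXsq : (ζ / 20) ^ 2 ≤ dn X ^ 2 := by gcongr
      refine small_class (β := (ζ / 20) ^ 2 / 100) G X ((L.erase X).biUnion id) (L.biUnion id)ᶜ (by positivity)
        (by linarith) (hn2.trans hXsq) hX0 hcon ?_ hg (ζ1.trans (by norm_num)) ?_
      · symm
        rw [eq_univ_iff_forall]
        intro z
        rw [mem_union, mem_union]
        by_cases hz : z ∈ L.biUnion id
        · obtain ⟨A, hA, hzA⟩ := mem_biUnion.1 hz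
          by_cases hAX : A = X
          · left; rw [← hAX]; exact hzA
          · right; left; exact mem_biUnion.2 ⟨A, mem_erase.2 ⟨hAX, hA⟩, hzA⟩
        · right; right; exact mem_compl.2 hz
      · have c := pair_count X ((L.erase X).biUnion id) (ov H) (Cl (s + 1)) ((n : ℝ) ^ 3) α (20 * α)
          (by positivity) α0.le ov_le
          (fun a b h => S.mono (Nat.zero_le _) (by omega) (S.p0 a b h)) ?_
        · refine c.trans ?_
          have : (ζ / 20) ^ 2 / 100 / 10 ^ 4 = 100 * α := by rw [hα]; ring
          rw [this]
          have : 0 < α * (n : ℝ) ^ 5 := by positivity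
          nlinarith
        · have hd : Set.PairwiseDisjoint (↑(L.erase X)) (id : Finset (Fin n) → Finset (Fin n)) :=
            fun A hA B hB hAB => hdis A (mem_of_mem_erase hA) B (mem_of_mem_erase hB) hAB
          have e : ∀ a ∈ X, ∑ b ∈ (L.erase X).biUnion id, ind (Cl (s + 1) a b) =
              ∑ B ∈ L.erase X, ∑ b ∈ B, ind (Cl (s + 1) a b) := fun a _ => sum_biUnion hd
          rw [sum_congr rfl e, sum_comm]
          calc _ ≤ ∑ B ∈ L.erase X, 2 * α * (n : ℝ) ^ 2 := sum_le_sum fun B hB =>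
                hsp X hX B (mem_of_mem_erase hB) (ne_of_mem_erase hB).symm
            _ = (L.erase X).card * (2 * α * (n : ℝ) ^ 2) := by rw [sum_const, nsmul_eq_mul]
            _ ≤ 10 * (2 * α * (n : ℝ) ^ 2) := by
                have : ((L.erase X).card : ℝ) ≤ 10 := by
                  exact_mod_cast (card_le_card (erase_subset _ _)).trans hLc
                gcongr
            _ = _ := by ring
    · intro P hP Q hQ R hR A hA B hB hAB kA kB
      have c := pair_count A B (fun a b => ph H P Q R a * ph H P Q R b) (Cl (s + 1)) ((n : ℝ) ^ 6) α (2 * α)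
        (by positivity) α0.le (fun a b => by
          calc ph H P Q R a * ph H P Q R b ≤ (n : ℝ) ^ 3 * (n : ℝ) ^ 3 :=
                mul_le_mul (ph_le_n _ _ _ _) (ph_le_n _ _ _ _) (ph_nonneg _ _ _ _) (by positivity)
            _ = _ := by ring)
        (fun a b h => S.p3 s (by omega) a b P Q R (hcl P hP) (hcl Q hQ) (hcl R hR) h) (hsp A hA B hB hAB)
      have e : ∀ A : Finset (Fin n), ζ ≤ KN H P Q R A → ζ * (n : ℝ) ^ 4 ≤ ∑ a ∈ A, ph H P Q R a := by
        intro A kA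
        unfold KN at kA
        rw [le_div_iff₀ (by positivity)] at kA
        refine kA.trans (le_of_eq ?_)
        exact (swap3 A P Q R fun d a b c => k4 H a b c d).symm
      simp only [← mul_sum, ← sum_mul] at c
      have m := mul_le_mul (e A kA) (e B kB) (by positivity) (sum_nonneg fun _ _ => ph_nonneg _ _ _ _)
      have n8 : 0 < (n : ℝ) ^ 8 := by positivity
      have m2 : ζ ^ 2 * (n : ℝ) ^ 8 ≤ 3 * α * (n : ℝ) ^ 8 := by
        calc _ = ζ * (n : ℝ) ^ 4 * (ζ * (n : ℝ) ^ 4) := by ring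
          _ ≤ _ := m.trans c
          _ = _ := by ring
      have m3 := le_of_mul_le_mul_right m2 n8
      norm_num at hα2
      linarith

end

/-- the absorbing lemma in the non-extremal case. -/
theorem stmt_2 :
    ∃ γ₀ : ℝ, 0 < γ₀ ∧ ∀ γ : ℝ, 0 < γ → γ ≤ γ₀ →
      ∃ ε₀ : ℝ, 0 < ε₀ ∧ ∀ ε : ℝ, 0 < ε → ε ≤ ε₀ →
        ∃ φ₀ : ℝ, 0 < φ₀ ∧ ∀ φ : ℝ, 0 < φ → φ ≤ φ₀ →
          ∃ n₀ : ℕ, ∀ n : ℕ, n₀ ≤ n →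
            ∀ H : Finset (Finset (Fin n)), Is3Graph n H →
              CodegLB H ((1 / 2 - γ) * n) →
              ¬ IsExtremal H (3 * γ) →
              ∃ W : Finset (Fin n), (W.card : ℝ) ≤ ε * n ∧
                ∀ U : Finset (Fin n), U ⊆ Finset.univ \ W →
                  (U.card : ℝ) ≤ φ * n → 4 ∣ U.card →
                  HasK4mFactorOn H W ∧ HasK4mFactorOn H (U ∪ W) := by
  refine ⟨1 / 10 ^ 8, by norm_num, fun γ hγ hγ1 => ⟨1, by norm_num, fun ε hε _ => ?_⟩⟩
  obtain ⟨ζ, hζ⟩ : ∃ ζ : ℝ, ζ = γ / 10 ^ 7 := ⟨_, rfl⟩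
  obtain ⟨α, hα⟩ : ∃ α : ℝ, α = (ζ / 20) ^ 2 / 10 ^ 8 := ⟨_, rfl⟩
  obtain ⟨κ, hκ⟩ : ∃ κ : ℝ, κ = 0.1 := ⟨_, rfl⟩
  have ζ0 : 0 < ζ := by rw [hζ]; positivity
  have ζ1 : ζ ≤ 1 := by
    rw [hζ, div_le_one (by norm_num)]
    exact hγ1.trans (by norm_num)
  have α0 : 0 < α := by rw [hα]; positivity
  have α1 : α ≤ 1 := by
    have : (ζ / 20) ^ 2 ≤ 1 := pow_le_one₀ (by positivity) (by linarith)
    rw [hα, div_le_one (by norm_num)]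
    exact this.trans (by norm_num)
  have κ0 : 0 < κ := by rw [hκ]; norm_num
  have κ1 : κ ≤ 1 := by rw [hκ]; norm_num
  obtain ⟨n1, hn1⟩ := large_n α0 κ0
  obtain ⟨η, hη⟩ : ∃ η : ℝ, η = ee α κ 30 := ⟨_, rfl⟩
  obtain ⟨m, hm⟩ : ∃ m : ℕ, m = 4 * kk 30 + 3 := ⟨_, rfl⟩
  have η0 : 0 < η := by rw [hη]; exact ee_pos α0 κ0 30
  have η1 : η ≤ 1 := by rw [hη]; exact ee_le α0 α1 κ0 κ1 30
  obtain ⟨β, hβ⟩ : ∃ β : ℝ, β = κ * η ^ 4 / 2 := ⟨_, rfl⟩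
  have β0 : 0 < β := by rw [hβ]; positivity
  have β1 : β ≤ 1 := by
    have h1 : η ^ 4 ≤ 1 := pow_le_one₀ η0.le η1
    have h2 : κ * η ^ 4 ≤ 1 := mul_le_one₀ κ1 (by positivity) h1
    rw [hβ]; linarith
  obtain ⟨φ₀, hφ₀, n2, hn2⟩ := absorb (J := Fin 4 ⊕ (Fin 4 × Fin m)) β ε β0 β1 hε
  refine ⟨φ₀, hφ₀, fun φ _ hφ1 => ?_⟩
  obtain ⟨n3, hn3⟩ := exists_nat_ge ((((4 * m + 4 : ℕ) : ℝ) ^ 2 + 4 * (4 * m + 4 : ℕ)) / β)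
  obtain ⟨n4, hn4⟩ := exists_nat_ge (100 / (ζ / 20) ^ 2)
  refine ⟨max (max n1 n2) (max (max n3 n4) (10 ^ 14)), fun n hn H h3 hcod hext => ?_⟩
  have b1 : n1 ≤ n := le_trans (by simp) hn
  have b2 : n2 ≤ n := le_trans (by simp) hn
  have b3 : n3 ≤ n := le_trans (by simp) hn
  have b4 : n4 ≤ n := le_trans (by simp) hn
  have b5 : 10 ^ 14 ≤ n := le_trans (by simp) hn
  have hn0 : 0 < n := lt_of_lt_of_le (by norm_num) b5
  have hn' : (0 : ℝ) < n := by exact_mod_cast hn0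
  have b5' : (10 : ℝ) ^ 14 ≤ n := by exact_mod_cast b5
  have G : Good H (1 / 2 - γ) (1 / n) := by
    refine ⟨h3, hn0, le_rfl, by linarith, by linarith, ?_, ?_⟩
    · exact one_div_le_one_div_of_le (by norm_num) b5'
    · intro a b
      by_cases hab : a = b
      · have e1 : dd a b = 1 := ind_pos hab
        rw [e1]
        have := NN_nonneg (H := H) univ a b
        linarith
      · have e1 : dd a b = 0 := ind_neg hab
        have h := hcod a b hab
        have e2 : ((degOn H a b univ : ℕ) : ℝ) = ∑ z, hh H a b z := by
          have := cnt_eq_card (fun z : Fin n => ({a, b, z} : Finset (Fin n)) ∈ H)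
          unfold degOn
          rw [← this]; rfl
        rw [e1]
        unfold NN
        rw [le_div_iff₀ hn', ← e2]
        linarith
  have hK : κ * (n : ℝ) ^ 4 ≤ cnt (fun s : Fin 4 → Fin n => KK H s) := by rw [hκ]; exact KK_big G
  have S := sys_mk α0 α1 κ0 κ1 (fun t ht => hn1 n b1 t ht) hK
  have hlarge : 100 * (1 / (n : ℝ)) ≤ (ζ / 20) ^ 2 := by
    have : 100 / (ζ / 20) ^ 2 ≤ (n : ℝ) := hn4.trans (by exact_mod_cast b4)
    rw [div_le_iff₀ (by positivity)] at this
    rw [mul_one_div, div_le_iff₀ hn']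
    linarith
  have hall := all_close hγ hγ1 hζ hα G hlarge S hext
  have hcl : ∀ x y, CloseT H m η x y := by
    intro x y
    have h := hall x y
    beta_reduce at h
    rw [← hm, ← hη] at h
    exact h
  obtain ⟨W, hW, hU⟩ := hn2 n b2 H (by
    intro x hx
    have hc : Fintype.card (Fin 4 ⊕ (Fin 4 × Fin m)) = 4 * m + 4 := by
      simp; ring
    rw [hc]
    refine abs_count κ η β η0.le β0 m (by rw [hβ]; linarith) ?_ hK hcl x hx
    have : _ ≤ (n : ℝ) := hn3.trans (by exact_mod_cast b3)
    rw [div_le_iff₀ β0] at this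
    linarith)
  refine ⟨W, hW, fun U hUW hUc h4 => hU U hUW (hUc.trans ?_) h4⟩
  gcongr
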